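/- arXiv:1105.1979 — 2 statements merged into one kernel-verified Lean document; each statement's English description precedes it below -/
import Mathlib

section
/- Let (A_k, γ_k) be an inductive system of C*-algebras in which every connecting *-homomorphism γ_k : A_k → A_{k+1} is semiprojective, and let A be its inductive limit. Assume that for every C*-algebra D, every semiprojective *-homomorphism D → A is null-homotopic. Then for each index k there exists an index k' ≥ k such that the composition γ_{k',k} : A_k → A_{k'} is null-homotopic. -/
open Filter Topology Set

noncomputable section

universe u v

/-- The iterated connecting morphisms `γ_{k+n,k} : A_k → A_{k+n}` of an inductive system. -/
def iterHom {A : ℕ → Type u} [∀ k, NonUnitalCStarAlgebra (A k)]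
    (γ : ∀ k, A k →⋆ₙₐ[ℂ] A (k + 1)) : ∀ k n : ℕ, A k →⋆ₙₐ[ℂ] A (k + n)
  | _, 0 => NonUnitalStarAlgHom.id ℂ _
  | k, n + 1 => (γ (k + n)).comp (iterHom γ k n)

/-- `(L, μ)` is the inductive limit of the inductive system `(A, γ)` of C*-algebras. -/
structure IsInductiveLimit {A : ℕ → Type u} [∀ k, NonUnitalCStarAlgebra (A k)]
    (γ : ∀ k, A k →⋆ₙₐ[ℂ] A (k + 1)) (L : Type v) [NonUnitalCStarAlgebra L]
    (μ : ∀ k, A k →⋆ₙₐ[ℂ] L) : Prop where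
  compat : ∀ k, (μ (k + 1)).comp (γ k) = μ k
  dense_union : Dense (⋃ k, Set.range (μ k))
  norm_tendsto : ∀ (k : ℕ) (a : A k),
    Tendsto (fun n => ‖iterHom γ k n a‖) atTop (𝓝 ‖μ k a‖)

/-- Two *-homomorphisms are homotopic if they are connected by a path of *-homomorphisms,
i.e. by a *-homomorphism into `C([0,1], B)`. -/
def Homotopic {A : Type u} {B : Type v} [NonUnitalCStarAlgebra A] [NonUnitalCStarAlgebra B]
    (φ ψ : A →⋆ₙₐ[ℂ] B) : Prop :=
  ∃ H : A →⋆ₙₐ[ℂ] C(unitInterval, B), (∀ a, H a 0 = φ a) ∧ (∀ a, H a 1 = ψ a)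

/-- A *-homomorphism is null-homotopic if it is homotopic to the zero morphism. -/
def NullHomotopic {A : Type u} {B : Type v} [NonUnitalCStarAlgebra A] [NonUnitalCStarAlgebra B]
    (φ : A →⋆ₙₐ[ℂ] B) : Prop :=
  Homotopic φ 0

/-- A C*-algebra is contractible if its identity is null-homotopic. -/
def Contractible (A : Type u) [NonUnitalCStarAlgebra A] : Prop :=
  NullHomotopic (NonUnitalStarAlgHom.id ℂ A)

/-- A projective *-homomorphism between C*-algebras. -/
def IsProjectiveMorphism {A B : Type u} [NonUnitalCStarAlgebra A] [NonUnitalCStarAlgebra B]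
    (φ : A →⋆ₙₐ[ℂ] B) : Prop :=
  ∀ (C D : Type u) [NonUnitalCStarAlgebra C] [NonUnitalCStarAlgebra D]
    (π : C →⋆ₙₐ[ℂ] D), Function.Surjective π → ∀ σ : B →⋆ₙₐ[ℂ] D,
    ∃ ψ : A →⋆ₙₐ[ℂ] C, π.comp ψ = σ.comp φ

/-- A projective C*-algebra. -/
def IsProjective (A : Type u) [NonUnitalCStarAlgebra A] : Prop :=
  IsProjectiveMorphism (NonUnitalStarAlgHom.id ℂ A)

/-- A semiprojective *-homomorphism between C*-algebras. -/
def IsSemiprojectiveMorphism {A B : Type u} [NonUnitalCStarAlgebra A] [NonUnitalCStarAlgebra B]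
    (φ : A →⋆ₙₐ[ℂ] B) : Prop :=
  ∀ (C : ℕ → Type u) [∀ k, NonUnitalCStarAlgebra (C k)]
    (δ : ∀ k, C k →⋆ₙₐ[ℂ] C (k + 1)), (∀ k, Function.Surjective (δ k)) →
    ∀ (L : Type u) [NonUnitalCStarAlgebra L] (μ : ∀ k, C k →⋆ₙₐ[ℂ] L),
    IsInductiveLimit δ L μ → ∀ σ : B →⋆ₙₐ[ℂ] L,
    ∃ (k : ℕ) (ψ : A →⋆ₙₐ[ℂ] C k), (μ k).comp ψ = σ.comp φ

/-- A semiprojective C*-algebra. -/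
def IsSemiprojective (A : Type u) [NonUnitalCStarAlgebra A] : Prop :=
  IsSemiprojectiveMorphism (NonUnitalStarAlgHom.id ℂ A)

/-- A weakly semiprojective *-homomorphism between C*-algebras. -/
def IsWeaklySemiprojectiveMorphism {A B : Type u} [NonUnitalCStarAlgebra A]
    [NonUnitalCStarAlgebra B] (φ : A →⋆ₙₐ[ℂ] B) : Prop :=
  ∀ (C : ℕ → Type u) [∀ k, NonUnitalCStarAlgebra (C k)]
    (δ : ∀ k, C k →⋆ₙₐ[ℂ] C (k + 1)), (∀ k, Function.Surjective (δ k)) →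
    ∀ (L : Type u) [NonUnitalCStarAlgebra L] (μ : ∀ k, C k →⋆ₙₐ[ℂ] L),
    IsInductiveLimit δ L μ → ∀ σ : B →⋆ₙₐ[ℂ] L,
    ∀ ε : ℝ, 0 < ε → ∀ F : Finset A,
    ∃ (k : ℕ) (ψ : A →⋆ₙₐ[ℂ] C k), ∀ x ∈ F, ‖μ k (ψ x) - σ (φ x)‖ < ε

/-- A weakly semiprojective C*-algebra. -/
def IsWeaklySemiprojective (A : Type u) [NonUnitalCStarAlgebra A] : Prop :=
  IsWeaklySemiprojectiveMorphism (NonUnitalStarAlgHom.id ℂ A)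

/-- A weakly projective C*-algebra. -/
def IsWeaklyProjective (A : Type u) [NonUnitalCStarAlgebra A] : Prop :=
  ∀ (C D : Type u) [NonUnitalCStarAlgebra C] [NonUnitalCStarAlgebra D]
    (π : C →⋆ₙₐ[ℂ] D), Function.Surjective π → ∀ σ : A →⋆ₙₐ[ℂ] D,
    ∀ ε : ℝ, 0 < ε → ∀ F : Finset A,
    ∃ ψ : A →⋆ₙₐ[ℂ] C, ∀ x ∈ F, ‖π (ψ x) - σ x‖ < ε

/-- `F ⊂_ε G` : every element of `F` is within `ε` of some element of `G`. -/
def EpsContained {A : Type*} [NonUnitalCStarAlgebra A] (ε : ℝ) (F G : Set A) : Prop :=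
  ∀ x ∈ F, ∃ y ∈ G, ‖x - y‖ < ε

/-- A subset of a C*-algebra which is a sub-C*-algebra. -/
def IsCStarSubset {A : Type*} [NonUnitalCStarAlgebra A] (S : Set A) : Prop :=
  IsClosed S ∧ (0 : A) ∈ S ∧ (∀ x ∈ S, ∀ y ∈ S, x + y ∈ S) ∧
    (∀ x ∈ S, ∀ y ∈ S, x * y ∈ S) ∧ (∀ (c : ℂ), ∀ x ∈ S, c • x ∈ S) ∧ ∀ x ∈ S, star x ∈ S

/-- A C*-algebra is finitely generated if some finite subset is contained in no proper
sub-C*-algebra. -/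
def IsFinitelyGeneratedCStar (A : Type*) [NonUnitalCStarAlgebra A] : Prop :=
  ∃ S : Finset A, ∀ T : Set A, IsCStarSubset T → ↑S ⊆ T → T = Set.univ

end
noncomputable section
universe w

/-- A bundled inductive system of C*-algebras. -/
structure CStarInductiveSystem : Type (w + 1) where
  X : ℕ → Type w
  inst : ∀ k, NonUnitalCStarAlgebra (X k)
  conn : ∀ k, X k →⋆ₙₐ[ℂ] X (k + 1)

attribute [instance] CStarInductiveSystem.inst

/-- `A` is (isomorphic to) an inductive limit of projective C*-algebras,
i.e. `A` has trivial shape. -/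
def IsInductiveLimitOfProjectives (A : Type w) [NonUnitalCStarAlgebra A] : Prop :=
  ∃ (S : CStarInductiveSystem.{w}) (μ : ∀ k, S.X k →⋆ₙₐ[ℂ] A),
    IsInductiveLimit S.conn A μ ∧ ∀ k, IsProjective (S.X k)

end

noncomputable section

open scoped ENNReal unitInterval

universe u₁ u₂ u₃

/-- An elementwise form of being an inductive limit, phrased in terms of sequences which are
eventually compatible with the connecting maps. -/
structure IsCoherentLimit {A : ℕ → Type u₁} [∀ k, NonUnitalCStarAlgebra (A k)]
    (γ : ∀ k, A k →⋆ₙₐ[ℂ] A (k + 1)) {L : Type u₂} [NonUnitalCStarAlgebra L]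
    (μ : ∀ k, A k →⋆ₙₐ[ℂ] L) : Prop where
  compat : ∀ k a, μ (k + 1) (γ k a) = μ k a
  dense : ∀ (a : L) (ε : ℝ), 0 < ε → ∃ k x, ‖a - μ k x‖ < ε
  norm_le : ∀ (x : ∀ m, A m) (M : ℕ), (∀ m, M ≤ m → x (m + 1) = γ m (x m)) →
    ∀ ε : ℝ, 0 < ε → ∀ᶠ m in atTop, ‖x m‖ ≤ ‖μ M (x M)‖ + ε

/-! ### Shifting an inductive system -/

section Shift

variable {A : ℕ → Type u₁} [∀ k, NonUnitalCStarAlgebra (A k)]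

/-- Transport between the members of a sequence of C*-algebras along an equality of indices. -/
def indexCast (A : ℕ → Type u₁) [∀ k, NonUnitalCStarAlgebra (A k)] {m n : ℕ} (h : m = n) :
    A m →⋆ₙₐ[ℂ] A n :=
  h ▸ NonUnitalStarAlgHom.id ℂ (A m)

lemma norm_indexCast {m n : ℕ} (h : m = n) (a : A m) : ‖indexCast A h a‖ = ‖a‖ := by
  subst h; rfl

lemma map_indexCast (γ : ∀ k, A k →⋆ₙₐ[ℂ] A (k + 1)) {m n : ℕ} (h : m = n) (a : A m) :
    γ n (indexCast A h a) = indexCast A (congrArg (· + 1) h) (γ m a) := by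
  subst h; rfl

lemma limitMap_indexCast {L : Type u₂} [NonUnitalCStarAlgebra L] (μ : ∀ k, A k →⋆ₙₐ[ℂ] L)
    {m n : ℕ} (h : m = n) (a : A m) : μ n (indexCast A h a) = μ m a := by
  subst h; rfl

variable (γ : ∀ k, A k →⋆ₙₐ[ℂ] A (k + 1))

lemma iterHom_succ_left (k n : ℕ) (a : A k) :
    iterHom γ k (n + 1) a =
      indexCast A (Nat.succ_add_eq_add_succ k n) (iterHom γ (k + 1) n (γ k a)) := by
  induction n with
  | zero => rfl
  | succ n ih =>
    change γ (k + (n + 1)) (iterHom γ k (n + 1) a) = _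
    rw [ih, map_indexCast]
    rfl

lemma iterHom_shift (k M i : ℕ) (x : ∀ m, A (k + m))
    (hx : ∀ m, M ≤ m → x (m + 1) = γ (k + m) (x m)) :
    x (M + i) = indexCast A (Nat.add_assoc k M i) (iterHom γ (k + M) i (x M)) := by
  induction i with
  | zero => rfl
  | succ i ih =>
    change x (M + i + 1) = _
    rw [hx _ (Nat.le_add_right M i), ih, map_indexCast]
    rfl

lemma limitMap_iterHom {L : Type u₂} [NonUnitalCStarAlgebra L] {μ : ∀ k, A k →⋆ₙₐ[ℂ] L}
    (hμ : ∀ k a, μ (k + 1) (γ k a) = μ k a) (k n : ℕ) (a : A k) :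
    μ (k + n) (iterHom γ k n a) = μ k a := by
  induction n with
  | zero => rfl
  | succ n ih => exact (hμ (k + n) _).trans ih

/-- The tail of an inductive system has the same limit. -/
lemma IsInductiveLimit.isCoherentLimit_shift {γ} {L : Type u₂} [NonUnitalCStarAlgebra L]
    {μ : ∀ k, A k →⋆ₙₐ[ℂ] L} (h : IsInductiveLimit γ L μ) (k : ℕ) :
    IsCoherentLimit (A := fun m => A (k + m)) (fun m => γ (k + m)) (fun m => μ (k + m)) where
  compat m a := DFunLike.congr_fun (h.compat (k + m)) a
  dense a ε hε := by
    obtain ⟨b, hb, hab⟩ := Metric.dense_iff.1 h.dense_union a ε hε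
    obtain ⟨j, x, rfl⟩ := Set.mem_iUnion.1 hab
    refine ⟨j, indexCast A (Nat.add_comm j k) (iterHom γ j k x), ?_⟩
    rw [limitMap_indexCast μ,
      limitMap_iterHom γ (fun m a => DFunLike.congr_fun (h.compat m) a), ← dist_eq_norm, dist_comm]
    exact hb
  norm_le x M hx ε hε := by
    have hn := h.norm_tendsto (k + M) (x M)
    have hev := hn.eventually_le_const (lt_add_of_pos_right _ hε)
    obtain ⟨N, hN⟩ := eventually_atTop.1 hev
    refine eventually_atTop.2 ⟨M + N, fun m hm => ?_⟩
    obtain ⟨i, rfl⟩ := Nat.exists_eq_add_of_le (le_of_add_le_left hm)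
    rw [iterHom_shift γ k M i x hx, norm_indexCast]
    exact hN i (by omega)

end Shift

/-! ### Inductive limits of path algebras -/

section Path

lemma continuous_starHom {A : Type u₁} {B : Type u₂} [NonUnitalCStarAlgebra A]
    [NonUnitalCStarAlgebra B] (φ : A →⋆ₙₐ[ℂ] B) : Continuous φ :=
  AddMonoidHomClass.continuous_of_bound φ 1 fun a => by
    simpa using NonUnitalStarAlgHom.norm_apply_le φ a

/-- Postcomposition with a *-homomorphism of C*-algebras. -/
def postcompHom (X : Type*) [TopologicalSpace X] [CompactSpace X] {A : Type u₁} {B : Type u₂}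
    [NonUnitalCStarAlgebra A] [NonUnitalCStarAlgebra B] (φ : A →⋆ₙₐ[ℂ] B) :
    C(X, A) →⋆ₙₐ[ℂ] C(X, B) where
  toFun f := ⟨fun x => φ (f x), (continuous_starHom φ).comp f.continuous⟩
  map_smul' c f := by ext; simp
  map_zero' := by ext; simp
  map_add' f g := by ext; simp
  map_mul' f g := by ext; simp
  map_star' f := by ext; simp [map_star]

@[simp] lemma postcompHom_apply {X : Type*} [TopologicalSpace X] [CompactSpace X] {A : Type u₁}
    {B : Type u₂} [NonUnitalCStarAlgebra A] [NonUnitalCStarAlgebra B] (φ : A →⋆ₙₐ[ℂ] B)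
    (f : C(X, A)) (x : X) : postcompHom X φ f x = φ (f x) := rfl

variable {A : ℕ → Type u₁} [∀ k, NonUnitalCStarAlgebra (A k)]
  {γ : ∀ k, A k →⋆ₙₐ[ℂ] A (k + 1)} {L : Type u₂} [NonUnitalCStarAlgebra L]
  {μ : ∀ k, A k →⋆ₙₐ[ℂ] L}

lemma IsCoherentLimit.map_eq (h : IsCoherentLimit γ μ) {x : ∀ m, A m} {M : ℕ}
    (hx : ∀ m, M ≤ m → x (m + 1) = γ m (x m)) {m : ℕ} (hm : M ≤ m) : μ m (x m) = μ M (x M) := by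
  induction m, hm using Nat.le_induction with
  | base => rfl
  | succ m hm ih => rw [hx m hm, h.compat, ih]

lemma exists_coherent_extension (γ : ∀ k, A k →⋆ₙₐ[ℂ] A (k + 1)) {k : ℕ} (x : A k) :
    ∃ y : ∀ m, A m, (∀ m, k ≤ m → y (m + 1) = γ m (y m)) ∧ y k = x := by
  let z : ∀ m, k ≤ m → A m := fun m h =>
    Nat.leRec (motive := fun m _ => A m) x (fun n _ a => γ n a) h
  refine ⟨fun m => if h : k ≤ m then z m h else 0, fun m hm => ?_, ?_⟩
  · dsimp only
    rw [dif_pos hm, dif_pos (hm.trans m.le_succ)]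
    exact Nat.leRec_succ ..
  · dsimp only
    rw [dif_pos le_rfl]
    exact Nat.leRec_self ..

/-- The additive subgroup of the elements of `L` in the range of `μ n` for all large `n`. -/
def rangeUnion (μ : ∀ k, A k →⋆ₙₐ[ℂ] L) : AddSubgroup L where
  carrier := {a | ∃ N, ∀ n, N ≤ n → ∃ x, μ n x = a}
  zero_mem' := ⟨0, fun n _ => ⟨0, map_zero _⟩⟩
  add_mem' := by
    rintro a b ⟨N, hN⟩ ⟨N', hN'⟩
    refine ⟨max N N', fun n hn => ?_⟩
    obtain ⟨x, rfl⟩ := hN n (le_of_max_le_left hn)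
    obtain ⟨y, rfl⟩ := hN' n (le_of_max_le_right hn)
    exact ⟨x + y, map_add _ _ _⟩
  neg_mem' := by
    rintro a ⟨N, hN⟩
    refine ⟨N, fun n hn => ?_⟩
    obtain ⟨x, rfl⟩ := hN n hn
    exact ⟨-x, map_neg _ _⟩

lemma IsCoherentLimit.map_mem_rangeUnion (h : IsCoherentLimit γ μ) (k : ℕ) (x : A k) :
    μ k x ∈ rangeUnion μ := by
  refine ⟨k, fun n hn => ?_⟩
  induction n, hn using Nat.le_induction with
  | base => exact ⟨x, rfl⟩
  | succ n hn ih =>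
    obtain ⟨y, hy⟩ := ih
    exact ⟨γ n y, (h.compat n y).trans hy⟩

/-- Passing to path algebras preserves inductive limits. -/
lemma IsCoherentLimit.pathAlgebra (h : IsCoherentLimit γ μ) :
    IsCoherentLimit (fun k => postcompHom I (γ k)) (fun k => postcompHom I (μ k)) where
  compat k a := by ext t; exact h.compat k (a t)
  dense f ε hε := by
    obtain ⟨n, hn⟩ := ((bernsteinApproximation_uniform f).eventually
      (Metric.ball_mem_nhds f (half_pos hε))).exists
    choose k x hx using fun j : Fin (n + 1) => h.dense (f (bernstein.z j)) (ε / 2) (half_pos hε)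
    choose N hN using fun j : Fin (n + 1) => h.map_mem_rangeUnion (k j) (x j)
    choose y hy using fun j : Fin (n + 1) =>
      hN j (Finset.univ.sup N) (Finset.le_sup (Finset.mem_univ j))
    refine ⟨Finset.univ.sup N, ∑ j : Fin (n + 1), bernstein n j • ContinuousMap.const I (y j), ?_⟩
    rw [dist_eq_norm, norm_sub_rev] at hn
    have hle : ‖bernsteinApproximation n f - postcompHom I (μ (Finset.univ.sup N))
        (∑ j : Fin (n + 1), bernstein n j • ContinuousMap.const I (y j))‖ ≤ ε / 2 := by
      refine (ContinuousMap.norm_le _ (half_pos hε).le).2 fun t => ?_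
      have hsmul : ∀ (r : ℝ) (a : A (Finset.univ.sup N)),
          μ (Finset.univ.sup N) (r • a) = r • μ (Finset.univ.sup N) a := fun r a => by
        rw [← Complex.coe_smul, map_smul, Complex.coe_smul]
      calc _ = ‖∑ j : Fin (n + 1), bernstein n j t • (f (bernstein.z j) - μ (k j) (x j))‖ := by
            simp [bernsteinApproximation.apply, smul_sub, hsmul, hy]
        _ ≤ ∑ j : Fin (n + 1), bernstein n j t * (ε / 2) := by
            refine norm_sum_le_of_le _ fun j _ => ?_
            rw [norm_smul, Real.norm_of_nonneg bernstein_nonneg]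
            exact mul_le_mul_of_nonneg_left (hx j).le bernstein_nonneg
        _ = ε / 2 := by rw [← Finset.sum_mul, bernstein.probability, one_mul]
    exact (norm_sub_le_norm_sub_add_norm_sub _ (bernsteinApproximation n f) _).trans_lt
      (by linarith)
  norm_le x M hx ε hε := by
    set C := ‖postcompHom I (μ M) (x M)‖
    have hpt : ∀ t : I, ∃ m, M ≤ m ∧ ‖x m t‖ < C + ε := by
      intro t
      have := h.norm_le (fun m => x m t) M (fun m hm => congrArg (· t) (hx m hm)) (ε / 2)
        (half_pos hε)
      obtain ⟨m, hm, hMm⟩ := (this.and (eventually_ge_atTop M)).exists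
      have hC : ‖μ M (x M t)‖ ≤ C := (postcompHom I (μ M) (x M)).norm_coe_le_norm t
      exact ⟨m, hMm, by linarith⟩
    choose m hMm hm using hpt
    obtain ⟨s, hs⟩ := CompactSpace.elim_nhds_subcover
      (fun t : I => {r | ‖x (m t) r‖ < C + ε}) fun t =>
        (isOpen_lt (x (m t)).continuous.norm continuous_const).mem_nhds (hm t)
    refine eventually_atTop.2 ⟨s.sup m, fun n hn => ?_⟩
    refine (ContinuousMap.norm_le _ (by positivity)).2 fun r => ?_
    obtain ⟨t, ht, hr⟩ := Set.mem_iUnion₂.1 (hs.ge (Set.mem_univ r))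
    have hanti : ∀ n, m t ≤ n → ‖x n r‖ ≤ ‖x (m t) r‖ := by
      intro n hn
      induction n, hn using Nat.le_induction with
      | base => exact le_rfl
      | succ n hn ih =>
        rw [hx n ((hMm t).trans hn)]
        exact (NonUnitalStarAlgHom.norm_apply_le (γ n) (x n r)).trans ih
    exact (hanti n ((Finset.le_sup ht).trans hn)).trans (le_of_lt hr)

variable {E : Type u₁} [NonUnitalCStarAlgebra E] {G : Type u₂} [NonUnitalCStarAlgebra G]

/-- The C*-algebra of paths in `E`. -/
def PathAlg (E : Type u₁) [NonUnitalCStarAlgebra E] : Type u₁ := C(I, E)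

namespace PathAlg

instance : NonUnitalCStarAlgebra (PathAlg E) := inferInstanceAs (NonUnitalCStarAlgebra C(I, E))

/-- Continuous maps on the unit interval as elements of the path algebra. -/
def ofMap : C(I, E) →⋆ₙₐ[ℂ] PathAlg E where
  toFun f := f
  map_smul' _ _ := rfl
  map_zero' := rfl
  map_add' _ _ := rfl
  map_mul' _ _ := rfl
  map_star' _ := rfl

/-- Elements of the path algebra as continuous maps on the unit interval. -/
def toMap : PathAlg E →⋆ₙₐ[ℂ] C(I, E) where
  toFun f := f
  map_smul' _ _ := rfl
  map_zero' := rfl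
  map_add' _ _ := rfl
  map_mul' _ _ := rfl
  map_star' _ := rfl

/-- Evaluation of paths at a point. -/
def eval (t : I) : PathAlg E →⋆ₙₐ[ℂ] E where
  toFun f := toMap f t
  map_smul' _ _ := rfl
  map_zero' := rfl
  map_add' _ _ := rfl
  map_mul' _ _ := rfl
  map_star' _ := rfl

/-- Postcomposition of paths with a *-homomorphism. -/
def map (φ : E →⋆ₙₐ[ℂ] G) : PathAlg E →⋆ₙₐ[ℂ] PathAlg G :=
  (ofMap.comp (postcompHom I φ)).comp toMap

lemma eval_map (φ : E →⋆ₙₐ[ℂ] G) (t : I) (f : PathAlg E) : eval t (map φ f) = φ (eval t f) := rfl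

lemma norm_eval_le (t : I) (f : PathAlg E) : ‖eval t f‖ ≤ ‖f‖ :=
  NonUnitalStarAlgHom.norm_apply_le (eval t) f

/-- The linear path from `a` to `b`. -/
def segment (a b : E) : PathAlg E :=
  ofMap ⟨fun t : I => (1 - (t : ℝ)) • a + (t : ℝ) • b, by fun_prop⟩

lemma norm_segment_le (a b : E) : ‖segment a b‖ ≤ ‖a‖ + ‖b‖ := by
  refine (ContinuousMap.norm_le _ (by positivity)).2 fun t => ?_
  refine (norm_add_le _ _).trans (add_le_add ?_ ?_) <;> rw [norm_smul, Real.norm_of_nonneg]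
  · exact mul_le_of_le_one_left (norm_nonneg _) (by linarith [t.2.1])
  · linarith [t.2.2]
  · exact mul_le_of_le_one_left (norm_nonneg _) t.2.2
  · exact t.2.1

@[simp] lemma eval_zero_segment (a b : E) : eval 0 (segment a b) = a := by
  change (1 - ((0 : I) : ℝ)) • a + ((0 : I) : ℝ) • b = a
  simp

@[simp] lemma eval_one_segment (a b : E) : eval 1 (segment a b) = b := by
  change (1 - ((1 : I) : ℝ)) • a + ((1 : I) : ℝ) • b = b
  simp

end PathAlg

lemma IsCoherentLimit.pathAlg (h : IsCoherentLimit γ μ) :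
    IsCoherentLimit (fun k => PathAlg.map (γ k)) (fun k => PathAlg.map (μ k)) :=
  ⟨h.pathAlgebra.compat, h.pathAlgebra.dense, h.pathAlgebra.norm_le⟩

end Path

/-! ### Asymptotically coherent sequences -/

section Coherent

variable {A : ℕ → Type u₁} [∀ k, NonUnitalCStarAlgebra (A k)]

/-- The *-endomorphism of `∏ A m` which annihilates the coordinates below `N`. -/
def truncHom (A : ℕ → Type u₁) [∀ k, NonUnitalCStarAlgebra (A k)] (N : ℕ) :
    lp A ∞ →⋆ₙₐ[ℂ] lp A ∞ where
  toFun F := ⟨fun m => if m < N then 0 else F m, memℓp_infty ⟨‖F‖, by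
    rintro _ ⟨m, rfl⟩
    dsimp only
    split_ifs
    · simp
    · exact lp.norm_apply_le_norm ENNReal.top_ne_zero F m⟩⟩
  map_smul' c F := by
    ext m; by_cases hm : m < N <;> simp [hm]
  map_zero' := by
    ext m; by_cases hm : m < N <;> simp [hm]
  map_add' F G := by
    ext m
    change (if m < N then 0 else F m + G m) =
      (if m < N then 0 else F m) + (if m < N then 0 else G m)
    split_ifs <;> simp
  map_mul' F G := by
    ext m; by_cases hm : m < N <;> simp [hm]
  map_star' F := by
    ext m; by_cases hm : m < N <;> simp [hm]

lemma truncHom_apply (N : ℕ) (F : lp A ∞) (m : ℕ) :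
    truncHom A N F m = if m < N then 0 else F m := rfl

variable (γ : ∀ k, A k →⋆ₙₐ[ℂ] A (k + 1)) {L : Type u₂} [NonUnitalCStarAlgebra L]
  (μ : ∀ k, A k →⋆ₙₐ[ℂ] L)

/-- The pairs `(a, F)` such that the sequence `F` is eventually compatible with the connecting
maps and represents `a` in the limit. -/
def coherentAlg : NonUnitalStarSubalgebra ℂ (L × lp A ∞) where
  carrier := {p | ∃ M, ∀ m, M ≤ m → p.2 (m + 1) = γ m (p.2 m) ∧ μ m (p.2 m) = p.1}
  zero_mem' := ⟨0, fun m _ => by simp⟩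
  add_mem' := by
    rintro p q ⟨M, hM⟩ ⟨N, hN⟩
    refine ⟨max M N, fun m hm => ?_⟩
    obtain ⟨h₁, h₂⟩ := hM m (le_of_max_le_left hm)
    obtain ⟨h₃, h₄⟩ := hN m (le_of_max_le_right hm)
    simp [h₁, h₂, h₃, h₄]
  mul_mem' := by
    rintro p q ⟨M, hM⟩ ⟨N, hN⟩
    refine ⟨max M N, fun m hm => ?_⟩
    obtain ⟨h₁, h₂⟩ := hM m (le_of_max_le_left hm)
    obtain ⟨h₃, h₄⟩ := hN m (le_of_max_le_right hm)
    simp [h₁, h₂, h₃, h₄]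
  smul_mem' := by
    rintro c p ⟨M, hM⟩
    exact ⟨M, fun m hm => by simp [hM m hm]⟩
  star_mem' := by
    rintro p ⟨M, hM⟩
    exact ⟨M, fun m hm => by simp [hM m hm, map_star]⟩

/-- The closure of `coherentAlg`: the pairs `(a, F)` such that `F` converges to `a`. -/
def asympAlg : NonUnitalStarSubalgebra ℂ (L × lp A ∞) :=
  (coherentAlg γ μ).topologicalClosure

lemma isClosed_asympAlg : IsClosed (asympAlg γ μ : Set (L × lp A ∞)) :=
  NonUnitalStarSubalgebra.isClosed_topologicalClosure _

variable {γ μ}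

lemma exists_coherent_near {p : L × lp A ∞} (hp : p ∈ asympAlg γ μ) {ε : ℝ} (hε : 0 < ε) :
    ∃ q ∈ coherentAlg γ μ, ‖p.1 - q.1‖ < ε ∧ ∀ m, ‖p.2 m - q.2 m‖ < ε := by
  obtain ⟨q, hq, hpq⟩ := Metric.mem_closure_iff.1 hp ε hε
  rw [dist_eq_norm] at hpq
  refine ⟨q, hq, (norm_fst_le (p - q)).trans_lt hpq, fun m => ?_⟩
  exact (lp.norm_apply_le_norm ENNReal.top_ne_zero (p - q).2 m).trans_lt
    ((norm_snd_le (p - q)).trans_lt hpq)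

lemma IsCoherentLimit.norm_le_of_mem_coherentAlg (h : IsCoherentLimit γ μ) {p : L × lp A ∞}
    (hp : p ∈ coherentAlg γ μ) {ε : ℝ} (hε : 0 < ε) : ∀ᶠ m in atTop, ‖p.2 m‖ ≤ ‖p.1‖ + ε := by
  obtain ⟨M, hM⟩ := hp
  have := h.norm_le (fun m => p.2 m) M (fun m hm => (hM m hm).1) ε hε
  rwa [(hM M le_rfl).2] at this

lemma IsCoherentLimit.norm_le_of_mem_asympAlg (h : IsCoherentLimit γ μ) {p : L × lp A ∞}
    (hp : p ∈ asympAlg γ μ) {ε : ℝ} (hε : 0 < ε) : ∀ᶠ m in atTop, ‖p.2 m‖ ≤ ‖p.1‖ + ε := by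
  obtain ⟨q, hq, h₁, h₂⟩ := exists_coherent_near hp (ε := ε / 3) (by linarith)
  filter_upwards [h.norm_le_of_mem_coherentAlg hq (ε := ε / 3) (by linarith)] with m hm
  have h₃ := norm_le_norm_add_norm_sub' (p.2 m) (q.2 m)
  have h₄ := norm_le_norm_add_norm_sub p.1 q.1
  linarith [h₂ m]

lemma mem_coherentAlg_of_eventually {p q : L × lp A ∞} (hp : p ∈ coherentAlg γ μ)
    (h₁ : q.1 = p.1) {N : ℕ} (h₂ : ∀ m, N ≤ m → q.2 m = p.2 m) : q ∈ coherentAlg γ μ := by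
  obtain ⟨M, hM⟩ := hp
  refine ⟨max M N, fun m hm => ?_⟩
  rw [h₂ m (le_of_max_le_right hm), h₂ (m + 1) ((le_of_max_le_right hm).trans m.le_succ), h₁]
  exact hM m (le_of_max_le_left hm)

/-- Null sequences converge to zero. -/
lemma mem_asympAlg_of_tendsto_zero {F : lp A ∞} (hF : Tendsto (fun m => ‖F m‖) atTop (𝓝 0)) :
    ((0 : L), F) ∈ asympAlg γ μ := by
  refine Metric.mem_closure_iff.2 fun ε hε => ?_
  obtain ⟨N, hN⟩ := eventually_atTop.1 (hF.eventually_le_const (half_pos hε))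
  refine ⟨(0, F - truncHom A N F), ?_, ?_⟩
  · refine mem_coherentAlg_of_eventually (zero_mem _) rfl (N := N) fun m hm => ?_
    simp [truncHom_apply, hm.not_gt]
  · rw [dist_eq_norm, Prod.mk_sub_mk, sub_sub_cancel, sub_zero, Prod.norm_mk, norm_zero,
      max_eq_right (norm_nonneg _)]
    refine (lp.norm_le_of_forall_le (half_pos hε).le fun m => ?_).trans_lt (half_lt_self hε)
    rw [truncHom_apply]
    split_ifs with hm
    · simpa using (half_pos hε).le
    · exact hN m (not_lt.1 hm)

lemma mem_asympAlg_of_eventually {p q : L × lp A ∞} (hp : p ∈ asympAlg γ μ)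
    (h₁ : q.1 = p.1) {N : ℕ} (h₂ : ∀ m, N ≤ m → q.2 m = p.2 m) : q ∈ asympAlg γ μ := by
  have h₃ : q - p ∈ asympAlg γ μ := by
    refine (coherentAlg γ μ).le_topologicalClosure
      (mem_coherentAlg_of_eventually (zero_mem _) (sub_eq_zero.2 h₁) (N := N) fun m hm => ?_)
    simp [h₂ m hm]
  simpa using add_mem h₃ hp

/-- Every element of the limit is the limit of an asymptotically coherent sequence. -/
lemma IsCoherentLimit.exists_mem_asympAlg (h : IsCoherentLimit γ μ) (a : L) :
    ∃ F, (a, F) ∈ asympAlg γ μ := by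
  have : IsClosed (asympAlg γ μ : Set (L × lp A ∞)) := isClosed_asympAlg γ μ
  let f : NormedAddGroupHom (asympAlg γ μ) L :=
    ((NonUnitalStarAlgHom.fst ℂ L (lp A ∞)).comp
      (NonUnitalStarSubalgebraClass.subtype (asympAlg γ μ)) : _ →+ L).mkNormedAddGroupHom 1
      fun p => by simpa using norm_fst_le (p : L × lp A ∞)
  have hf : f.SurjectiveOnWith (rangeUnion μ) 2 := by
    rintro a ⟨N, hN⟩
    rcases eq_or_ne a 0 with rfl | ha
    · exact ⟨0, map_zero f, by simp⟩
    obtain ⟨x, hx⟩ := hN N le_rfl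
    obtain ⟨y, hy, rfl⟩ := exists_coherent_extension γ x
    obtain ⟨K, hK⟩ := eventually_atTop.1 (h.norm_le y N hy ‖a‖ (norm_pos_iff.2 ha))
    rw [hx, ← two_mul] at hK
    have hbd : ∀ m, ‖(if m < K then 0 else y m : A m)‖ ≤ 2 * ‖a‖ := fun m => by
      split_ifs with hm
      · simp
      · exact hK m (not_lt.1 hm)
    let F : lp A ∞ := ⟨fun m => if m < K then 0 else y m, memℓp_infty ⟨2 * ‖a‖, by
      rintro _ ⟨m, rfl⟩
      exact hbd m⟩⟩
    have hF : (a, F) ∈ asympAlg γ μ := by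
      refine (coherentAlg γ μ).le_topologicalClosure ⟨max N K, fun m hm => ?_⟩
      have hNm := le_of_max_le_left hm
      have hKm := le_of_max_le_right hm
      have h₁ : ∀ m, K ≤ m → F m = y m := fun m hm => if_neg hm.not_gt
      exact ⟨by rw [h₁ m hKm, h₁ (m + 1) (hKm.trans m.le_succ), hy m hNm],
        by rw [h₁ m hKm, h.map_eq hy hNm, hx]⟩
    refine ⟨⟨(a, F), hF⟩, rfl, ?_⟩
    refine max_le (?_ : ‖a‖ ≤ 2 * ‖a‖) (lp.norm_le_of_forall_le (by positivity) hbd)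
    linarith [norm_nonneg a]
  have ha : a ∈ (rangeUnion μ).topologicalClosure := by
    refine Metric.mem_closure_iff.2 fun ε hε => ?_
    obtain ⟨k, x, hx⟩ := h.dense a ε hε
    exact ⟨_, h.map_mem_rangeUnion k x, by rwa [dist_eq_norm]⟩
  obtain ⟨⟨⟨b, F⟩, hF⟩, rfl, -⟩ :=
    controlled_closure_of_complete two_pos one_pos hf a ha
  exact ⟨F, hF⟩

end Coherent

/-! ### Lifting homotopies -/

section Lifting

variable {A : ℕ → Type u₁} [∀ k, NonUnitalCStarAlgebra (A k)]
  {γ : ∀ k, A k →⋆ₙₐ[ℂ] A (k + 1)} {L : Type u₂} [NonUnitalCStarAlgebra L]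
  {μ : ∀ k, A k →⋆ₙₐ[ℂ] L} {B : Type u₃} [NonUnitalCStarAlgebra B]

/-- If a path sequence `F` converges to `g`, then at a point `t` it is asymptotic to every
coherent sequence representing `g t`. -/
lemma IsCoherentLimit.tendsto_eval (h : IsCoherentLimit γ μ)
    {p : PathAlg L × lp (fun m => PathAlg (A m)) ∞}
    (hp : p ∈ asympAlg (fun k => PathAlg.map (γ k)) (fun k => PathAlg.map (μ k)))
    (t : I) {c : ∀ m, A m} (hc : ∀ m, c (m + 1) = γ m (c m))
    (hct : ∀ m, μ m (c m) = PathAlg.eval t p.1) :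
    Tendsto (fun m => ‖PathAlg.eval t (p.2 m) - c m‖) atTop (𝓝 0) := by
  rw [Metric.tendsto_nhds]
  intro ε hε
  obtain ⟨q, ⟨M, hM⟩, h₁, h₂⟩ := exists_coherent_near hp (ε := ε / 4) (by linarith)
  have h₃ := h.norm_le (fun m => PathAlg.eval t (q.2 m) - c m) M (fun m hm => by
    rw [hc, map_sub, (hM m hm).1, PathAlg.eval_map]) (ε / 4) (by linarith)
  have h₄ : ‖μ M (PathAlg.eval t (q.2 M) - c M)‖ ≤ ε / 4 := by
    rw [map_sub, hct, ← PathAlg.eval_map, (hM M le_rfl).2, norm_sub_rev]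
    rw [← map_sub]
    exact (PathAlg.norm_eval_le t _).trans h₁.le
  filter_upwards [h₃] with m hm
  rw [dist_zero_right, norm_norm]
  have h₅ : ‖PathAlg.eval t (p.2 m) - PathAlg.eval t (q.2 m)‖ ≤ ε / 4 := by
    rw [← map_sub]
    exact (PathAlg.norm_eval_le t _).trans (h₂ m).le
  linarith [norm_sub_le_norm_sub_add_norm_sub (PathAlg.eval t (p.2 m)) (PathAlg.eval t (q.2 m))
    (c m)]

variable (γ μ)

/-- Pairs `(b, F)` where `F` is a sequence of paths converging to the path `H b`, which
run from `ν m b` to `0` for `m ≥ n` and vanish for `m < n`. -/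
def liftAlg (ν : ∀ m, B →⋆ₙₐ[ℂ] A m) (H : B →⋆ₙₐ[ℂ] PathAlg L) (n : ℕ) :
    NonUnitalStarSubalgebra ℂ (B × lp (fun m => PathAlg (A m)) ∞) where
  carrier := {p | (H p.1, p.2) ∈
      asympAlg (fun k => PathAlg.map (γ k)) (fun k => PathAlg.map (μ k)) ∧
    (∀ m, n ≤ m → PathAlg.eval 0 (p.2 m) = ν m p.1 ∧ PathAlg.eval 1 (p.2 m) = 0) ∧
    ∀ m, m < n → p.2 m = 0}
  zero_mem' := ⟨by simpa using! zero_mem _, by simp, by simp⟩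
  add_mem' := by
    rintro p q ⟨h₁, h₂, h₃⟩ ⟨k₁, k₂, k₃⟩
    refine ⟨by simpa using! add_mem h₁ k₁, fun m hm => ?_, fun m hm => ?_⟩
    · simp [h₂ m hm, k₂ m hm]
    · simp [h₃ m hm, k₃ m hm]
  mul_mem' := by
    rintro p q ⟨h₁, h₂, h₃⟩ ⟨k₁, k₂, k₃⟩
    refine ⟨by simpa using! mul_mem h₁ k₁, fun m hm => ?_, fun m hm => ?_⟩
    · simp [h₂ m hm, k₂ m hm]
    · simp [h₃ m hm, k₃ m hm]
  smul_mem' := by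
    rintro c p ⟨h₁, h₂, h₃⟩
    refine ⟨by simpa using! SMulMemClass.smul_mem c h₁, fun m hm => ?_, fun m hm => ?_⟩
    · simp [h₂ m hm]
    · simp [h₃ m hm]
  star_mem' := by
    rintro p ⟨h₁, h₂, h₃⟩
    refine ⟨by simpa [map_star] using! star_mem h₁, fun m hm => ?_, fun m hm => ?_⟩
    · simp [h₂ m hm, map_star]
    · simp [h₃ m hm]

variable {γ μ} {ν : ∀ m, B →⋆ₙₐ[ℂ] A m} {H : B →⋆ₙₐ[ℂ] PathAlg L}

lemma isClosed_liftAlg (n : ℕ) :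
    IsClosed (liftAlg γ μ ν H n : Set (B × lp (fun m => PathAlg (A m)) ∞)) := by
  have hcoord : ∀ m, Continuous fun p : B × lp (fun m => PathAlg (A m)) ∞ => p.2 m := fun m => by
    have hm : Continuous fun F : lp (fun m => PathAlg (A m)) ∞ => F m :=
      (LipschitzWith.of_dist_le_mul (K := 1) fun F G => by
        simpa [dist_eq_norm] using
          lp.norm_apply_le_norm ENNReal.top_ne_zero (F - G) m).continuous
    exact hm.comp continuous_snd
  have heval := fun m t => (continuous_starHom (PathAlg.eval (E := A m) t)).comp (hcoord m)
  have h₁ : Continuous fun p : B × lp (fun m => PathAlg (A m)) ∞ => (H p.1, p.2) :=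
    ((continuous_starHom H).comp continuous_fst).prodMk continuous_snd
  refine ((isClosed_asympAlg _ _).preimage h₁).inter (IsClosed.inter ?_ ?_)
  · change IsClosed {p : B × lp (fun m => PathAlg (A m)) ∞ |
      ∀ m, n ≤ m → PathAlg.eval 0 (p.2 m) = ν m p.1 ∧ PathAlg.eval 1 (p.2 m) = 0}
    simp only [Set.ofPred_forall]
    exact isClosed_iInter fun m => isClosed_iInter fun _ =>
      (isClosed_eq (heval m 0) ((continuous_starHom (ν m)).comp continuous_fst)).inter
        (isClosed_eq (heval m 1) continuous_const)
  · change IsClosed {p : B × lp (fun m => PathAlg (A m)) ∞ | ∀ m, m < n → p.2 m = 0}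
    simp only [Set.ofPred_forall]
    exact isClosed_iInter fun m => isClosed_iInter fun _ =>
      isClosed_eq (hcoord m) continuous_const

instance (n : ℕ) : NonUnitalCStarAlgebra (liftAlg γ μ ν H n) :=
  NonUnitalStarSubalgebra.nonUnitalCStarAlgebra _ (h_closed := isClosed_liftAlg n)

/-- The surjections of the system `liftAlg`, annihilating one more coordinate. -/
def liftAlgMap (ν : ∀ m, B →⋆ₙₐ[ℂ] A m) (H : B →⋆ₙₐ[ℂ] PathAlg L) (n : ℕ) :
    liftAlg γ μ ν H n →⋆ₙₐ[ℂ] liftAlg γ μ ν H (n + 1) :=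
  NonUnitalStarAlgHom.codRestrict
    (((NonUnitalStarAlgHom.fst ℂ B (lp (fun m => PathAlg (A m)) ∞)).prod
      ((truncHom (fun m => PathAlg (A m)) (n + 1)).comp (NonUnitalStarAlgHom.snd ℂ B _))).comp
        (NonUnitalStarSubalgebraClass.subtype (liftAlg γ μ ν H n)))
    (liftAlg γ μ ν H (n + 1)) (by
      rintro ⟨p, h₁, h₂, h₃⟩
      refine ⟨mem_asympAlg_of_eventually h₁ rfl (N := n + 1) fun m hm => if_neg hm.not_gt,
        fun m hm => ?_, fun m hm => if_pos hm⟩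
      have : truncHom (fun m => PathAlg (A m)) (n + 1) p.2 m = p.2 m := if_neg hm.not_gt
      simpa [this] using h₂ m (n.le_succ.trans hm))

/-- The projection of `liftAlg` to its first coordinate. -/
def liftAlgFst (ν : ∀ m, B →⋆ₙₐ[ℂ] A m) (H : B →⋆ₙₐ[ℂ] PathAlg L) (n : ℕ) :
    liftAlg γ μ ν H n →⋆ₙₐ[ℂ] B :=
  (NonUnitalStarAlgHom.fst ℂ B (lp (fun m => PathAlg (A m)) ∞)).comp
    (NonUnitalStarSubalgebraClass.subtype (liftAlg γ μ ν H n))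

lemma liftAlgMap_surjective (n : ℕ) :
    Function.Surjective (liftAlgMap (γ := γ) (μ := μ) ν H n) := by
  rintro ⟨⟨b, F⟩, hp⟩
  obtain ⟨h₁, h₂, h₃⟩ := id hp
  replace h₃ : ∀ m, m < n + 1 → F m = 0 := h₃
  let F' : lp (fun m => PathAlg (A m)) ∞ := F + lp.single ∞ n (PathAlg.segment (ν n b) 0)
  have hne : ∀ m, m ≠ n → F' m = F m := fun m hm => by
    simp [F', lp.single_apply, Pi.single_eq_of_ne hm]
  have heq : F' n = PathAlg.segment (ν n b) 0 := by
    simp [F', lp.single_apply, h₃ n n.lt_succ_self]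
  have hF' : (b, F') ∈ liftAlg γ μ ν H n := by
    refine ⟨mem_asympAlg_of_eventually h₁ rfl (N := n + 1) fun m hm => hne m (by omega),
      fun m hm => ?_, fun m hm => ?_⟩
    · rcases hm.eq_or_lt with rfl | hm
      · simp [heq]
      · rw [hne m hm.ne']
        exact h₂ m hm
    · rw [hne m hm.ne]
      exact h₃ m (hm.trans n.lt_succ_self)
  refine ⟨⟨(b, F'), hF'⟩, Subtype.ext (Prod.ext rfl (lp.ext (funext fun m => ?_)))⟩
  change (if m < n + 1 then 0 else F' m) = F m
  split_ifs with hm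
  · exact (h₃ m hm).symm
  · exact hne m (by omega)

lemma coe_iterHom_liftAlgMap (k i : ℕ) (p : liftAlg γ μ ν H k) :
    (iterHom (A := fun n => liftAlg γ μ ν H n) (liftAlgMap ν H) k i p :
      B × lp (fun m => PathAlg (A m)) ∞) =
      ((p : B × lp (fun m => PathAlg (A m)) ∞).1,
        truncHom (fun m => PathAlg (A m)) (k + i) (p : B × lp (fun m => PathAlg (A m)) ∞).2) := by
  induction i with
  | zero =>
    refine Prod.ext rfl (lp.ext (funext fun m => ?_))
    change p.1.2 m = if m < k then 0 else p.1.2 m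
    split_ifs with hm
    · exact p.2.2.2 m hm
    · rfl
  | succ i ih =>
    refine Prod.ext (congrArg Prod.fst ih :) (lp.ext (funext fun m => ?_))
    change (if m < k + i + 1 then 0 else (iterHom (A := fun n => liftAlg γ μ ν H n)
      (liftAlgMap ν H) k i p).1.2 m) = if m < k + i + 1 then 0 else p.1.2 m
    rw [ih]
    split_ifs with hm
    · rfl
    · exact if_neg (by omega)

lemma IsCoherentLimit.liftAlgFst_surjective (h : IsCoherentLimit γ μ)
    (hν : ∀ m b, ν (m + 1) b = γ m (ν m b)) (hH₀ : ∀ b m, PathAlg.eval 0 (H b) = μ m (ν m b))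
    (hH₁ : ∀ b, PathAlg.eval 1 (H b) = 0) :
    Function.Surjective (liftAlgFst (γ := γ) (μ := μ) ν H 0) := by
  intro b
  obtain ⟨G, hG⟩ := h.pathAlg.exists_mem_asympAlg (H b)
  have h₀ := h.tendsto_eval hG 0 (fun m => hν m b) (fun m => (hH₀ b m).symm)
  have h₁ := h.tendsto_eval hG 1 (c := fun _ => 0) (fun m => (map_zero _).symm)
    (fun m => by rw [map_zero, hH₁])
  simp only [sub_zero] at h₁
  let s := fun m => PathAlg.segment (PathAlg.eval 0 (G m) - ν m b) (PathAlg.eval 1 (G m))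
  have htends : Tendsto (fun m => ‖s m‖) atTop (𝓝 0) := squeeze_zero (fun _ => norm_nonneg _)
    (fun m => PathAlg.norm_segment_le _ _) (by simpa using h₀.add h₁)
  let P : lp (fun m => PathAlg (A m)) ∞ := ⟨s, memℓp_infty htends.bddAbove_range⟩
  have hP : (0, P) ∈ asympAlg (fun k => PathAlg.map (γ k)) (fun k => PathAlg.map (μ k)) :=
    mem_asympAlg_of_tendsto_zero htends
  refine ⟨⟨(b, G - P), by simpa using! sub_mem hG hP, fun m _ => ?_, by simp⟩, rfl⟩
  change PathAlg.eval 0 (G m - s m) = ν m b ∧ PathAlg.eval 1 (G m - s m) = 0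
  simp [s]

lemma IsCoherentLimit.isInductiveLimit_liftAlg (h : IsCoherentLimit γ μ)
    (hν : ∀ m b, ν (m + 1) b = γ m (ν m b)) (hH₀ : ∀ b m, PathAlg.eval 0 (H b) = μ m (ν m b))
    (hH₁ : ∀ b, PathAlg.eval 1 (H b) = 0) :
    IsInductiveLimit (A := fun n => liftAlg γ μ ν H n) (liftAlgMap ν H) B (liftAlgFst ν H) where
  compat k := rfl
  dense_union := by
    refine dense_iff_closure_eq.2 (Set.eq_univ_of_univ_subset fun b _ => subset_closure ?_)
    exact Set.mem_iUnion.2 ⟨0, h.liftAlgFst_surjective hν hH₀ hH₁ b⟩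
  norm_tendsto k p := by
    rw [Metric.tendsto_nhds]
    intro ε hε
    have hev := h.pathAlg.norm_le_of_mem_asympAlg p.2.1 (half_pos hε)
    obtain ⟨N, hN⟩ := eventually_atTop.1 hev
    filter_upwards [eventually_ge_atTop N] with i hi
    have hnorm : ‖iterHom (A := fun n => liftAlg γ μ ν H n) (liftAlgMap ν H) k i p‖ =
        max ‖p.1.1‖ ‖truncHom (fun m => PathAlg (A m)) (k + i) p.1.2‖ :=
      congrArg norm (coe_iterHom_liftAlgMap k i p)
    have hb : ‖H p.1.1‖ ≤ ‖p.1.1‖ := NonUnitalStarAlgHom.norm_apply_le H _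
    have htr : ‖truncHom (fun m => PathAlg (A m)) (k + i) p.1.2‖ ≤ ‖p.1.1‖ + ε / 2 := by
      refine lp.norm_le_of_forall_le (by positivity) fun m => ?_
      rw [truncHom_apply]
      split_ifs with hm
      · simpa using by positivity
      · exact (hN m (by omega)).trans (by simpa using hb)
    change dist _ ‖p.1.1‖ < ε
    rw [hnorm, Real.dist_eq, abs_of_nonneg (sub_nonneg.2 (le_max_left _ _)), sub_lt_iff_lt_add]
    exact max_lt (by linarith) (by linarith)

end Lifting

/-- If the limit of a compatible family `ν` is null-homotopic, then for every semiprojective `φ`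
some `ν n ∘ φ` is null-homotopic. -/
lemma IsSemiprojectiveMorphism.exists_nullHomotopic_comp {A : ℕ → Type u₁}
    [∀ k, NonUnitalCStarAlgebra (A k)] {γ : ∀ k, A k →⋆ₙₐ[ℂ] A (k + 1)} {L : Type u₁}
    [NonUnitalCStarAlgebra L] {μ : ∀ k, A k →⋆ₙₐ[ℂ] L} (h : IsCoherentLimit γ μ)
    {D B : Type u₁} [NonUnitalCStarAlgebra D] [NonUnitalCStarAlgebra B] {φ : D →⋆ₙₐ[ℂ] B}
    (hφ : IsSemiprojectiveMorphism φ) {ν : ∀ m, B →⋆ₙₐ[ℂ] A m}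
    (hν : ∀ m b, ν (m + 1) b = γ m (ν m b)) (hnull : NullHomotopic ((μ 0).comp (ν 0))) :
    ∃ n, NullHomotopic ((ν n).comp φ) := by
  obtain ⟨H, hH₀, hH₁⟩ := hnull
  have hμν : ∀ b m, PathAlg.eval 0 (PathAlg.ofMap (H b)) = μ m (ν m b) := fun b m => by
    refine (hH₀ b).trans ?_
    exact (h.map_eq (x := fun m => ν m b) (fun m _ => hν m b) m.zero_le).symm
  obtain ⟨n, ψ, hψ⟩ := hφ (fun n => liftAlg γ μ ν (PathAlg.ofMap.comp H) n) (liftAlgMap ν _)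
    liftAlgMap_surjective B (liftAlgFst ν _)
    (h.isInductiveLimit_liftAlg (H := PathAlg.ofMap.comp H) hν hμν hH₁)
    (NonUnitalStarAlgHom.id ℂ B)
  refine ⟨n, ⟨⟨⟨⟨fun d => PathAlg.toMap ((ψ d).1.2 n), ?_⟩, ?_, ?_⟩, ?_⟩, ?_⟩,
    fun d => ?_, fun d => ?_⟩
  · intro c d; simp
  · simp
  · intro c d; simp
  · intro c d; simp
  · intro d; simp [map_star]
  · have hd : (ψ d).1.1 = φ d := DFunLike.congr_fun hψ d
    exact ((ψ d).2.2.1 n le_rfl).1.trans (congrArg (ν n) hd)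
  · exact ((ψ d).2.2.1 n le_rfl).2

end

/-- If `(A_k, γ_k)` is a shape system (semiprojective connecting morphisms) with limit `A`,
and every semiprojective morphism into `A` is null-homotopic, then for each `k` some
composition `γ_{k',k} = γ_{k+n,k}` is null-homotopic. -/
theorem shape_system_nullHomotopic_connecting_maps
    (Ak : ℕ → Type u) [∀ k, NonUnitalCStarAlgebra (Ak k)]
    (γ : ∀ k, Ak k →⋆ₙₐ[ℂ] Ak (k + 1)) (hsp : ∀ k, IsSemiprojectiveMorphism (γ k))
    (A : Type u) [NonUnitalCStarAlgebra A] (μ : ∀ k, Ak k →⋆ₙₐ[ℂ] A)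
    (hlim : IsInductiveLimit γ A μ)
    (h : ∀ (D : Type u) [NonUnitalCStarAlgebra D] (φ : D →⋆ₙₐ[ℂ] A),
      IsSemiprojectiveMorphism φ → NullHomotopic φ) :
    ∀ k : ℕ, ∃ n : ℕ, NullHomotopic (iterHom γ k n) := by
  intro k
  have hsemi : IsSemiprojectiveMorphism (μ (k + 1)) := by
    intro C _ δ hδ L _ κ hL σ
    obtain ⟨n, ψ, hψ⟩ := hsp (k + 1) C δ hδ L κ hL (σ.comp (μ (k + 1 + 1)))
    refine ⟨n, ψ, hψ.trans ?_⟩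
    rw [← hlim.compat (k + 1)]
    rfl
  obtain ⟨n, H, hH₀, hH₁⟩ := (hsp k).exists_nullHomotopic_comp
    (hlim.isCoherentLimit_shift (k + 1)) (ν := iterHom γ (k + 1)) (fun _ _ => rfl)
    (h _ _ hsemi)
  refine ⟨n + 1, (postcompHom unitInterval (indexCast Ak
    (Nat.succ_add_eq_add_succ k n))).comp H, fun a => ?_, fun a => ?_⟩
  · rw [iterHom_succ_left]
    exact congrArg _ (hH₀ a)
  · change indexCast Ak _ (H a 1) = 0
    rw [hH₁]
    exact map_zero _
end

section
/- Let A be a separable C*-algebra which is the inductive limit of an inductive system (A_k, γ_k) in which every connecting *-homomorphism γ_k : A_k → A_{k+1} is null-homotopic. Then A is isomorphic to the inductive limit of an inductive system all of whose terms are finitely generated projective C*-algebras. (This is the implication (d) ⇒ (e) of the paper's main theorem on C*-algebras of trivial shape.) -/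
open Filter Topology Set

noncomputable section
universe u

namespace TrivialShape

section

/-- An element whose image has norm `< r` has the same image as an element of norm `≤ r`. -/
theorem exists_norm_le_of_norm_map_lt {C D : Type*} [NonUnitalCStarAlgebra C]
    [NonUnitalCStarAlgebra D] (π : C →⋆ₙₐ[ℂ] D) (a : C) {r : ℝ} (hr : ‖π a‖ < r) :
    ∃ a', π a' = π a ∧ ‖a'‖ ≤ r := by
  have hr0 : 0 < r := (norm_nonneg _).trans_lt hr
  set f : ℝ → ℝ := fun x => r / max r √|x| with hf
  have hfc : Continuous f := by
    refine continuous_const.div (by fun_prop) fun x => ?_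
    exact (lt_max_of_lt_left hr0).ne'
  set g : ℝ → ℝ := fun x => f x - 1 with hg
  have hgc : Continuous g := hfc.sub continuous_const
  have hg0 : g 0 = 0 := by simp [hg, hf, max_eq_left hr0.le, hr0.ne']
  set h : C := star a * a with hh
  have hsa : IsSelfAdjoint h := IsSelfAdjoint.star_mul_self a
  have hG : IsSelfAdjoint (cfcₙ g h) := cfcₙ_predicate g h
  refine ⟨a + a * cfcₙ g h, ?_, ?_⟩
  · have h1 : π (cfcₙ g h) = 0 := by
      rw [NonUnitalStarAlgHomClass.map_cfcₙ π g h (by fun_prop) hg0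
        (hφ := (NonUnitalStarAlgHom.instContinuousLinearMapClassComplex).map_continuous π)
        (hφa := hsa.map π)]
      rw [← cfcₙ_zero ℝ (π h)]
      refine cfcₙ_congr fun x hx => ?_
      have hx' : |x| ≤ ‖π h‖ := by
        exact NonUnitalIsometricContinuousFunctionalCalculus.norm_quasispectrum_le (π h) hx
          (hsa.map π)
      have h2 : ‖π h‖ = ‖π a‖ ^ 2 := by
        rw [hh, map_mul, map_star, CStarRing.norm_star_mul_self, sq]
      have h3 : √|x| ≤ r := by
        rw [Real.sqrt_le_left hr0.le]
        nlinarith [norm_nonneg (π a)]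
      simp [hg, hf, max_eq_left h3, hr0.ne']
    rw [map_add, map_mul, h1, mul_zero, add_zero]
  · have key : star (a + a * cfcₙ g h) * (a + a * cfcₙ g h) = cfcₙ (fun x => x * f x ^ 2) h := by
      have e1 : (fun x => x * f x ^ 2) =
          fun x => (fun x => x + x * g x) x + (fun x => g x * x + g x * x * g x) x := by
        funext x; simp only [hg]; ring
      clear_value g
      have c1 : Continuous fun x : ℝ => x * g x := by fun_prop
      have c2 : Continuous fun x : ℝ => g x * x := by fun_prop
      have c3 : Continuous fun x : ℝ => g x * x * g x := by fun_prop
      have e2 : cfcₙ (fun x => x * g x) h = h * cfcₙ g h := by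
        rw [cfcₙ_mul (fun x => x) g h continuousOn_id rfl hgc.continuousOn hg0, cfcₙ_id' ℝ h hsa]
      have e3 : cfcₙ (fun x => g x * x) h = cfcₙ g h * h := by
        rw [cfcₙ_mul g (fun x => x) h hgc.continuousOn hg0 continuousOn_id rfl, cfcₙ_id' ℝ h hsa]
      have e4 : cfcₙ (fun x => g x * x * g x) h = cfcₙ g h * h * cfcₙ g h := by
        rw [cfcₙ_mul (fun x => g x * x) g h c2.continuousOn (by simp) hgc.continuousOn hg0, e3]
      rw [e1, cfcₙ_add (fun x => x + x * g x) (fun x => g x * x + g x * x * g x) h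
          (by fun_prop) (by simp) (by fun_prop) (by simp),
        cfcₙ_add (fun x => x) (fun x => x * g x) h continuousOn_id rfl c1.continuousOn (by simp),
        cfcₙ_add (fun x => g x * x) (fun x => g x * x * g x) h c2.continuousOn (by simp)
          c3.continuousOn (by simp), e2, e3, e4, cfcₙ_id' ℝ h hsa, star_add, star_mul, hG.star_eq]
      simp only [hh]
      noncomm_ring
    have h5 : ‖a + a * cfcₙ g h‖ ^ 2 ≤ r ^ 2 := by
      rw [sq, ← CStarRing.norm_star_mul_self, key]
      refine norm_cfcₙ_le fun x _ => ?_
      have hm : 0 < max r √|x| := lt_max_of_lt_left hr0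
      rw [Real.norm_eq_abs, abs_mul, abs_of_nonneg (sq_nonneg (f x)), hf]
      simp only [div_pow]
      have h6 : |x| ≤ max r √|x| ^ 2 := by
        have h7 : √|x| ≤ max r √|x| := le_max_right _ _
        nlinarith [Real.sq_sqrt (abs_nonneg x), Real.sqrt_nonneg |x|]
      rw [mul_div_assoc', div_le_iff₀ (by positivity), mul_comm]
      exact mul_le_mul_of_nonneg_left h6 (sq_nonneg r)
    exact le_of_sq_le_sq h5 hr0.le

/-- A *-homomorphism has closed range. -/
theorem isClosed_range {C D : Type*} [NonUnitalCStarAlgebra C]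
    [NonUnitalCStarAlgebra D] (π : C →⋆ₙₐ[ℂ] D) : IsClosed (range π) := by
  have hπ : Continuous π :=
    (NonUnitalStarAlgHom.instContinuousLinearMapClassComplex).map_continuous π
  refine isClosed_of_closure_subset fun d hd => ?_
  have hcl : ∀ ε : ℝ, 0 < ε → ∀ d ∈ closure (range π), ∃ c, ‖d - π c‖ < ε := by
    intro ε hε d hd
    obtain ⟨_, ⟨c, rfl⟩, hc⟩ := Metric.mem_closure_iff.1 hd ε hε
    exact ⟨c, by rwa [← dist_eq_norm]⟩
  have step : ∀ (n : ℕ) (c : C), ‖d - π c‖ < (1 / 2) ^ n →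
      ∃ c', ‖d - π c'‖ < (1 / 2) ^ (n + 1) ∧ ‖c' - c‖ ≤ 2 * (1 / 2) ^ n := by
    intro n c hc
    obtain ⟨e, he⟩ := hcl ((1 / 2) ^ (n + 1)) (by positivity) d hd
    have h1 : ‖π (e - c)‖ < 2 * (1 / 2) ^ n := by
      have : π (e - c) = (d - π c) - (d - π e) := by rw [map_sub]; abel
      rw [this]
      refine (norm_sub_le _ _).trans_lt ?_
      have : ((1 : ℝ) / 2) ^ (n + 1) ≤ (1 / 2) ^ n := by
        rw [pow_succ]; linarith [show (0 : ℝ) < (1 / 2) ^ n by positivity]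
      linarith
    obtain ⟨b, hb, hb'⟩ := exists_norm_le_of_norm_map_lt π _ h1
    refine ⟨c + b, ?_, by simpa using hb'⟩
    rw [map_add, hb, map_sub]
    convert he using 2
    abel
  obtain ⟨c0, hc0⟩ := hcl 1 one_pos d hd
  choose! F hF1 hF2 using step
  let s : ℕ → C := fun n => Nat.rec c0 (fun n c => F n c) n
  have hs : ∀ n, ‖d - π (s n)‖ < (1 / 2) ^ n := by
    intro n
    induction n with
    | zero =>
      change ‖d - π c0‖ < _
      simpa using hc0
    | succ n ih => exact hF1 n _ ih
  have hcau : CauchySeq s := by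
    refine cauchySeq_of_le_geometric (1 / 2) 2 (by norm_num) fun n => ?_
    rw [dist_comm, dist_eq_norm]
    exact hF2 n _ (hs n)
  obtain ⟨c, hc⟩ := cauchySeq_tendsto_of_complete hcau
  refine ⟨c, tendsto_nhds_unique ((hπ.tendsto c).comp hc) ?_⟩
  rw [tendsto_iff_norm_sub_tendsto_zero]
  refine squeeze_zero (fun _ => norm_nonneg _) (fun n => ?_)
    (tendsto_pow_atTop_nhds_zero_of_lt_one (r := (1 / 2 : ℝ)) (by norm_num) (by norm_num))
  rw [norm_sub_rev]
  exact (hs n).le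

theorem surjective_of_denseRange {C D : Type*} [NonUnitalCStarAlgebra C]
    [NonUnitalCStarAlgebra D] (π : C →⋆ₙₐ[ℂ] D) (h : DenseRange π) : Function.Surjective π := by
  rw [← range_eq_univ, ← (isClosed_range π).closure_eq]
  exact h.closure_range

theorem norm_commutator_pow_le {U : Type*} [NormedRing U] [NormOneClass U] (v a : U)
    (hv : ‖v‖ ≤ 1) (n : ℕ) : ‖v ^ n * a - a * v ^ n‖ ≤ n * ‖v * a - a * v‖ := by
  induction n with
  | zero => simp
  | succ n ih =>
    have e : v ^ (n + 1) * a - a * v ^ (n + 1) =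
        v ^ n * (v * a - a * v) + (v ^ n * a - a * v ^ n) * v := by
      rw [pow_succ]; noncomm_ring
    have h1 : ‖v ^ n‖ ≤ 1 := (norm_pow_le v n).trans (pow_le_one₀ (norm_nonneg _) hv)
    rw [e]
    refine (norm_add_le _ _).trans ?_
    have h2 := norm_mul_le (v ^ n) (v * a - a * v)
    have h3 := norm_mul_le (v ^ n * a - a * v ^ n) v
    push_cast
    nlinarith [norm_nonneg (v * a - a * v), norm_nonneg (v ^ n * a - a * v ^ n), norm_nonneg v]

theorem exists_norm_commutator_aeval_le (q : Polynomial ℝ) :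
    ∃ K : ℝ, 0 ≤ K ∧ ∀ (U : Type u) [CStarAlgebra U] [Nontrivial U] (v a : U), ‖v‖ ≤ 1 →
      ‖Polynomial.aeval v q * a - a * Polynomial.aeval v q‖ ≤ K * ‖v * a - a * v‖ := by
  induction q using Polynomial.induction_on' with
  | add p q hp hq =>
    obtain ⟨K, hK, h⟩ := hp
    obtain ⟨L, hL, h'⟩ := hq
    refine ⟨K + L, by positivity, fun U _ _ v a hv => ?_⟩
    have := norm_add_le (Polynomial.aeval v p * a - a * Polynomial.aeval v p)
      (Polynomial.aeval v q * a - a * Polynomial.aeval v q)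
    have e : Polynomial.aeval v (p + q) * a - a * Polynomial.aeval v (p + q) =
      (Polynomial.aeval v p * a - a * Polynomial.aeval v p) +
      (Polynomial.aeval v q * a - a * Polynomial.aeval v q) := by
      rw [map_add]; noncomm_ring
    rw [e]
    linarith [h U v a hv, h' U v a hv]
  | monomial n c =>
    refine ⟨|c| * n, by positivity, fun U _ _ v a hv => ?_⟩
    rw [Polynomial.aeval_monomial, ← Algebra.smul_def, smul_mul_assoc, mul_smul_comm, ← smul_sub,
      norm_smul, mul_assoc, Real.norm_eq_abs]
    gcongr
    exact norm_commutator_pow_le v a hv n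

theorem norm_conj_add_conj_le {U : Type*} [CStarAlgebra U] (f v a b : U) (m : ℝ)
    (hf : IsSelfAdjoint f) (hv : IsSelfAdjoint v) (hc : f * v = v * f) (h1 : f * f + v * v = 1)
    (ha : ‖a‖ ≤ m) (hb : ‖b‖ ≤ m) : ‖f * a * f + v * b * v‖ ≤ m := by
  let _ := CStarAlgebra.spectralOrder U
  let _ := CStarAlgebra.spectralOrderedRing U
  have hm : 0 ≤ m := (norm_nonneg a).trans ha
  set T := f * a * f + v * b * v with hT
  have sq_le : ∀ x y : U, IsSelfAdjoint y → ‖x‖ ≤ m →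
      y * (star x * x) * y ≤ (m ^ 2) • (y * y) := by
    intro x y hy hx
    have h2 : star x * x ≤ algebraMap ℝ U (m ^ 2) := by
      refine (CStarAlgebra.star_mul_le_algebraMap_norm_sq).trans ?_
      exact algebraMap_mono U (by gcongr)
    have h3 := star_left_conjugate_le_conjugate h2 y
    rw [hy.star_eq] at h3
    refine h3.trans_eq ?_
    rw [← Algebra.commutes, mul_assoc, Algebra.smul_def]
  have e : star T * T + star (v * (a * f) - f * (b * v)) * (v * (a * f) - f * (b * v)) =
      f * (star a * a) * f + v * (star b * b) * v := by
    have hvv : v * v = 1 - f * f := by rw [← h1]; abel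
    simp only [hT, star_add, star_sub, star_mul, hf.star_eq, hv.star_eq]
    have r1 : f * star a * f * f * a * f + f * star a * v * v * a * f = f * (star a * a) * f := by
      have : f * star a * f * f * a * f + f * star a * v * v * a * f =
        f * star a * (f * f + v * v) * a * f := by noncomm_ring
      rw [this, h1]; noncomm_ring
    have r2 : v * star b * f * f * b * v + v * star b * v * v * b * v = v * (star b * b) * v := by
      have : v * star b * f * f * b * v + v * star b * v * v * b * v =
        v * star b * (f * f + v * v) * b * v := by noncomm_ring
      rw [this, h1]; noncomm_ring
    have r3 : f * star a * f * v * b * v = f * star a * v * f * b * v := by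
      rw [mul_assoc (f * star a), hc, ← mul_assoc]
    have r4 : v * star b * v * f * a * f = v * star b * f * v * a * f := by
      rw [mul_assoc (v * star b), ← hc, ← mul_assoc]
    rw [← r1, ← r2]
    simp only [mul_add, add_mul, mul_sub, sub_mul, ← mul_assoc]
    rw [r3, r4]
    abel
  have hle : star T * T ≤ algebraMap ℝ U (m ^ 2) := by
    calc star T * T ≤ star T * T +
          star (v * (a * f) - f * (b * v)) * (v * (a * f) - f * (b * v)) :=
          le_add_of_nonneg_right (star_mul_self_nonneg _)
      _ = f * (star a * a) * f + v * (star b * b) * v := e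
      _ ≤ (m ^ 2) • (f * f) + (m ^ 2) • (v * v) := add_le_add (sq_le a f hf ha) (sq_le b v hv hb)
      _ = algebraMap ℝ U (m ^ 2) := by rw [← smul_add, h1, Algebra.algebraMap_eq_smul_one]
  have h4 : ‖T‖ ^ 2 ≤ m ^ 2 := by
    rw [sq, ← CStarRing.norm_star_mul_self]
    exact (CStarAlgebra.norm_le_iff_le_algebraMap _ (by positivity)
      (star_mul_self_nonneg _)).2 hle
  exact le_of_sq_le_sq h4 hm

end

section

theorem exists_norm_add_le_of_commutator_le (M δ : ℝ) (hM : 0 ≤ M) (hδ : 0 < δ) :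
    ∃ ζ : ℝ, 0 < ζ ∧ ∀ (C : Type u) [NonUnitalCStarAlgebra C] (v a b : C) (m : ℝ),
      IsSelfAdjoint v → ‖v‖ ≤ 1 → ‖a‖ ≤ m → ‖b‖ ≤ m → m ≤ M →
      ‖v * a - a * v‖ ≤ ζ → ‖v * b - b * v‖ ≤ ζ → ‖a + v * v * (b - a)‖ ≤ m + δ := by
  obtain ⟨q, hq⟩ := exists_polynomial_near_of_continuousOn (-1) 1 (fun x : ℝ => √(1 - x ^ 2))
    (by fun_prop) (δ / (4 * (M + 1))) (by positivity)
  obtain ⟨K, hK, hcomm⟩ := exists_norm_commutator_aeval_le.{u} q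
  refine ⟨δ / (2 * (K + 1)), by positivity, fun C _ v' a' b' m hv' hv1' ha hb hm h1 h2 => ?_⟩
  have key : ∀ v a b : Unitization ℂ C, IsSelfAdjoint v → ‖v‖ ≤ 1 → ‖a‖ ≤ m → ‖b‖ ≤ m →
      ‖v * a - a * v‖ ≤ δ / (2 * (K + 1)) → ‖v * b - b * v‖ ≤ δ / (2 * (K + 1)) →
      ‖a + v * v * (b - a)‖ ≤ m + δ := by
    intro v a b hv hv1 ha hb h1 h2
    set f := cfc (fun x : ℝ => √(1 - x ^ 2)) v with hf
    have hfc : Continuous fun x : ℝ => √(1 - x ^ 2) := by fun_prop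
    have hsp : ∀ x ∈ spectrum ℝ v, |x| ≤ 1 := fun x hx =>
      (spectrum.norm_le_norm_of_mem hx).trans hv1
    have hfsa : IsSelfAdjoint f := cfc_predicate _ _
    have hff : f * f + v * v = 1 := by
      rw [hf, ← cfc_mul _ _ v hfc.continuousOn hfc.continuousOn]
      have : v * v = cfc (fun x : ℝ => x * x) v := by
        rw [cfc_mul (fun x : ℝ => x) (fun x => x) v continuousOn_id continuousOn_id, cfc_id' ℝ v hv]
      rw [this, ← cfc_add (a := v) _ _ (by fun_prop) (by fun_prop), ← cfc_one ℝ v hv]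
      refine cfc_congr fun x hx => ?_
      have hx' := abs_le.1 (hsp x hx)
      rw [Real.mul_self_sqrt (by nlinarith)]
      simp only [Pi.one_apply]
      ring
    have hfv : f * v = v * f := by
      have e : v = cfc (fun x : ℝ => x) v := (cfc_id' ℝ v hv).symm
      have := cfc_commute_cfc (fun x : ℝ => √(1 - x ^ 2)) (fun x => x) v
      rwa [← e] at this
    have hf1 : ‖f‖ ≤ 1 := by
      refine norm_cfc_le zero_le_one fun x hx => ?_
      rw [Real.norm_eq_abs, abs_of_nonneg (Real.sqrt_nonneg _)]
      exact Real.sqrt_le_one.2 (by nlinarith)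
    have hfq : ‖f - Polynomial.aeval v q‖ ≤ δ / (4 * (M + 1)) := by
      rw [← cfc_polynomial q v hv, hf, ← cfc_sub _ _ v hfc.continuousOn (by fun_prop)]
      refine norm_cfc_le (by positivity) fun x hx => ?_
      rw [norm_sub_rev]
      exact (hq x (abs_le.1 (hsp x hx))).le
    have hfa : ‖f * a - a * f‖ + δ / (2 * (K + 1)) ≤ δ := by
      have e : f * a - a * f = (f - Polynomial.aeval v q) * a - a * (f - Polynomial.aeval v q) +
          (Polynomial.aeval v q * a - a * Polynomial.aeval v q) := by noncomm_ring
      have i1 := norm_add_le ((f - Polynomial.aeval v q) * a - a * (f - Polynomial.aeval v q))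
        (Polynomial.aeval v q * a - a * Polynomial.aeval v q)
      have i2 := norm_sub_le ((f - Polynomial.aeval v q) * a) (a * (f - Polynomial.aeval v q))
      have i3 : ‖(f - Polynomial.aeval v q) * a‖ ≤ δ / (4 * (M + 1)) * M :=
        norm_mul_le_of_le hfq (ha.trans hm)
      have i4 : ‖a * (f - Polynomial.aeval v q)‖ ≤ M * (δ / (4 * (M + 1))) :=
        norm_mul_le_of_le (ha.trans hm) hfq
      have i5 := (hcomm _ v a hv1).trans (mul_le_mul_of_nonneg_left h1 hK)
      have i6 : δ / (4 * (M + 1)) * M ≤ δ / 4 := by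
        rw [div_mul_eq_mul_div, div_le_div_iff₀ (by positivity) (by positivity)]
        nlinarith
      have i7 : K * (δ / (2 * (K + 1))) + δ / (2 * (K + 1)) = δ / 2 := by
        field_simp
      rw [e]
      linarith
    have e : a + v * v * (b - a) = (f * a * f + v * b * v) +
        (f * (f * a - a * f) + v * (v * b - b * v)) := by
      have : a = (f * f + v * v) * a := by rw [hff, one_mul]
      calc a + v * v * (b - a) = (f * f + v * v) * a + v * v * (b - a) := by rw [← this]
        _ = _ := by noncomm_ring
    have j1 := norm_conj_add_conj_le f v a b m hfsa hv hfv hff ha hb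
    have j2 : ‖f * (f * a - a * f)‖ ≤ 1 * ‖f * a - a * f‖ := norm_mul_le_of_le hf1 le_rfl
    have j3 : ‖v * (v * b - b * v)‖ ≤ 1 * (δ / (2 * (K + 1))) := norm_mul_le_of_le hv1 h2
    rw [e]
    refine (norm_add_le _ _).trans ?_
    have j4 := norm_add_le (f * (f * a - a * f)) (v * (v * b - b * v))
    linarith
  have := key v' a' b' (by rw [IsSelfAdjoint, ← Unitization.inr_star, hv'.star_eq])
    (by rwa [Unitization.norm_inr]) (by rwa [Unitization.norm_inr]) (by rwa [Unitization.norm_inr])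
    (by rwa [← Unitization.inr_mul, ← Unitization.inr_mul, ← Unitization.inr_sub,
      Unitization.norm_inr])
    (by rwa [← Unitization.inr_mul, ← Unitization.inr_mul, ← Unitization.inr_sub,
      Unitization.norm_inr])
  rwa [← Unitization.inr_mul, ← Unitization.inr_sub, ← Unitization.inr_mul, ← Unitization.inr_add,
    Unitization.norm_inr] at this

end

section

theorem continuous_starHom {C D : Type*} [NonUnitalCStarAlgebra C] [NonUnitalCStarAlgebra D]
    (π : C →⋆ₙₐ[ℂ] D) : Continuous π :=
  (NonUnitalStarAlgHom.instContinuousLinearMapClassComplex).map_continuous π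

theorem exists_approx_unit_ker {C D : Type*} [NonUnitalCStarAlgebra C] [NonUnitalCStarAlgebra D]
    (π : C →⋆ₙₐ[ℂ] D) (J : Set C) (hJf : J.Finite) (hJ : ∀ i ∈ J, π i = 0) (δ : ℝ) (hδ : 0 < δ) :
    ∃ e, π e = 0 ∧ IsSelfAdjoint e ∧ ‖e‖ ≤ 1 ∧ ∀ i ∈ J, ‖i - e * i‖ ≤ δ := by
  let I := NonUnitalStarAlgHom.equalizer π (0 : C →⋆ₙₐ[ℂ] D)
  have hI : IsClosed (I : Set C) := isClosed_eq (continuous_starHom π) continuous_const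
  let _ := CStarAlgebra.spectralOrder I
  let _ := CStarAlgebra.spectralOrderedRing I
  have hl := CStarAlgebra.increasingApproximateUnit I
  have h1 : ∀ i ∈ J, ∀ᶠ e : I in CStarAlgebra.approximateUnit I, ‖i - e * i‖ ≤ δ := by
    intro i hi
    have := hl.tendsto_mul_right ⟨i, hJ i hi⟩
    have h2 := (Metric.tendsto_nhds.1 this) δ hδ
    filter_upwards [h2] with e he
    rw [dist_comm, dist_eq_norm] at he
    exact he.le
  have h3 := (eventually_all_finite hJf).2 h1
  have := hl.neBot
  obtain ⟨e, he1, he2, he3⟩ := (h3.and (hl.eventually_isSelfAdjoint.and hl.eventually_norm)).exists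
  exact ⟨e, e.2, congrArg Subtype.val he2, he3, he1⟩

theorem exists_quasicentral_sum {C D : Type*} [NonUnitalCStarAlgebra C] [NonUnitalCStarAlgebra D]
    (π : C →⋆ₙₐ[ℂ] D) (Y J : Set C) (hY : Y.Finite) (hJf : J.Finite) (hJ : ∀ i ∈ J, π i = 0)
    (δ : ℝ) (hδ : 0 < δ) (n : ℕ) :
    ∃ E, π E = 0 ∧ IsSelfAdjoint E ∧ ‖E‖ ≤ n ∧ (∀ i ∈ J, ‖(n : ℝ) • i - E * i‖ ≤ n * δ) ∧
      ∀ y ∈ Y, ‖E * y - y * E‖ ^ 2 ≤ n * (4 * ‖y‖ ^ 2 + 1) := by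
  induction n with
  | zero => exact ⟨0, by simp⟩
  | succ n ih =>
    obtain ⟨E, hE, hEsa, hEn, hEJ, hEY⟩ := ih
    obtain ⟨R, hR0, hR⟩ : ∃ R : ℝ, 0 ≤ R ∧ ∀ y ∈ Y, ‖y‖ ≤ R := by
      obtain ⟨R, hR⟩ := hY.isBounded.exists_norm_le
      exact ⟨max R 0, le_max_right _ _, fun y hy => (hR y hy).trans (le_max_left _ _)⟩
    obtain ⟨e, he, hesa, hen, heJ⟩ := exists_approx_unit_ker π
      (J ∪ ((fun y => E * y - y * E) '' Y ∪ (fun y => star y * (E * y - y * E)) '' Y))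
      (hJf.union ((hY.image _).union (hY.image _)))
      (by
        rintro i (hi | ⟨y, -, rfl⟩ | ⟨y, -, rfl⟩)
        · exact hJ i hi
        · simp [hE]
        · simp [hE])
      (min δ (1 / (2 * (R + 1)))) (by positivity)
    refine ⟨E + e, by simp [hE, he], hEsa.add hesa, ?_, ?_, ?_⟩
    · push_cast
      exact (norm_add_le _ _).trans (add_le_add hEn hen)
    · intro i hi
      have e1 : ((n + 1 : ℕ) : ℝ) • i - (E + e) * i = ((n : ℝ) • i - E * i) + (i - e * i) := by
        push_cast
        rw [add_smul, one_smul, add_mul]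
        abel
      rw [e1]
      have := heJ i (Or.inl hi)
      have := this.trans (min_le_left _ _)
      refine (norm_add_le _ _).trans ?_
      push_cast
      linarith [hEJ i hi]
    · intro y hy
      set S := E * y - y * E with hS
      set T := e * y - y * e with hT
      have e1 : (E + e) * y - y * (E + e) = S + T := by rw [hS, hT]; noncomm_ring
      have b1 : ‖S - e * S‖ ≤ 1 / (2 * (R + 1)) :=
        (heJ S (Or.inr (Or.inl ⟨y, hy, rfl⟩))).trans (min_le_right _ _)
      have b2 : ‖star y * S - e * (star y * S)‖ ≤ 1 / (2 * (R + 1)) :=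
        (heJ _ (Or.inr (Or.inr ⟨y, hy, rfl⟩))).trans (min_le_right _ _)
      have hTS : ‖star T * S‖ ≤ 1 / 2 := by
        have e2 : star T * S = (star y * S - e * (star y * S)) - star y * (S - e * S) := by
          rw [hT, star_sub, star_mul, star_mul, hesa.star_eq]; noncomm_ring
        rw [e2]
        refine (norm_sub_le _ _).trans ?_
        have b3 : ‖star y * (S - e * S)‖ ≤ R * (1 / (2 * (R + 1))) :=
          norm_mul_le_of_le (by rw [norm_star]; exact hR y hy) b1
        have : 1 / (2 * (R + 1)) + R * (1 / (2 * (R + 1))) = 1 / 2 := by field_simp; ring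
        linarith
      have hT2 : ‖T‖ ≤ 2 * ‖y‖ := by
        have := norm_mul_le_of_le hen (le_refl ‖y‖)
        have := norm_mul_le_of_le (le_refl ‖y‖) hen
        refine (norm_sub_le _ _).trans ?_
        linarith
      rw [e1, sq, ← CStarRing.norm_star_mul_self]
      have e3 : star (S + T) * (S + T) = star S * S + star T * T + (star (star T * S) + star T * S) := by
        rw [star_add, star_mul, star_star]; noncomm_ring
      rw [e3]
      refine (norm_add_le _ _).trans ?_
      have i1 := norm_add_le (star S * S) (star T * T)
      have i2 := norm_add_le (star (star T * S)) (star T * S)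
      rw [norm_star] at i2
      rw [CStarRing.norm_star_mul_self, CStarRing.norm_star_mul_self] at i1
      have := hEY y hy
      push_cast
      nlinarith [norm_nonneg T]

theorem exists_quasicentral {C D : Type*} [NonUnitalCStarAlgebra C] [NonUnitalCStarAlgebra D]
    (π : C →⋆ₙₐ[ℂ] D) (Y J : Set C) (hY : Y.Finite) (hJf : J.Finite) (hJ : ∀ i ∈ J, π i = 0)
    (δ : ℝ) (hδ : 0 < δ) :
    ∃ v, π v = 0 ∧ IsSelfAdjoint v ∧ ‖v‖ ≤ 1 ∧ (∀ i ∈ J, ‖i - v * i‖ ≤ δ) ∧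
      ∀ y ∈ Y, ‖v * y - y * v‖ ≤ δ := by
  obtain ⟨R, hR⟩ : ∃ R : ℝ, ∀ y ∈ Y, ‖y‖ ≤ R := hY.isBounded.exists_norm_le
  obtain ⟨n, hn⟩ := exists_nat_gt ((4 * R ^ 2 + 1) / δ ^ 2)
  have hn0 : (0 : ℝ) < n := lt_of_le_of_lt (by positivity) hn
  obtain ⟨E, hE, hEsa, hEn, hEJ, hEY⟩ := exists_quasicentral_sum π Y J hY hJf hJ δ hδ n
  have hsm : ∀ (x : C) (r : ℝ), ‖x‖ ≤ n * r → ‖(n : ℝ)⁻¹ • x‖ ≤ r := by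
    intro x r hx
    rw [norm_smul, norm_inv, Real.norm_natCast, inv_mul_le_iff₀ hn0]
    exact hx
  refine ⟨(n : ℝ)⁻¹ • E, ?_, ?_, hsm _ _ (by simpa using hEn), fun i hi => ?_, fun y hy => ?_⟩
  · rw [← Complex.coe_smul, map_smul, hE, smul_zero]
  · exact (IsSelfAdjoint.all _).smul hEsa
  · have : i - (n : ℝ)⁻¹ • E * i = (n : ℝ)⁻¹ • ((n : ℝ) • i - E * i) := by
      rw [smul_sub, smul_smul, inv_mul_cancel₀ hn0.ne', one_smul, smul_mul_assoc]
    rw [this]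
    exact hsm _ _ (hEJ i hi)
  · rw [smul_mul_assoc, mul_smul_comm, ← smul_sub]
    refine hsm _ _ (le_of_sq_le_sq ?_ (by positivity))
    refine (hEY y hy).trans ?_
    rw [div_lt_iff₀ (by positivity)] at hn
    have : ‖y‖ ^ 2 ≤ R ^ 2 := by gcongr; exact hR y hy
    nlinarith

end

section

theorem exists_combination_of_finite {C D : Type u} [NonUnitalCStarAlgebra C]
    [NonUnitalCStarAlgebra D] (π : C →⋆ₙₐ[ℂ] D) (S : Set (C × C × ℝ)) (hS : S.Finite)
    (hSm : ∀ p ∈ S, ‖π p.1‖ ≤ p.2.2 ∧ ‖p.2.1‖ ≤ p.2.2) (Y : Set C) (hY : Y.Finite)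
    (δ : ℝ) (hδ : 0 < δ) :
    ∃ u, π u = 0 ∧ IsSelfAdjoint u ∧ ‖u‖ ≤ 1 ∧ (∀ y ∈ Y, ‖u * y - y * u‖ ≤ δ) ∧
      ∀ p ∈ S, ‖p.1 + u * (p.2.1 - p.1)‖ ≤ p.2.2 + δ := by
  have hcut : ∀ p ∈ S, ∃ a', π a' = π p.1 ∧ ‖a'‖ ≤ p.2.2 + δ / 4 := fun p hp =>
    exists_norm_le_of_norm_map_lt π p.1 (by linarith [(hSm p hp).1])
  choose! c hc1 hc2 using hcut
  obtain ⟨M, hM0, hM⟩ : ∃ M : ℝ, 0 ≤ M ∧ ∀ p ∈ S, p.2.2 + δ / 4 ≤ M := by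
    obtain ⟨R, hR⟩ := (hS.image fun p => p.2.2 + δ / 4).isBounded.exists_norm_le
    exact ⟨max R 0, le_max_right _ _, fun p hp => (le_abs_self _).trans
      ((hR _ ⟨p, hp, rfl⟩).trans (le_max_left _ _))⟩
  obtain ⟨ζ, hζ, hsqrt⟩ := exists_norm_add_le_of_commutator_le.{u} M (δ / 4) hM0 (by positivity)
  obtain ⟨v, hv0, hvsa, hv1, hvJ, hvY⟩ := exists_quasicentral π
    (Y ∪ (c '' S ∪ (fun p => p.2.1) '' S)) ((fun p => p.1 - c p) '' S)
    (hY.union ((hS.image _).union (hS.image _))) (hS.image _)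
    (by rintro _ ⟨p, hp, rfl⟩; simp [hc1 p hp]) (min ζ (δ / 8)) (by positivity)
  refine ⟨v * v, by simp [hv0], ?_, ?_, fun y hy => ?_, fun p hp => ?_⟩
  · rw [IsSelfAdjoint, star_mul, hvsa.star_eq]
  · simpa using norm_mul_le_of_le hv1 hv1
  · have h1 := (hvY y (Or.inl hy)).trans (min_le_right _ _)
    have e : v * v * y - y * (v * v) = v * (v * y - y * v) + (v * y - y * v) * v := by
      noncomm_ring
    have h2 := norm_mul_le_of_le hv1 h1
    have h3 := norm_mul_le_of_le h1 hv1
    rw [e]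
    refine (norm_add_le _ _).trans ?_
    linarith
  · have h1 := hsqrt C v (c p) p.2.1 (p.2.2 + δ / 4) hvsa hv1 (hc2 p hp)
      (by linarith [(hSm p hp).2]) (hM p hp)
      ((hvY _ (Or.inr (Or.inl ⟨p, hp, rfl⟩))).trans (min_le_left _ _))
      ((hvY _ (Or.inr (Or.inr ⟨p, hp, rfl⟩))).trans (min_le_left _ _))
    have h2 := (hvJ _ ⟨p, hp, rfl⟩).trans (min_le_right _ _)
    have h3 := norm_mul_le_of_le hv1 h2
    have e : p.1 + v * v * (p.2.1 - p.1) = (c p + v * v * (p.2.1 - c p)) +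
        ((p.1 - c p - v * (p.1 - c p)) + v * (p.1 - c p - v * (p.1 - c p))) := by
      noncomm_ring
    rw [e]
    refine (norm_add_le _ _).trans ?_
    have h4 := norm_add_le (p.1 - c p - v * (p.1 - c p)) (v * (p.1 - c p - v * (p.1 - c p)))
    simp only at h2 h3
    linarith

theorem exists_combination {C D : Type u} [NonUnitalCStarAlgebra C]
    [NonUnitalCStarAlgebra D] (π : C →⋆ₙₐ[ℂ] D) (S : Set (C × C × ℝ)) (hS : IsCompact S)
    (hSm : ∀ p ∈ S, ‖π p.1‖ ≤ p.2.2 ∧ ‖p.2.1‖ ≤ p.2.2) (Y : Set C) (hY : Y.Finite)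
    (δ : ℝ) (hδ : 0 < δ) :
    ∃ u, π u = 0 ∧ IsSelfAdjoint u ∧ ‖u‖ ≤ 1 ∧ (∀ y ∈ Y, ‖u * y - y * u‖ ≤ δ) ∧
      ∀ p ∈ S, ‖p.1 + u * (p.2.1 - p.1)‖ ≤ p.2.2 + δ := by
  obtain ⟨t, htS, htf, hcov⟩ := hS.finite_cover_balls (e := δ / 8) (by positivity)
  obtain ⟨u, hu0, husa, hu1, huY, huS⟩ := exists_combination_of_finite π t htf
    (fun p hp => hSm p (htS hp)) Y hY (δ / 2) (by positivity)
  refine ⟨u, hu0, husa, hu1, fun y hy => (huY y hy).trans (by linarith), fun p hp => ?_⟩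
  obtain ⟨q, hq, hpq⟩ := mem_iUnion₂.1 (hcov hp)
  rw [Metric.mem_ball, Prod.dist_eq, Prod.dist_eq, max_lt_iff, max_lt_iff, dist_eq_norm,
    dist_eq_norm, Real.dist_eq, abs_lt] at hpq
  obtain ⟨h1, h2, h3, h4⟩ := hpq
  have e : p.1 + u * (p.2.1 - p.1) = (q.1 + u * (q.2.1 - q.1)) +
      ((p.1 - q.1) + (u * (p.2.1 - q.2.1) - u * (p.1 - q.1))) := by noncomm_ring
  rw [e]
  have i1 := norm_add_le (q.1 + u * (q.2.1 - q.1))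
    ((p.1 - q.1) + (u * (p.2.1 - q.2.1) - u * (p.1 - q.1)))
  have i2 := norm_add_le (p.1 - q.1) (u * (p.2.1 - q.2.1) - u * (p.1 - q.1))
  have i3 := norm_sub_le (u * (p.2.1 - q.2.1)) (u * (p.1 - q.1))
  have i4 := norm_mul_le_of_le hu1 h1.le
  have i5 := norm_mul_le_of_le hu1 h2.le
  linarith [huS q hq]

end

section

/-- Noncommutative *-polynomials without constant term, as formal expressions. -/
inductive Term (ι : Type) : Type
  | zero : Term ι
  | var : ι → Term ι
  | add : Term ι → Term ι → Term ι
  | mul : Term ι → Term ι → Term ι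
  | smul : ℂ → Term ι → Term ι
  | adj : Term ι → Term ι

/-- The weighted scaling `X i ↦ r ^ (w i + 1) • X i`. -/
def rescale {ι : Type} (w : ι → ℕ) {D : Type*} [NonUnitalCStarAlgebra D] (r : ℝ) (X : ι → D) :
    ι → D := fun i => r ^ (w i + 1) • X i

/-- The value at `s` of the quotient of `s ↦ p (rescale w s X)` by `s`. -/
def Term.ev {ι : Type} (w : ι → ℕ) {D : Type*} [NonUnitalCStarAlgebra D] (s : ℝ) (X : ι → D) :
    Term ι → D
  | .zero => 0
  | .var i => s ^ w i • X i
  | .add p q => p.ev w s X + q.ev w s X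
  | .mul p q => s • (p.ev w s X * q.ev w s X)
  | .smul c p => c • p.ev w s X
  | .adj p => star (p.ev w s X)

theorem map_real_smul' {C D : Type*} [NonUnitalCStarAlgebra C] [NonUnitalCStarAlgebra D]
    (π : C →⋆ₙₐ[ℂ] D) (r : ℝ) (x : C) : π (r • x) = r • π x := by
  rw [← Complex.coe_smul, map_smul, Complex.coe_smul]

namespace Term

variable {ι : Type} (w : ι → ℕ)

theorem map_ev {C D : Type*} [NonUnitalCStarAlgebra C] [NonUnitalCStarAlgebra D]
    (π : C →⋆ₙₐ[ℂ] D) (s : ℝ) (X : ι → C) (p : Term ι) :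
    π (p.ev w s X) = p.ev w s (fun i => π (X i)) := by
  induction p with
  | zero => simp [ev]
  | var i => simp [ev, map_real_smul']
  | add p q hp hq => simp [ev, hp, hq]
  | mul p q hp hq => simp [ev, map_real_smul', hp, hq]
  | smul c p hp => simp [ev, hp]
  | adj p hp => simp [ev, map_star, hp]

theorem continuous_ev {D : Type*} [NonUnitalCStarAlgebra D] (p : Term ι) :
    Continuous fun q : ℝ × (ι → D) => p.ev w q.1 q.2 := by
  induction p with
  | zero => simpa [ev] using continuous_const
  | var i => simp only [ev]; fun_prop
  | add p q hp hq => simp only [ev]; fun_prop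
  | mul p q hp hq => simp only [ev]; fun_prop
  | smul c p hp => simp only [ev]; fun_prop
  | adj p hp => simp only [ev]; fun_prop

theorem ev_rescale {D : Type*} [NonUnitalCStarAlgebra D] (s r : ℝ) (X : ι → D) (p : Term ι) :
    p.ev w s (rescale w r X) = r • p.ev w (s * r) X := by
  induction p with
  | zero => simp [ev]
  | var i => simp only [ev, rescale, smul_smul]; congr 1; ring
  | add p q hp hq => simp [ev, hp, hq]
  | mul p q hp hq =>
    simp only [ev, hp, hq, smul_mul_assoc, mul_smul_comm, smul_smul]; congr 1; ring
  | smul c p hp => simp only [ev, hp]; rw [smul_comm]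
  | adj p hp => simp only [ev, hp]; rw [star_smul, star_trivial]

end Term

/-- First order expansion estimates: `y` is close to `x + u * (z - x)`. -/
structure Expansion {D : Type*} [NonUnitalCStarAlgebra D] (K ε ζ : ℝ) (u x z y : D) : Prop where
  norm_le : ‖x‖ ≤ K
  norm_sub_le : ‖z - x‖ ≤ K * ε
  comm_left : ‖u * x - x * u‖ ≤ K * ζ
  comm_right : ‖u * z - z * u‖ ≤ K * ζ
  norm_error_le : ‖y - x - u * (z - x)‖ ≤ K * (ε ^ 2 + ζ)

namespace Expansion

variable {D : Type*} [NonUnitalCStarAlgebra D] {K L ε ζ : ℝ} {u x z y x' z' y' : D}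

theorem mono (h : Expansion K ε ζ u x z y) (hKL : K ≤ L) (hε : 0 ≤ ε) (hζ : 0 ≤ ζ) :
    Expansion L ε ζ u x z y where
  norm_le := h.norm_le.trans hKL
  norm_sub_le := h.norm_sub_le.trans (by gcongr)
  comm_left := h.comm_left.trans (by gcongr)
  comm_right := h.comm_right.trans (by gcongr)
  norm_error_le := h.norm_error_le.trans (by gcongr)

theorem add (h : Expansion K ε ζ u x z y) (h' : Expansion L ε ζ u x' z' y') :
    Expansion (K + L) ε ζ u (x + x') (z + z') (y + y') where
  norm_le := norm_add_le_of_le h.norm_le h'.norm_le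
  norm_sub_le := by
    rw [add_mul, add_sub_add_comm]
    exact norm_add_le_of_le h.norm_sub_le h'.norm_sub_le
  comm_left := by
    rw [add_mul, mul_add, add_mul, add_sub_add_comm]
    exact norm_add_le_of_le h.comm_left h'.comm_left
  comm_right := by
    rw [add_mul, mul_add, add_mul, add_sub_add_comm]
    exact norm_add_le_of_le h.comm_right h'.comm_right
  norm_error_le := by
    have e : y + y' - (x + x') - u * (z + z' - (x + x')) =
      (y - x - u * (z - x)) + (y' - x' - u * (z' - x')) := by noncomm_ring
    rw [add_mul, e]
    exact norm_add_le_of_le h.norm_error_le h'.norm_error_le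

theorem smul (h : Expansion K ε ζ u x z y) (c : ℂ) :
    Expansion (‖c‖ * K) ε ζ u (c • x) (c • z) (c • y) where
  norm_le := by rw [norm_smul]; gcongr; exact h.norm_le
  norm_sub_le := by rw [← smul_sub, norm_smul, mul_assoc]; gcongr; exact h.norm_sub_le
  comm_left := by
    rw [mul_smul_comm, smul_mul_assoc, ← smul_sub, norm_smul, mul_assoc]
    gcongr; exact h.comm_left
  comm_right := by
    rw [mul_smul_comm, smul_mul_assoc, ← smul_sub, norm_smul, mul_assoc]
    gcongr; exact h.comm_right
  norm_error_le := by
    rw [← smul_sub, ← smul_sub, mul_smul_comm, ← smul_sub, norm_smul, mul_assoc]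
    gcongr; exact h.norm_error_le

theorem star (h : Expansion K ε ζ u x z y) (hu : IsSelfAdjoint u) (hK : 0 ≤ K) :
    Expansion (3 * K) ε ζ u (star x) (star z) (star y) := by
  have hc : ∀ d : D, ‖u * Star.star d - Star.star d * u‖ = ‖u * d - d * u‖ := by
    intro d
    rw [← norm_star (u * d - d * u), star_sub, star_mul, star_mul, hu.star_eq, norm_sub_rev]
  have hε : 0 ≤ K * ε := (norm_nonneg _).trans h.norm_sub_le
  have hζ : 0 ≤ K * ζ := (norm_nonneg _).trans h.comm_left
  refine ⟨?_, ?_, ?_, ?_, ?_⟩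
  · rw [norm_star]; linarith [h.norm_le]
  · rw [← star_sub, norm_star]; linarith [h.norm_sub_le]
  · rw [hc]; linarith [h.comm_left]
  · rw [hc]; linarith [h.comm_right]
  · have e : Star.star y - Star.star x - u * (Star.star z - Star.star x) =
        Star.star (y - x - u * (z - x)) -
          ((u * Star.star z - Star.star z * u) - (u * Star.star x - Star.star x * u)) := by
      rw [star_sub, star_mul, hu.star_eq, star_sub, star_sub]; noncomm_ring
    rw [e]
    have i1 := _root_.norm_sub_le (Star.star (y - x - u * (z - x)))
      ((u * Star.star z - Star.star z * u) - (u * Star.star x - Star.star x * u))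
    have i2 := _root_.norm_sub_le (u * Star.star z - Star.star z * u)
      (u * Star.star x - Star.star x * u)
    rw [hc, hc] at i2
    rw [norm_star] at i1
    have := h.norm_error_le
    have := h.comm_left
    have := h.comm_right
    have : 0 ≤ K * ε ^ 2 := by positivity
    linarith

theorem mul (h : Expansion K ε ζ u x z y) (h' : Expansion L ε ζ u x' z' y') (hu : ‖u‖ ≤ 1)
    (hε : 0 ≤ ε) (hε1 : ε ≤ 1) (hζ : 0 ≤ ζ) (hζ1 : ζ ≤ 1) :
    Expansion (9 * K * L) ε ζ u (x * x') (z * z') (y * y') := by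
  have hK : 0 ≤ K := (norm_nonneg _).trans h.norm_le
  have hL : 0 ≤ L := (norm_nonneg _).trans h'.norm_le
  have hz : ‖z‖ ≤ 2 * K := by
    have := norm_add_le_of_le h.norm_sub_le h.norm_le
    rw [sub_add_cancel] at this
    nlinarith
  have hz' : ‖z'‖ ≤ 2 * L := by
    have := norm_add_le_of_le h'.norm_sub_le h'.norm_le
    rw [sub_add_cancel] at this
    nlinarith
  have hd' : ‖z' - x'‖ ≤ L := h'.norm_sub_le.trans (by nlinarith)
  have hd : ‖z - x‖ ≤ K := h.norm_sub_le.trans (by nlinarith)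
  have hE' : ‖y' - x' - u * (z' - x')‖ ≤ 2 * L := by
    refine h'.norm_error_le.trans ?_
    rw [mul_comm]
    exact mul_le_mul_of_nonneg_right (by nlinarith) hL
  have hKL : 0 ≤ K * L := by positivity
  have hKLε : 0 ≤ K * L * ε := by positivity
  have hKLζ : 0 ≤ K * L * ζ := by positivity
  have hKLε2 : 0 ≤ K * L * ε ^ 2 := by positivity
  refine ⟨?_, ?_, ?_, ?_, ?_⟩
  · refine (norm_mul_le_of_le h.norm_le h'.norm_le).trans ?_
    linarith
  · have e : z * z' - x * x' = z * (z' - x') + (z - x) * x' := by noncomm_ring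
    rw [e]
    refine (norm_add_le_of_le (norm_mul_le_of_le hz h'.norm_sub_le)
      (norm_mul_le_of_le h.norm_sub_le h'.norm_le)).trans ?_
    linarith
  · have e : u * (x * x') - x * x' * u = (u * x - x * u) * x' + x * (u * x' - x' * u) := by
      noncomm_ring
    rw [e]
    refine (norm_add_le_of_le (norm_mul_le_of_le h.comm_left h'.norm_le)
      (norm_mul_le_of_le h.norm_le h'.comm_left)).trans ?_
    linarith
  · have e : u * (z * z') - z * z' * u = (u * z - z * u) * z' + z * (u * z' - z' * u) := by
      noncomm_ring
    rw [e]
    refine (norm_add_le_of_le (norm_mul_le_of_le h.comm_right hz')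
      (norm_mul_le_of_le hz h'.comm_right)).trans ?_
    linarith
  · have e : y * y' - x * x' - u * (z * z' - x * x') =
        (y - x - u * (z - x)) * (x' + u * (z' - x')) + (x + u * (z - x)) * (y' - x' - u * (z' - x'))
        + (y - x - u * (z - x)) * (y' - x' - u * (z' - x'))
        + (u * (z - x) * (u * (z' - x')) - u * (z - x) * (z' - x'))
        - (u * x - x * u) * (z' - x') := by noncomm_ring
    have a1 : ‖x' + u * (z' - x')‖ ≤ L + 1 * L :=
      norm_add_le_of_le h'.norm_le (norm_mul_le_of_le hu hd')
    have a2 : ‖x + u * (z - x)‖ ≤ K + 1 * K :=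
      norm_add_le_of_le h.norm_le (norm_mul_le_of_le hu hd)
    have a3 := norm_mul_le_of_le (norm_mul_le_of_le hu h.norm_sub_le)
      (norm_mul_le_of_le hu h'.norm_sub_le)
    have a4 := norm_mul_le_of_le (norm_mul_le_of_le hu h.norm_sub_le) h'.norm_sub_le
    rw [e]
    refine (norm_sub_le_of_le (norm_add_le_of_le (norm_add_le_of_le (norm_add_le_of_le
      (norm_mul_le_of_le h.norm_error_le a1) (norm_mul_le_of_le a2 h'.norm_error_le))
      (norm_mul_le_of_le h.norm_error_le hE')) (norm_sub_le_of_le a3 a4))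
      (norm_mul_le_of_le h.comm_left hd')).trans ?_
    nlinarith

end Expansion

namespace Term

variable {ι : Type} (w : ι → ℕ)

theorem exists_expansion [Finite ι] (R : ℝ) (hR : 0 ≤ R) (p : Term ι) :
    ∃ K : ℝ, 0 ≤ K ∧ ∀ (D : Type u) [NonUnitalCStarAlgebra D] (X : ι → D) (u : D) (s ε ζ : ℝ),
      0 ≤ s → s ≤ 1 → 0 ≤ ε → ε ≤ 1 → 0 ≤ ζ → ζ ≤ 1 → IsSelfAdjoint u → ‖u‖ ≤ 1 →
      (∀ i, ‖X i‖ ≤ R) → (∀ i, ‖u * X i - X i * u‖ ≤ ζ) →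
      Expansion K ε ζ u (p.ev w s X) (p.ev w s (rescale w (1 - ε) X))
        (p.ev w s (fun i => X i + u * (rescale w (1 - ε) X i - X i))) := by
  induction p with
  | zero =>
    refine ⟨0, le_rfl, fun D _ X u s ε ζ _ _ _ _ _ _ _ _ _ _ => ?_⟩
    constructor <;> simp [ev]
  | var i =>
    refine ⟨(w i + 1) * R + 1, by positivity, fun D _ X u s ε ζ hs hs1 hε hε1 hζ hζ1 _ hu hX hc => ?_⟩
    have hsw : |s ^ w i| ≤ 1 := by
      rw [abs_of_nonneg (by positivity)]; exact pow_le_one₀ hs hs1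
    have hsm : ∀ d : D, ‖s ^ w i • d‖ ≤ ‖d‖ := fun d => by
      rw [norm_smul, Real.norm_eq_abs]; exact mul_le_of_le_one_left (norm_nonneg _) hsw
    have hr : 0 ≤ (1 - ε) ^ (w i + 1) := pow_nonneg (by linarith) _
    have hr1 : (1 - ε) ^ (w i + 1) ≤ 1 := pow_le_one₀ (by linarith) (by linarith)
    have hr2 : 1 - (w i + 1) * ε ≤ (1 - ε) ^ (w i + 1) := by
      have := one_add_mul_le_pow (a := -ε) (by linarith) (w i + 1)
      push_cast at this
      rw [← sub_eq_add_neg] at this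
      linarith
    have hw : (0 : ℝ) ≤ w i * R := by positivity
    simp only [ev, rescale]
    refine ⟨(hsm _).trans ((hX i).trans (by linarith)), ?_, ?_, ?_, ?_⟩
    · rw [← smul_sub]
      refine (hsm _).trans ?_
      have : (1 - ε) ^ (w i + 1) • X i - X i = ((1 - ε) ^ (w i + 1) - 1) • X i := by
        rw [sub_smul, one_smul]
      rw [this, norm_smul, Real.norm_eq_abs, abs_sub_comm, abs_of_nonneg (by linarith)]
      have := mul_le_mul (show 1 - (1 - ε) ^ (w i + 1) ≤ (w i + 1) * ε by linarith) (hX i)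
        (norm_nonneg _) (by positivity)
      linarith
    · rw [mul_smul_comm, smul_mul_assoc, ← smul_sub]
      refine (hsm _).trans ((hc i).trans ?_)
      nlinarith
    · rw [mul_smul_comm, smul_mul_assoc, ← smul_sub]
      refine (hsm _).trans ?_
      rw [mul_smul_comm, smul_mul_assoc, ← smul_sub, norm_smul, Real.norm_eq_abs, abs_of_nonneg hr]
      refine (mul_le_of_le_one_left (norm_nonneg _) hr1).trans ((hc i).trans ?_)
      nlinarith
    · have : s ^ w i • (X i + u * ((1 - ε) ^ (w i + 1) • X i - X i)) - s ^ w i • X i -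
          u * (s ^ w i • (1 - ε) ^ (w i + 1) • X i - s ^ w i • X i) = 0 := by
        rw [← smul_sub (s ^ w i) _ (X i), ← smul_sub (s ^ w i) _ (X i), mul_smul_comm, ← smul_sub]; simp
      rw [this, norm_zero]
      positivity
  | add p q hp hq =>
    obtain ⟨K, hK, h⟩ := hp
    obtain ⟨L, hL, h'⟩ := hq
    exact ⟨K + L, by positivity, fun D _ X u s ε ζ h1 h2 h3 h4 h5 h6 h7 h8 h9 h10 =>
      (h D X u s ε ζ h1 h2 h3 h4 h5 h6 h7 h8 h9 h10).add
        (h' D X u s ε ζ h1 h2 h3 h4 h5 h6 h7 h8 h9 h10)⟩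
  | mul p q hp hq =>
    obtain ⟨K, hK, h⟩ := hp
    obtain ⟨L, hL, h'⟩ := hq
    refine ⟨9 * K * L, by positivity, fun D _ X u s ε ζ h1 h2 h3 h4 h5 h6 h7 h8 h9 h10 => ?_⟩
    have := (((h D X u s ε ζ h1 h2 h3 h4 h5 h6 h7 h8 h9 h10).mul
        (h' D X u s ε ζ h1 h2 h3 h4 h5 h6 h7 h8 h9 h10) h8 h3 h4 h5 h6).smul (s : ℂ)).mono
        (L := 9 * K * L) (by
          rw [Complex.norm_real, Real.norm_eq_abs, abs_of_nonneg h1]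
          exact mul_le_of_le_one_left (by positivity) h2) h3 h5
    simpa only [Complex.coe_smul, ev] using this
  | smul c p hp =>
    obtain ⟨K, hK, h⟩ := hp
    exact ⟨‖c‖ * K, by positivity, fun D _ X u s ε ζ h1 h2 h3 h4 h5 h6 h7 h8 h9 h10 =>
      (h D X u s ε ζ h1 h2 h3 h4 h5 h6 h7 h8 h9 h10).smul c⟩
  | adj p hp =>
    obtain ⟨K, hK, h⟩ := hp
    exact ⟨3 * K, by positivity, fun D _ X u s ε ζ h1 h2 h3 h4 h5 h6 h7 h8 h9 h10 =>
      (h D X u s ε ζ h1 h2 h3 h4 h5 h6 h7 h8 h9 h10).star h7 hK⟩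

end Term

end

section

/-- `X` satisfies `‖p(s·X)‖ ≤ M s / (s + e)` for all `p ∈ T` and all `s ∈ [0, 1]`. -/
def Sat {ι : Type} (w : ι → ℕ) (T : Set (Term ι)) (e M : ℝ) {D : Type*} [NonUnitalCStarAlgebra D]
    (X : ι → D) : Prop :=
  ∀ p ∈ T, ∀ s ∈ Icc (0 : ℝ) 1, ‖p.ev w s X‖ * (s + e) ≤ M

/-- `T` contains a nonzero multiple of every variable. -/
def BoundsVars {ι : Type} (T : Set (Term ι)) : Prop :=
  ∀ i, ∃ c : ℂ, c ≠ 0 ∧ Term.smul c (.var i) ∈ T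

variable {ι : Type} {w : ι → ℕ} {T : Set (Term ι)} {e : ℝ}

theorem BoundsVars.exists_bound [Finite ι] (hT : BoundsVars T) (he : 0 < e) (M : ℝ) (hM : 0 ≤ M) :
    ∃ R : ℝ, 0 ≤ R ∧ ∀ {D : Type u} [NonUnitalCStarAlgebra D] (X : ι → D), Sat w T e M X →
      ∀ i, ‖X i‖ ≤ R := by
  choose c hc0 hcT using hT
  obtain ⟨R, hR⟩ := (finite_range fun i => M / ‖c i‖).bddAbove
  refine ⟨max R 0, le_max_right _ _, fun {D} _ X hX i => ?_⟩
  refine le_trans ?_ ((hR ⟨i, rfl⟩).trans (le_max_left _ _))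
  have h := hX _ (hcT i) 1 ⟨zero_le_one, le_rfl⟩
  simp only [Term.ev, one_pow, one_smul, norm_smul] at h
  have hc : 0 < ‖c i‖ := norm_pos_iff.2 (hc0 i)
  rw [le_div_iff₀ hc, mul_comm]
  nlinarith [mul_nonneg hc.le (norm_nonneg (X i))]

theorem exists_sat [Finite ι] (hTf : T.Finite) {D : Type*} [NonUnitalCStarAlgebra D] (e : ℝ)
    (X : ι → D) : ∃ M : ℝ, Sat w T e M X := by
  have h : ∀ p ∈ T, ∃ M : ℝ, ∀ s ∈ Icc (0 : ℝ) 1, ‖p.ev w s X‖ * (s + e) ≤ M := by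
    intro p _
    have hc : Continuous fun s : ℝ => ‖p.ev w s X‖ * (s + e) := by
      have : Continuous fun s : ℝ => p.ev w s X :=
        (Term.continuous_ev w p).comp (by fun_prop : Continuous fun s : ℝ => (s, X))
      fun_prop
    obtain ⟨M, hM⟩ := (isCompact_Icc.image hc).bddAbove
    exact ⟨M, fun s hs => hM ⟨s, hs, rfl⟩⟩
  choose! M hM using h
  obtain ⟨R, hR⟩ := (hTf.image M).bddAbove
  exact ⟨R, fun p hp s hs => (hM p hp s hs).trans (hR ⟨p, hp, rfl⟩)⟩

theorem exists_improvement [Finite ι] (hTf : T.Finite) (hT : BoundsVars T) (he : 0 < e)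
    (he1 : e ≤ 1) (Δ₀ : ℝ) (hΔ₀ : 0 < Δ₀) :
    ∃ q L : ℝ, 0 < q ∧ q < 1 ∧ 0 ≤ L ∧ ∀ (C D : Type u) [NonUnitalCStarAlgebra C]
      [NonUnitalCStarAlgebra D] (π : C →⋆ₙₐ[ℂ] D) (Δ : ℝ) (X : ι → C), 0 < Δ → Δ ≤ Δ₀ →
      Sat w T e (1 + Δ) X → Sat w T e 1 (fun i => π (X i)) →
      ∃ X' : ι → C, (∀ i, π (X' i) = π (X i)) ∧ Sat w T e (1 + q * Δ) X' ∧
        ∀ i, ‖X' i - X i‖ ≤ L * Δ := by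
  obtain ⟨R, hR, hbd⟩ := hT.exists_bound (w := w) he (1 + Δ₀) (by positivity)
  have hexp := Term.exists_expansion.{u} w R hR
  choose K₀ hK₀ hK₀e using hexp
  obtain ⟨K, hK, hKT⟩ : ∃ K : ℝ, 0 ≤ K ∧ ∀ p ∈ T, K₀ p ≤ K := by
    obtain ⟨K, hK⟩ := (hTf.image K₀).bddAbove
    exact ⟨max K 0, le_max_right _ _, fun p hp => (hK ⟨p, hp, rfl⟩).trans (le_max_left _ _)⟩
  obtain ⟨V, hV, hVw⟩ : ∃ V : ℝ, 0 ≤ V ∧ ∀ i, K₀ (.var i) ≤ V := by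
    obtain ⟨V, hV⟩ := (finite_range fun i => K₀ (.var i)).bddAbove
    exact ⟨max V 0, le_max_right _ _, fun i => (hV ⟨i, rfl⟩).trans (le_max_left _ _)⟩
  set θ := e / (1 + e) with hθ
  have hθ0 : 0 < θ := by positivity
  have hθ1 : θ ≤ 1 := (div_le_one (by positivity)).2 (by linarith)
  set K' := 4 * K + 2 with hK'
  -- the relative step size
  set κ := min 1 (min (1 / Δ₀) (θ / (2 * K' * Δ₀))) with hκ
  have hκ0 : 0 < κ := by positivity
  have hκ1 : κ ≤ 1 := min_le_left _ _
  have hκ2 : κ * Δ₀ ≤ 1 := by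
    have : κ ≤ 1 / Δ₀ := (min_le_right _ _).trans (min_le_left _ _)
    rwa [le_div_iff₀ hΔ₀] at this
  have hκ3 : K' * (κ * Δ₀) ≤ θ / 2 := by
    have : κ ≤ θ / (2 * K' * Δ₀) := (min_le_right _ _).trans (min_le_right _ _)
    rw [le_div_iff₀ (by positivity)] at this
    linarith
  have hθκ : θ * κ ≤ 1 := by nlinarith
  have hθκ0 : 0 < θ * κ := by positivity
  refine ⟨1 - θ * κ / 2, V * κ, by linarith, by linarith, by positivity, ?_⟩
  intro C D _ _ π Δ X hΔ hΔ' hX hπX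
  set ε := κ * Δ with hε
  have hε0 : 0 < ε := by positivity
  have hε1 : ε ≤ 1 := le_trans (by rw [hε]; gcongr) hκ2
  have hXR : ∀ i, ‖X i‖ ≤ R := hbd X fun p hp s hs => (hX p hp s hs).trans (by linarith)
  set m : ℝ := max 1 ((1 + Δ) * (1 - θ * ε)) with hm
  have hrate : ∀ s ∈ Icc (0 : ℝ) 1, (1 - ε) * (s + e) ≤ (1 - θ * ε) * (s * (1 - ε) + e) := by
    rintro s ⟨hs0, hs1⟩
    have h1 : θ * (1 + e) = e := by rw [hθ]; field_simp
    have h2 : s * (1 - ε) + e ≤ 1 + e := by nlinarith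
    have h3 : θ * ε * (s * (1 - ε) + e) ≤ θ * ε * (1 + e) := by gcongr
    nlinarith
  have hZ : ∀ p ∈ T, ∀ s ∈ Icc (0 : ℝ) 1,
      ‖p.ev w s (rescale w (1 - ε) X)‖ * (s + e) ≤ m := by
    intro p hp s hs
    have hs' : s * (1 - ε) ∈ Icc (0 : ℝ) 1 :=
      ⟨mul_nonneg hs.1 (by linarith), mul_le_one₀ hs.2 (by linarith) (by linarith)⟩
    have h1 := hX p hp _ hs'
    rw [Term.ev_rescale, norm_smul, Real.norm_eq_abs, abs_of_nonneg (by linarith)]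
    refine le_trans ?_ (le_max_right _ _)
    have hθε : θ * ε ≤ 1 := mul_le_one₀ hθ1 hε0.le hε1
    calc (1 - ε) * ‖p.ev w (s * (1 - ε)) X‖ * (s + e)
        = ‖p.ev w (s * (1 - ε)) X‖ * ((1 - ε) * (s + e)) := by ring
      _ ≤ ‖p.ev w (s * (1 - ε)) X‖ * ((1 - θ * ε) * (s * (1 - ε) + e)) := by
          exact mul_le_mul_of_nonneg_left (hrate s hs) (norm_nonneg _)
      _ = ‖p.ev w (s * (1 - ε)) X‖ * (s * (1 - ε) + e) * (1 - θ * ε) := by ring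
      _ ≤ (1 + Δ) * (1 - θ * ε) := by gcongr
  have hm1 : 1 ≤ m := le_max_left _ _
  let S : Set (C × C × ℝ) := ⋃ p ∈ T, (fun s : ℝ =>
    (p.ev w s X, p.ev w s (rescale w (1 - ε) X), m / (s + e))) '' Icc 0 1
  have hSc : IsCompact S := by
    refine hTf.isCompact_biUnion fun p _ => isCompact_Icc.image_of_continuousOn ?_
    have h1 : ∀ Z : ι → C, Continuous fun s : ℝ => p.ev w s Z := fun Z =>
      (Term.continuous_ev w p).comp (by fun_prop : Continuous fun s : ℝ => (s, Z))
    refine (h1 _).continuousOn.prodMk ((h1 _).continuousOn.prodMk ?_)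
    exact continuousOn_const.div (by fun_prop) fun s hs => by have := hs.1; positivity
  obtain ⟨u, hu0, husa, hu1, huY, huS⟩ := exists_combination π S hSc (by
    intro x hx
    obtain ⟨p, hp, s, hs, rfl⟩ := mem_iUnion₂.1 hx
    have hse : 0 < s + e := by have := hs.1; positivity
    refine ⟨?_, ?_⟩
    · simp only
      rw [le_div_iff₀ hse, Term.map_ev]
      exact (hπX p hp s hs).trans hm1
    · simp only
      rw [le_div_iff₀ hse]
      exact hZ p hp s hs) (range X) (finite_range X) (ε ^ 2) (by positivity)
  have hexp : ∀ (p : Term ι) (s : ℝ), s ∈ Icc (0 : ℝ) 1 → Expansion (K₀ p) ε (ε ^ 2) u (p.ev w s X)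
      (p.ev w s (rescale w (1 - ε) X))
      (p.ev w s (fun i => X i + u * (rescale w (1 - ε) X i - X i))) := fun p s hs =>
    hK₀e p C X u s ε (ε ^ 2) hs.1 hs.2 hε0.le hε1 (by positivity) (pow_le_one₀ hε0.le hε1) husa
      hu1 hXR fun i => huY _ ⟨i, rfl⟩
  refine ⟨fun i => X i + u * (rescale w (1 - ε) X i - X i), fun i => by simp [hu0], ?_, ?_⟩
  · intro p hp s hs
    have hse : 0 < s + e := by have := hs.1; positivity
    have hse2 : s + e ≤ 2 := by linarith [hs.2]
    have h1 := huS (p.ev w s X, p.ev w s (rescale w (1 - ε) X), m / (s + e))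
      (mem_iUnion₂.2 ⟨p, hp, s, hs, rfl⟩)
    have h2 := (hexp p s hs).norm_error_le.trans
      (mul_le_mul_of_nonneg_right (hKT p hp) (by positivity))
    simp only at h1
    have h3 := norm_add_le_of_le h2 h1
    rw [sub_sub, sub_add_cancel] at h3
    have h4 : ‖p.ev w s (fun i => X i + u * (rescale w (1 - ε) X i - X i))‖ * (s + e) ≤
        m + K' * ε ^ 2 := by
      refine (mul_le_mul_of_nonneg_right h3 hse.le).trans ?_
      have h5 : (K * (ε ^ 2 + ε ^ 2) + (m / (s + e) + ε ^ 2)) * (s + e) =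
          m + (2 * K + 1) * ε ^ 2 * (s + e) := by field_simp; ring
      rw [h5, hK']
      have : (2 * K + 1) * ε ^ 2 * (s + e) ≤ (2 * K + 1) * ε ^ 2 * 2 := by gcongr
      linarith
    refine h4.trans ?_
    have h6 : K' * ε ^ 2 ≤ Δ * κ * θ / 2 := by
      have : K' * ε ≤ θ / 2 := by
        refine le_trans ?_ hκ3
        rw [hε]; gcongr
      calc K' * ε ^ 2 = (K' * ε) * ε := by ring
        _ ≤ θ / 2 * ε := by gcongr
        _ = Δ * κ * θ / 2 := by rw [hε]; ring
    have h7 : m ≤ 1 + Δ * (1 - θ * κ) := by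
      refine max_le (by nlinarith) ?_
      have : 0 ≤ Δ * (θ * ε) := by positivity
      have : θ * ε = Δ * (θ * κ) := by rw [hε]; ring
      nlinarith
    linarith
  · intro i
    have h1 := (hexp (.var i) 1 ⟨zero_le_one, le_rfl⟩).norm_sub_le
    simp only [Term.ev, one_pow, one_smul] at h1
    simp only [add_sub_cancel_left]
    have := norm_mul_le_of_le hu1 (h1.trans (mul_le_mul_of_nonneg_right (hVw i) hε0.le))
    rw [hε] at this
    linarith

theorem exists_lift_sat [Finite ι] (hTf : T.Finite) (hT : BoundsVars T) (he : 0 < e)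
    (he1 : e ≤ 1) {C D : Type u} [NonUnitalCStarAlgebra C] [NonUnitalCStarAlgebra D]
    (π : C →⋆ₙₐ[ℂ] D) (hπ : Function.Surjective π) (x : ι → D) (hx : Sat w T e 1 x) :
    ∃ X : ι → C, (∀ i, π (X i) = x i) ∧ Sat w T e 1 X := by
  choose X₀ hX₀ using fun i => hπ (x i)
  obtain ⟨M, hM⟩ := exists_sat (w := w) hTf e X₀
  set Δ₀ := max M 1 with hΔ₀
  have hΔ₀0 : 0 < Δ₀ := lt_of_lt_of_le one_pos (le_max_right _ _)
  obtain ⟨q, L, hq0, hq1, hL, himp⟩ := exists_improvement (w := w) hTf hT he he1 Δ₀ hΔ₀0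
  have hx' : ∀ X : ι → C, (∀ i, π (X i) = x i) → Sat w T e 1 (fun i => π (X i)) := by
    intro X hX
    rwa [funext hX]
  let P : ℕ → (ι → C) → Prop := fun n X => (∀ i, π (X i) = x i) ∧ Sat w T e (1 + q ^ n * Δ₀) X
  have hstep : ∀ n X, P n X → ∃ X', P (n + 1) X' ∧ ∀ i, ‖X' i - X i‖ ≤ L * Δ₀ * q ^ n := by
    rintro n X ⟨h1, h2⟩
    have : q ^ n ≤ 1 := pow_le_one₀ hq0.le hq1.le
    obtain ⟨X', h3, h4, h5⟩ := himp C D π (q ^ n * Δ₀) X (by positivity)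
      (mul_le_of_le_one_left hΔ₀0.le this) h2 (hx' X h1)
    refine ⟨X', ⟨fun i => (h3 i).trans (h1 i), ?_⟩, fun i => (h5 i).trans (by linarith)⟩
    rwa [pow_succ', mul_assoc]
  choose! F hF1 hF2 using hstep
  let Y : ℕ → ι → C := fun n => Nat.rec X₀ (fun n X => F n X) n
  have hY : ∀ n, P n (Y n) := by
    intro n
    induction n with
    | zero =>
      refine ⟨hX₀, fun p hp s hs => (hM p hp s hs).trans ?_⟩
      rw [pow_zero, one_mul]
      linarith [le_max_left M 1]
    | succ n ih => exact hF1 n _ ih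
  have hcau : ∀ i, CauchySeq fun n => Y n i := fun i =>
    cauchySeq_of_le_geometric q (L * Δ₀) hq1 fun n => by
      rw [dist_comm, dist_eq_norm]
      exact hF2 n _ (hY n) i
  choose X hX using fun i => cauchySeq_tendsto_of_complete (hcau i)
  have hXt : Tendsto Y atTop (𝓝 X) := tendsto_pi_nhds.2 hX
  refine ⟨X, fun i => ?_, fun p hp s hs => ?_⟩
  · refine tendsto_nhds_unique (((continuous_starHom π).tendsto _).comp (hX i)) ?_
    exact tendsto_const_nhds.congr fun n => ((hY n).1 i).symm
  · have hc : Continuous fun Z : ι → C => ‖p.ev w s Z‖ * (s + e) := by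
      have : Continuous fun Z : ι → C => p.ev w s Z :=
        (Term.continuous_ev w p).comp (by fun_prop : Continuous fun Z : ι → C => (s, Z))
      fun_prop
    refine le_of_tendsto_of_tendsto' ((hc.tendsto X).comp hXt)
      (?_ : Tendsto (fun n => 1 + q ^ n * Δ₀) atTop (𝓝 1)) fun n => (hY n).2 p hp s hs
    have := ((tendsto_pow_atTop_nhds_zero_of_lt_one hq0.le hq1).mul_const Δ₀).const_add 1
    simpa using this

end

section

section Generated

variable {ι : Type} (w : ι → ℕ) {B : Type*} [NonUnitalCStarAlgebra B]

/-- The *-subalgebra generated by a family, as the set of values of all terms. -/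
def termAlg (X : ι → B) : NonUnitalStarSubalgebra ℂ B where
  carrier := range fun p : Term ι => p.ev w 1 X
  add_mem' := by
    rintro _ _ ⟨p, rfl⟩ ⟨q, rfl⟩
    exact ⟨.add p q, rfl⟩
  zero_mem' := ⟨.zero, rfl⟩
  mul_mem' := by
    rintro _ _ ⟨p, rfl⟩ ⟨q, rfl⟩
    exact ⟨.mul p q, by simp [Term.ev]⟩
  smul_mem' := by
    rintro c _ ⟨p, rfl⟩
    exact ⟨.smul c p, rfl⟩
  star_mem' := by
    rintro _ ⟨p, rfl⟩
    exact ⟨.adj p, rfl⟩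

/-- The C*-subalgebra generated by a family. -/
def genAlg (X : ι → B) : NonUnitalStarSubalgebra ℂ B := (termAlg w X).topologicalClosure

theorem isClosed_genAlg (X : ι → B) : IsClosed (genAlg w X : Set B) := isClosed_closure

instance (X : ι → B) : NonUnitalCStarAlgebra (genAlg w X) :=
  NonUnitalStarSubalgebra.nonUnitalCStarAlgebra _ (h_closed := isClosed_genAlg w X)

/-- The inclusion of a generated C*-subalgebra. -/
def genAlgIncl (X : ι → B) : genAlg w X →⋆ₙₐ[ℂ] B := NonUnitalStarSubalgebraClass.subtype _

theorem genAlgIncl_apply (X : ι → B) (a : genAlg w X) : genAlgIncl w X a = a := rfl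

theorem norm_genAlg (X : ι → B) (a : genAlg w X) : ‖a‖ = ‖(a : B)‖ := rfl

theorem ev_mem_genAlg (X : ι → B) (p : Term ι) : p.ev w 1 X ∈ genAlg w X :=
  subset_closure ⟨p, rfl⟩

theorem mem_genAlg (X : ι → B) (i : ι) : X i ∈ genAlg w X := by
  simpa [Term.ev] using ev_mem_genAlg w X (.var i)

/-- The canonical generators of a generated C*-subalgebra. -/
def genAlgGen (X : ι → B) (i : ι) : genAlg w X := ⟨X i, mem_genAlg w X i⟩

theorem coe_ev_genAlgGen (X : ι → B) (s : ℝ) (p : Term ι) :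
    ((p.ev w s (genAlgGen w X) : genAlg w X) : B) = p.ev w s X :=
  Term.map_ev w (genAlgIncl w X) s (genAlgGen w X) p

theorem denseRange_genAlgGen (X : ι → B) :
    DenseRange fun p : Term ι => p.ev w 1 (genAlgGen w X) := by
  rintro ⟨a, ha⟩
  rw [closure_subtype]
  have e : ((↑) : genAlg w X → B) '' (range fun p : Term ι => p.ev w 1 (genAlgGen w X)) =
      range fun p : Term ι => p.ev w 1 X := by
    rw [← range_comp]
    exact congrArg range (funext fun p => coe_ev_genAlgGen w X 1 p)
  rw [e]
  exact ha

end Generated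

section Dense

variable {ι : Type} {w : ι → ℕ} {Q : Type*} [NonUnitalCStarAlgebra Q] {y : ι → Q}

theorem hom_ext_of_dense (hy : DenseRange fun p : Term ι => p.ev w 1 y) {D : Type*}
    [NonUnitalCStarAlgebra D] {φ ψ : Q →⋆ₙₐ[ℂ] D} (h : ∀ i, φ (y i) = ψ (y i)) : φ = ψ := by
  apply DFunLike.coe_injective
  refine hy.equalizer (continuous_starHom φ) (continuous_starHom ψ) (funext fun p => ?_)
  simp only [Function.comp_apply, Term.map_ev, h]

theorem eq_univ_of_dense (hy : DenseRange fun p : Term ι => p.ev w 1 y) {T : Set Q} (hT : IsCStarSubset T)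
    (hyT : ∀ i, y i ∈ T) : T = univ := by
  obtain ⟨hcl, h0, hadd, hmul, hsmul, hstar⟩ := hT
  have hmem : ∀ p : Term ι, p.ev w 1 y ∈ T := by
    intro p
    induction p with
    | zero => exact h0
    | var i => simpa [Term.ev] using hyT i
    | add p q hp hq => exact hadd _ hp _ hq
    | mul p q hp hq => simpa [Term.ev] using hmul _ hp _ hq
    | smul c p hp => exact hsmul c _ hp
    | adj p hp => exact hstar _ hp
  have := hcl.closure_subset_iff.2 (range_subset_iff.2 hmem)
  rwa [hy.closure_eq, univ_subset_iff] at this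

theorem isFinitelyGenerated_of_dense [Finite ι] (hy : DenseRange fun p : Term ι => p.ev w 1 y) :
    IsFinitelyGeneratedCStar Q :=
  ⟨(finite_range y).toFinset, fun T hT hyT => eq_univ_of_dense hy hT fun i => hyT (by simp)⟩

theorem exists_hom_of_norm_le (hy : DenseRange fun p : Term ι => p.ev w 1 y) {D : Type*}
    [NonUnitalCStarAlgebra D] (d : ι → D)
    (h : ∀ p : Term ι, ‖p.ev w 1 d‖ ≤ ‖p.ev w 1 y‖) : ∃ ψ : Q →⋆ₙₐ[ℂ] D, ∀ i, ψ (y i) = d i := by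
  let X : ι → Q × D := fun i => (y i, d i)
  let π₁ : genAlg w X →⋆ₙₐ[ℂ] Q := (NonUnitalStarAlgHom.fst ℂ Q D).comp (genAlgIncl w X)
  let π₂ : genAlg w X →⋆ₙₐ[ℂ] D := (NonUnitalStarAlgHom.snd ℂ Q D).comp (genAlgIncl w X)
  have hle : ∀ a, ‖π₂ a‖ ≤ ‖π₁ a‖ := by
    intro a
    refine (denseRange_genAlgGen w X).induction_on (p := fun a => ‖π₂ a‖ ≤ ‖π₁ a‖) a ?_ ?_
    · exact isClosed_le (continuous_starHom π₂).norm (continuous_starHom π₁).norm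
    · intro p
      rw [Term.map_ev, Term.map_ev]
      exact h p
  have hinj : Function.Injective π₁ := by
    rw [injective_iff_map_eq_zero]
    intro a ha
    have h2 := hle a
    rw [ha, norm_zero, norm_le_zero_iff] at h2
    exact Subtype.ext (Prod.ext ha h2)
  have hsurj : Function.Surjective π₁ := by
    refine surjective_of_denseRange π₁ (hy.mono ?_)
    rintro _ ⟨p, rfl⟩
    exact ⟨p.ev w 1 (genAlgGen w X), Term.map_ev w π₁ 1 _ p⟩
  let g := Function.surjInv hsurj
  have hg : ∀ q, π₁ (g q) = q := Function.surjInv_eq hsurj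
  refine ⟨{ toFun := fun q => π₂ (g q), map_smul' := fun c a => ?_, map_zero' := ?_,
            map_add' := fun a b => ?_, map_mul' := fun a b => ?_, map_star' := fun a => ?_ },
          fun i => ?_⟩
  · rw [show g (c • a) = c • g a from hinj (by rw [map_smul, hg, hg]), map_smul]; rfl
  · rw [show g 0 = 0 from hinj (by rw [map_zero, hg]), map_zero]
  · rw [show g (a + b) = g a + g b from hinj (by rw [map_add, hg, hg, hg]), map_add]
  · rw [show g (a * b) = g a * g b from hinj (by rw [map_mul, hg, hg, hg]), map_mul]
  · rw [show g (star a) = star (g a) from hinj (by rw [map_star, hg, hg]), map_star]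
  · change π₂ (g (y i)) = d i
    rw [show g (y i) = genAlgGen w X i from hinj (hg _)]
    rfl

end Dense

end

section

open scoped ENNReal

/-- Evaluation at a coordinate of the `ℓ^∞`-product, as a *-homomorphism. -/
def lpEval {N : Type*} (D : N → Type*) [∀ n, NonUnitalCStarAlgebra (D n)] (n : N) :
    lp D ∞ →⋆ₙₐ[ℂ] D n where
  toFun f := f n
  map_smul' _ _ := rfl
  map_zero' := rfl
  map_add' _ _ := rfl
  map_mul' _ _ := rfl
  map_star' _ := rfl

theorem lpEval_apply {N : Type*} (D : N → Type*) [∀ n, NonUnitalCStarAlgebra (D n)] (n : N)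
    (f : lp D ∞) : lpEval D n f = f n := rfl

variable {ι : Type} (w : ι → ℕ) (T : Set (Term ι)) (e : ℝ)

/-- `y` is a universal solution of the relations `Sat w T e 1`. -/
structure IsUniversalSolution {Q : Type u} [NonUnitalCStarAlgebra Q] (y : ι → Q) : Prop where
  dense : DenseRange fun p : Term ι => p.ev w 1 y
  sat : Sat w T e 1 y
  exists_hom : ∀ (D : Type u) [NonUnitalCStarAlgebra D] (d : ι → D), Sat w T e 1 d →
    ∃ ψ : Q →⋆ₙₐ[ℂ] D, ∀ i, ψ (y i) = d i

variable {w T e}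

theorem Sat.map {M : ℝ} (he : 0 ≤ e) {C D : Type*} [NonUnitalCStarAlgebra C]
    [NonUnitalCStarAlgebra D] (π : C →⋆ₙₐ[ℂ] D) {X : ι → C} (hX : Sat w T e M X) :
    Sat w T e M fun i => π (X i) := by
  intro p hp s hs
  rw [← Term.map_ev]
  refine le_trans ?_ (hX p hp s hs)
  have : 0 ≤ s + e := add_nonneg hs.1 he
  gcongr
  exact NonUnitalStarAlgHom.norm_apply_le _ _

theorem IsUniversalSolution.isProjective [Finite ι] (hTf : T.Finite) (hT : BoundsVars T)
    (he : 0 < e) (he1 : e ≤ 1) {Q : Type u} [NonUnitalCStarAlgebra Q] {y : ι → Q}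
    (hy : IsUniversalSolution w T e y) : IsProjective Q := by
  intro C D _ _ π hπ σ
  obtain ⟨X, hX, hXs⟩ := exists_lift_sat (w := w) hTf hT he he1 π hπ _ (hy.sat.map he.le σ)
  obtain ⟨ψ, hψ⟩ := hy.exists_hom C X hXs
  refine ⟨ψ, hom_ext_of_dense hy.dense fun i => ?_⟩
  simp [hψ, hX]

variable (w T e)

/-- The possible norm functions on terms of solutions of the relations. -/
def SolutionNorm : Type :=
  {N : Term ι → ℝ // ∃ (D : Type u) (_ : NonUnitalCStarAlgebra D) (d : ι → D),
    Sat w T e 1 d ∧ ∀ p, N p = ‖p.ev w 1 d‖}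

namespace SolutionNorm

variable {w T e}

/-- A C*-algebra containing a solution with the prescribed norms. -/
def alg (N : SolutionNorm.{u} w T e) : Type u := N.2.choose

instance (N : SolutionNorm.{u} w T e) : NonUnitalCStarAlgebra N.alg := N.2.choose_spec.choose

/-- A solution with the prescribed norms. -/
def sol (N : SolutionNorm.{u} w T e) : ι → N.alg := N.2.choose_spec.choose_spec.choose

theorem sat_sol (N : SolutionNorm.{u} w T e) : Sat w T e 1 N.sol :=
  N.2.choose_spec.choose_spec.choose_spec.1

theorem norm_ev_sol (N : SolutionNorm.{u} w T e) (p : Term ι) : N.1 p = ‖p.ev w 1 N.sol‖ :=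
  N.2.choose_spec.choose_spec.choose_spec.2 p

end SolutionNorm

theorem exists_isUniversalSolution [Finite ι] (hT : BoundsVars T) (he : 0 < e) :
    ∃ (Q : Type u) (_ : NonUnitalCStarAlgebra Q) (y : ι → Q), IsUniversalSolution w T e y := by
  obtain ⟨R, hR, hbd⟩ := hT.exists_bound (w := w) he 1 zero_le_one
  let P := lp (fun N : SolutionNorm.{u} w T e => N.alg) ∞
  let x : ι → P := fun i => ⟨fun N => N.sol i, memℓp_infty ⟨R, by
    rintro _ ⟨N, rfl⟩
    exact hbd N.sol N.sat_sol i⟩⟩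
  have hx : ∀ (p : Term ι) (s : ℝ) N, (p.ev w s x : P) N = p.ev w s N.sol := fun p s N =>
    Term.map_ev w (lpEval _ N) s x p
  refine ⟨genAlg w x, inferInstance, genAlgGen w x, denseRange_genAlgGen w x, ?_, ?_⟩
  · intro p hp s hs
    have hse : 0 < s + e := add_pos_of_nonneg_of_pos hs.1 he
    rw [norm_genAlg, coe_ev_genAlgGen, ← le_div_iff₀ hse]
    refine lp.norm_le_of_forall_le (by positivity) fun N => ?_
    rw [hx, le_div_iff₀ hse]
    exact N.sat_sol p hp s hs
  · intro D _ d hd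
    refine exists_hom_of_norm_le (denseRange_genAlgGen w x) d fun p => ?_
    let N : SolutionNorm.{u} w T e := ⟨fun p => ‖p.ev w 1 d‖, D, _, d, hd, fun _ => rfl⟩
    change N.1 p ≤ _
    rw [N.norm_ev_sol, norm_genAlg, coe_ev_genAlgGen, ← hx]
    exact lp.norm_apply_le_norm ENNReal.top_ne_zero _ _

end

section

section FinitelyGenerated

variable {P : Type*} [NonUnitalCStarAlgebra P]

theorem isCStarSubset_coe (S : NonUnitalStarSubalgebra ℂ P) (hS : IsClosed (S : Set P)) :
    IsCStarSubset (S : Set P) :=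
  ⟨hS, S.zero_mem, fun _ hx _ hy => S.add_mem hx hy, fun _ hx _ hy => S.mul_mem hx hy,
    fun c _ hx => S.smul_mem c hx, fun _ hx => star_mem hx⟩

theorem exists_generators (h : IsFinitelyGeneratedCStar P) :
    ∃ (n : ℕ) (x : Fin n → P), DenseRange fun p : Term (Fin n) => p.ev 0 1 x := by
  obtain ⟨S, hS⟩ := h
  refine ⟨S.card, fun i => S.equivFin.symm i, ?_⟩
  set x : Fin S.card → P := fun i => S.equivFin.symm i
  have hu := hS (genAlg 0 x) (isCStarSubset_coe _ (isClosed_genAlg 0 x)) fun a ha => by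
    have := mem_genAlg 0 x (S.equivFin ⟨a, ha⟩)
    simpa [x] using this
  intro a
  change a ∈ (genAlg 0 x : Set P)
  rw [hu]
  exact mem_univ a

/-- The values of terms of bounded depth. -/
def evDepth {ι : Type} (x : ι → P) : ℕ → Set P
  | 0 => insert 0 (range x)
  | n + 1 => evDepth x n ∪ ((fun q : P × P => q.1 + q.2) '' (evDepth x n ×ˢ evDepth x n) ∪
      ((fun q : P × P => q.1 * q.2) '' (evDepth x n ×ˢ evDepth x n) ∪
      ((fun q : ℂ × P => q.1 • q.2) '' (univ ×ˢ evDepth x n) ∪ star '' evDepth x n)))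

open TopologicalSpace in
theorem separableSpace_of_isFinitelyGenerated (h : IsFinitelyGeneratedCStar P) :
    SeparableSpace P := by
  obtain ⟨m, x, hx⟩ := exists_generators h
  have hsep : ∀ n, IsSeparable (evDepth x n) := by
    intro n
    induction n with
    | zero => exact ((finite_range x).insert 0).isSeparable
    | succ n ih =>
      refine ih.union (IsSeparable.union ?_ (IsSeparable.union ?_ (IsSeparable.union ?_ ?_)))
      · exact (ih.prod ih).image continuous_add
      · exact (ih.prod ih).image continuous_mul
      · exact ((IsSeparable.of_separableSpace univ).prod ih).image continuous_smul
      · exact ih.image continuous_star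
  have hmono : Monotone (evDepth x) := monotone_nat_of_le_succ fun n => subset_union_left
  have hmem : ∀ p : Term (Fin m), ∃ n, p.ev 0 1 x ∈ evDepth x n := by
    intro p
    induction p with
    | zero => exact ⟨0, mem_insert _ _⟩
    | var i => exact ⟨0, by simp [Term.ev, evDepth]⟩
    | add p q hp hq =>
      obtain ⟨a, ha⟩ := hp
      obtain ⟨b, hb⟩ := hq
      exact ⟨max a b + 1, .inr (.inl ⟨(_, _), ⟨hmono (le_max_left a b) ha,
        hmono (le_max_right a b) hb⟩, rfl⟩)⟩
    | mul p q hp hq =>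
      obtain ⟨a, ha⟩ := hp
      obtain ⟨b, hb⟩ := hq
      exact ⟨max a b + 1, .inr (.inr (.inl ⟨(_, _), ⟨hmono (le_max_left a b) ha,
        hmono (le_max_right a b) hb⟩, by simp [Term.ev]⟩))⟩
    | smul c p hp =>
      obtain ⟨a, ha⟩ := hp
      exact ⟨a + 1, .inr (.inr (.inr (.inl ⟨(c, _), ⟨mem_univ _, ha⟩, rfl⟩)))⟩
    | adj p hp =>
      obtain ⟨a, ha⟩ := hp
      exact ⟨a + 1, .inr (.inr (.inr (.inr ⟨_, ha, rfl⟩)))⟩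
  have h1 : IsSeparable (range fun p : Term (Fin m) => p.ev 0 1 x) :=
    (IsSeparable.iUnion hsep).mono (range_subset_iff.2 fun p => mem_iUnion.2 (hmem p))
  have h2 := h1.closure
  rw [hx.closure_eq] at h2
  exact isSeparable_univ_iff.1 h2

end FinitelyGenerated

section RangeLifting

theorem isCStarSubset_preimage_range {P C D : Type*} [NonUnitalCStarAlgebra P]
    [NonUnitalCStarAlgebra C] [NonUnitalCStarAlgebra D] (π : C →⋆ₙₐ[ℂ] D) (σ : P →⋆ₙₐ[ℂ] D) :
    IsCStarSubset {p | σ p ∈ range π} := by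
  refine ⟨(isClosed_range π).preimage (continuous_starHom σ), ⟨0, by simp⟩, ?_, ?_, ?_, ?_⟩
  · rintro x ⟨a, ha⟩ y ⟨b, hb⟩
    exact ⟨a + b, by simp [ha, hb]⟩
  · rintro x ⟨a, ha⟩ y ⟨b, hb⟩
    exact ⟨a * b, by simp [ha, hb]⟩
  · rintro c x ⟨a, ha⟩
    exact ⟨c • a, by simp [ha]⟩
  · rintro x ⟨a, ha⟩
    exact ⟨star a, by simp [ha, map_star]⟩

theorem _root_.IsProjective.exists_lift {P C D : Type u} [NonUnitalCStarAlgebra P]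
    [NonUnitalCStarAlgebra C] [NonUnitalCStarAlgebra D] (hP : IsProjective P)
    (π : C →⋆ₙₐ[ℂ] D) (σ : P →⋆ₙₐ[ℂ] D) (h : ∀ p, σ p ∈ range π) :
    ∃ ψ : P →⋆ₙₐ[ℂ] C, ∀ p, π (ψ p) = σ p := by
  let R := NonUnitalStarAlgHom.range π
  have hcl : IsClosed (R : Set D) := by
    rw [NonUnitalStarAlgHom.coe_range]
    exact isClosed_range π
  let _ : NonUnitalCStarAlgebra R := NonUnitalStarSubalgebra.nonUnitalCStarAlgebra R
  let π' : C →⋆ₙₐ[ℂ] R := NonUnitalStarAlgHom.codRestrict π R fun c => ⟨c, rfl⟩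
  let σ' : P →⋆ₙₐ[ℂ] R := NonUnitalStarAlgHom.codRestrict σ R fun p => h p
  have hπ' : Function.Surjective π' := by
    rintro ⟨_, c, rfl⟩
    exact ⟨c, rfl⟩
  obtain ⟨ψ, hψ⟩ := hP C R π' hπ' σ'
  exact ⟨ψ, fun p => congrArg Subtype.val (DFunLike.congr_fun hψ p)⟩

theorem _root_.IsProjective.exists_lift_of_dense {P C D : Type u} [NonUnitalCStarAlgebra P]
    [NonUnitalCStarAlgebra C] [NonUnitalCStarAlgebra D] (hP : IsProjective P)
    {ι : Type} {w : ι → ℕ} {y : ι → P} (hy : DenseRange fun p : Term ι => p.ev w 1 y)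
    (π : C →⋆ₙₐ[ℂ] D) (σ : P →⋆ₙₐ[ℂ] D) (h : ∀ i, σ (y i) ∈ range π) :
    ∃ ψ : P →⋆ₙₐ[ℂ] C, ∀ p, π (ψ p) = σ p :=
  hP.exists_lift π σ fun p =>
    eq_univ_iff_forall.1 (eq_univ_of_dense hy (isCStarSubset_preimage_range π σ) h) p

end RangeLifting

end

section

/-- The paths `t ↦ t ^ (w i + 1) • b i`, which vanish at `0`. -/
def conePath {ι : Type} (w : ι → ℕ) {B : Type*} [NonUnitalCStarAlgebra B] (b : ι → B) (i : ι) :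
    C(unitInterval, B) :=
  ⟨fun t => (t : ℝ) ^ (w i + 1) • b i, by fun_prop⟩

/-- Evaluation of a continuous function at a point, as a *-homomorphism. -/
def evalHom {X : Type*} [TopologicalSpace X] [CompactSpace X] {B : Type*}
    [NonUnitalCStarAlgebra B] (t : X) : C(X, B) →⋆ₙₐ[ℂ] B where
  toFun f := f t
  map_smul' _ _ := rfl
  map_zero' := rfl
  map_add' _ _ := rfl
  map_mul' _ _ := rfl
  map_star' _ := rfl

theorem evalHom_apply {X : Type*} [TopologicalSpace X] [CompactSpace X] {B : Type*}
    [NonUnitalCStarAlgebra B] (t : X) (f : C(X, B)) : evalHom t f = f t := rfl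

section Cone

variable {ι : Type} (w : ι → ℕ) {B : Type*} [NonUnitalCStarAlgebra B] (b : ι → B)

theorem ev_conePath_apply (s : ℝ) (p : Term ι) (t : unitInterval) :
    p.ev w s (conePath w b) t = (t : ℝ) • p.ev w (s * t) b := by
  rw [← Term.ev_rescale, ← evalHom_apply, Term.map_ev]
  rfl

theorem mul_norm_ev_conePath_le {s : ℝ} (hs : s ∈ Icc (0 : ℝ) 1) (p : Term ι) :
    s * ‖p.ev w s (conePath w b)‖ ≤ ‖p.ev w 1 (conePath w b)‖ := by
  have h0 : ‖s • p.ev w s (conePath w b)‖ ≤ ‖p.ev w 1 (conePath w b)‖ := by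
    refine (ContinuousMap.norm_le _ (norm_nonneg _)).2 fun t => ?_
    let st : unitInterval := ⟨s * t, mul_nonneg hs.1 t.2.1, mul_le_one₀ hs.2 t.2.1 t.2.2⟩
    have h1 : (s • p.ev w s (conePath w b)) t = p.ev w 1 (conePath w b) st := by
      rw [ContinuousMap.smul_apply, ev_conePath_apply, ev_conePath_apply, smul_smul, one_mul]
    rw [h1]
    exact ContinuousMap.norm_coe_le_norm _ st
  rwa [norm_smul, Real.norm_of_nonneg hs.1] at h0

theorem exists_bound_ev {D : Type*} [NonUnitalCStarAlgebra D] (X : ι → D) (p : Term ι) :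
    ∃ K : ℝ, 0 ≤ K ∧ ∀ s ∈ Icc (0 : ℝ) 1, ‖p.ev w s X‖ ≤ K := by
  have hc : Continuous fun s : ℝ => ‖p.ev w s X‖ :=
    ((Term.continuous_ev w p).comp (by fun_prop : Continuous fun s : ℝ => (s, X))).norm
  obtain ⟨K, hK⟩ := (isCompact_Icc.image hc).bddAbove
  exact ⟨K, (norm_nonneg _).trans (hK ⟨0, by simp, rfl⟩), fun s hs => hK ⟨s, hs, rfl⟩⟩

end Cone

theorem norm_ofReal_smul_mul_le_one {D : Type*} [NonUnitalCStarAlgebra D] {R : ℝ} (hR : 0 < R)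
    (a : D) (r : ℝ) : ‖((R⁻¹ : ℝ) : ℂ) • a‖ * r ≤ 1 ↔ ‖a‖ * r ≤ R := by
  rw [norm_smul, Complex.norm_of_nonneg (by positivity), mul_assoc, inv_mul_le_iff₀ hR, mul_one]

/-- Scaled variables, with a common scale `R⁻¹`. -/
def scaledVars (ι : Type) (R : ℝ) : Set (Term ι) :=
  range fun i => Term.smul ((R⁻¹ : ℝ) : ℂ) (.var i)

theorem boundsVars_of_scaledVars_subset {ι : Type} {R : ℝ} (hR : 0 < R) {T : Set (Term ι)}
    (h : scaledVars ι R ⊆ T) : BoundsVars T :=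
  fun i => ⟨_, by exact_mod_cast (inv_pos.2 hR).ne', h ⟨i, rfl⟩⟩

theorem sat_scaledVars {ι : Type} (w : ι → ℕ) {R e : ℝ} (hR : 0 < R) (he : 0 ≤ e) (he1 : e ≤ 1)
    {D : Type*} [NonUnitalCStarAlgebra D] (d : ι → D) (hd : ∀ i, ‖d i‖ * 2 ≤ R) :
    Sat w (scaledVars ι R) e 1 d := by
  rintro _ ⟨i, rfl⟩ s hs
  refine (norm_ofReal_smul_mul_le_one hR _ _).2 (le_trans ?_ (hd i))
  simp only [Term.ev]
  rw [norm_smul, norm_pow, Real.norm_of_nonneg hs.1]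
  have h1 : s ^ w i ≤ 1 := pow_le_one₀ hs.1 hs.2
  have h2 : s ^ w i * ‖d i‖ ≤ ‖d i‖ := mul_le_of_le_one_left (norm_nonneg _) h1
  have h3 : s + e ≤ 2 := by linarith [hs.2]
  have h4 : 0 ≤ s + e := add_nonneg hs.1 he
  gcongr

theorem Sat.norm_ev_le {ι : Type} {w : ι → ℕ} {T : Set (Term ι)} {R e : ℝ} (hR : 0 < R)
    (he : 0 ≤ e) {D : Type*} [NonUnitalCStarAlgebra D] {d : ι → D} (hd : Sat w T e 1 d)
    {p : Term ι} (hp : Term.smul ((R⁻¹ : ℝ) : ℂ) p ∈ T) : ‖p.ev w 1 d‖ ≤ R := by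
  have h := (norm_ofReal_smul_mul_le_one hR (p.ev w 1 d) _).1 (hd _ hp 1 ⟨zero_le_one, le_rfl⟩)
  nlinarith [norm_nonneg (p.ev w 1 d)]

theorem exists_projective_over_cone {P B : Type u} [NonUnitalCStarAlgebra P]
    [NonUnitalCStarAlgebra B] (hP : IsProjective P) {ι : Type} [Finite ι] (w : ι → ℕ) (b : ι → B)
    (Φ : P →⋆ₙₐ[ℂ] genAlg w (conePath w b)) (G : Finset P) {ε : ℝ} (hε : 0 < ε) :
    ∃ (Q : Type u) (_ : NonUnitalCStarAlgebra Q) (ρ : Q →⋆ₙₐ[ℂ] genAlg w (conePath w b))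
      (α : P →⋆ₙₐ[ℂ] Q), IsFinitelyGeneratedCStar Q ∧ IsProjective Q ∧ Function.Surjective ρ ∧
        (∀ p, ρ (α p) = Φ p) ∧ ∀ g ∈ G, ‖α g‖ ≤ ‖Φ g‖ + ε := by
  set x := genAlgGen w (conePath w b) with hx
  have hsurj : ∀ {Q : Type u} [NonUnitalCStarAlgebra Q] (y : ι → Q)
      (ρ : Q →⋆ₙₐ[ℂ] genAlg w (conePath w b)), (∀ i, ρ (y i) = x i) → Function.Surjective ρ := by
    intro Q _ y ρ hρ
    refine surjective_of_denseRange ρ ((denseRange_genAlgGen w (conePath w b)).mono ?_)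
    rintro _ ⟨p, rfl⟩
    refine ⟨p.ev w 1 y, ?_⟩
    simp only [Term.map_ev, hρ, hx]
  obtain ⟨R, hR, hxR⟩ : ∃ R : ℝ, 0 < R ∧ ∀ i, ‖x i‖ * 2 ≤ R := by
    obtain ⟨R, hR⟩ := (finite_range fun i => ‖x i‖ * 2).bddAbove
    exact ⟨max R 1, by positivity, fun i => (hR ⟨i, rfl⟩).trans (le_max_left _ _)⟩
  have hR2 : 0 < R * 2 := by positivity
  obtain ⟨Q₀, _, y₀, hy₀⟩ := exists_isUniversalSolution.{u} w (scaledVars ι (R * 2)) 1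
    (boundsVars_of_scaledVars_subset hR2 subset_rfl) one_pos
  obtain ⟨ρ₀, hρ₀⟩ := hy₀.exists_hom _ x
    (sat_scaledVars w hR2 zero_le_one le_rfl x fun i => (hxR i).trans (by linarith))
  obtain ⟨α₀, hα₀⟩ := hP _ _ ρ₀ (hsurj y₀ ρ₀ hρ₀) Φ
  replace hα₀ : ∀ p, ρ₀ (α₀ p) = Φ p := DFunLike.congr_fun hα₀
  have happ : ∀ g : P, ∃ p : Term ι, ‖α₀ g - p.ev w 1 y₀‖ < ε / 4 := fun g => by
    simpa [dist_eq_norm] using hy₀.dense.exists_dist_lt (α₀ g) (by positivity : 0 < ε / 4)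
  choose t ht using happ
  have htx : ∀ g, ‖(t g).ev w 1 x‖ ≤ ‖Φ g‖ + ε / 4 := fun g => by
    have h1 : (t g).ev w 1 x = Φ g - ρ₀ (α₀ g - (t g).ev w 1 y₀) := by
      rw [map_sub, hα₀, Term.map_ev]
      simp only [hρ₀, sub_sub_cancel]
    rw [h1]
    exact (norm_sub_le _ _).trans (by
      linarith [NonUnitalStarAlgHom.norm_apply_le ρ₀ (α₀ g - (t g).ev w 1 y₀), ht g])
  choose K hK hKt using fun g => exists_bound_ev w x (t g)
  obtain ⟨e, he, he1, heK⟩ : ∃ e : ℝ, 0 < e ∧ e ≤ 1 ∧ ∀ g ∈ G, K g * e ≤ ε / 4 := by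
    obtain ⟨M, hM⟩ := (G.image K).bddAbove
    have hM0 : 0 < max M 1 := by positivity
    refine ⟨min 1 (ε / 4 / max M 1), by positivity, min_le_left _ _, fun g hg => ?_⟩
    have h1 : K g ≤ max M 1 :=
      (hM (Finset.mem_coe.2 (Finset.mem_image_of_mem K hg))).trans (le_max_left _ _)
    calc K g * min 1 (ε / 4 / max M 1) ≤ max M 1 * (ε / 4 / max M 1) := by
          gcongr
          exact min_le_right _ _
      _ = ε / 4 := by field_simp
  let T : Set (Term ι) := scaledVars ι R ∪
    (fun g => Term.smul (((‖Φ g‖ + 3 * (ε / 4))⁻¹ : ℝ) : ℂ) (t g)) '' G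
  have hTf : T.Finite := (finite_range _).union (G.finite_toSet.image _)
  have hT : BoundsVars T := boundsVars_of_scaledVars_subset hR subset_union_left
  obtain ⟨Q, _, y, hy⟩ := exists_isUniversalSolution.{u} w T e hT he
  have hpos : ∀ g, 0 < ‖Φ g‖ + 3 * (ε / 4) := fun g => by positivity
  have hxT : Sat w T e 1 x := by
    rintro p (hp | ⟨g, hg, rfl⟩) s hs
    · exact sat_scaledVars w hR he.le he1 x hxR p hp s hs
    · refine (norm_ofReal_smul_mul_le_one (hpos g) _ _).2 ?_
      have h1 : s * ‖(t g).ev w s x‖ ≤ ‖(t g).ev w 1 x‖ := by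
        rw [norm_genAlg, norm_genAlg, hx, coe_ev_genAlgGen, coe_ev_genAlgGen]
        exact mul_norm_ev_conePath_le w b hs (t g)
      have h2 := mul_le_mul_of_nonneg_right (hKt g s hs) he.le
      have h3 := htx g
      have h4 := heK g hg
      linarith
  obtain ⟨ρ, hρ⟩ := hy.exists_hom _ x hxT
  have hyR : ∀ i, ‖y i‖ ≤ R := fun i => by
    simpa [Term.ev] using hy.sat.norm_ev_le hR he.le (p := .var i) (.inl ⟨i, rfl⟩)
  obtain ⟨κ, hκ⟩ := hy₀.exists_hom _ y
    (sat_scaledVars w hR2 zero_le_one le_rfl y fun i => by linarith [hyR i])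
  have hρκ : ρ.comp κ = ρ₀ := hom_ext_of_dense hy₀.dense fun i => by simp [hκ, hρ, hρ₀]
  refine ⟨Q, _, ρ, κ.comp α₀, isFinitelyGenerated_of_dense hy.dense,
    hy.isProjective hTf hT he he1, hsurj y ρ hρ, fun p => ?_, fun g hg => ?_⟩
  · rw [← hα₀ p, ← hρκ]
    rfl
  · have h1 : κ (α₀ g) = (t g).ev w 1 y + κ (α₀ g - (t g).ev w 1 y₀) := by
      rw [map_sub, Term.map_ev]
      simp only [hκ, add_sub_cancel]
    have h2 := hy.sat.norm_ev_le (hpos g) he.le (p := t g) (.inr ⟨g, hg, rfl⟩)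
    rw [NonUnitalStarAlgHom.comp_apply, h1]
    exact (norm_add_le _ _).trans (by
      linarith [NonUnitalStarAlgHom.norm_apply_le κ (α₀ g - (t g).ev w 1 y₀), ht g])

end

section

open scoped ENNReal

section Asymptotic

variable {B : Type u} [NonUnitalCStarAlgebra B] {D : ℕ → Type u}
  [∀ n, NonUnitalCStarAlgebra (D n)] (κ : ∀ n, D n →⋆ₙₐ[ℂ] B)

/-- The algebra of bounded sequences in a sequence of algebras over `B` which converge in `B`,
together with their limits. -/
def convAlg : NonUnitalStarSubalgebra ℂ (B × lp D ∞) where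
  carrier := {z | Tendsto (fun n => κ n (z.2 n)) atTop (𝓝 z.1)}
  add_mem' {a b} ha hb := by
    simpa using ha.add hb
  zero_mem' := by
    simp
  mul_mem' {a b} ha hb := by
    simpa using ha.mul hb
  smul_mem' c a ha := by
    simpa using ha.const_smul c
  star_mem' {a} ha := by
    simpa [map_star] using ha.star

theorem isClosed_convAlg : IsClosed (convAlg κ : Set (B × lp D ∞)) := by
  refine isClosed_of_closure_subset fun z hz => ?_
  refine Metric.tendsto_atTop.2 fun ε hε => ?_
  obtain ⟨z', hz', hd⟩ := Metric.mem_closure_iff.1 hz (ε / 3) (by positivity)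
  obtain ⟨N, hN⟩ := Metric.tendsto_atTop.1 hz' (ε / 3) (by positivity)
  refine ⟨N, fun n hn => ?_⟩
  have h1 : dist z.1 z'.1 < ε / 3 := (le_max_left _ _).trans_lt hd
  have h2 : dist (κ n (z.2 n)) (κ n (z'.2 n)) < ε / 3 := by
    refine lt_of_le_of_lt ?_ ((le_max_right _ _).trans_lt hd)
    rw [dist_eq_norm, dist_eq_norm, ← map_sub]
    exact (NonUnitalStarAlgHom.norm_apply_le _ _).trans
      (lp.norm_apply_le_norm ENNReal.top_ne_zero (z.2 - z'.2) n)
  have h3 := hN n hn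
  calc dist (κ n (z.2 n)) z.1 ≤ _ := dist_triangle4 _ (κ n (z'.2 n)) z'.1 _
    _ < ε := by rw [dist_comm z'.1]; linarith

instance : NonUnitalCStarAlgebra (convAlg κ) :=
  NonUnitalStarSubalgebra.nonUnitalCStarAlgebra _ (h_closed := isClosed_convAlg κ)

theorem eventually_exists_approx_hom {P : Type u} [NonUnitalCStarAlgebra P] (hP : IsProjective P)
    {ι : Type} {w : ι → ℕ} {y : ι → P} (hy : DenseRange fun p : Term ι => p.ev w 1 y)
    (φ : P →⋆ₙₐ[ℂ] B)
    (hφ : ∀ i, φ (y i) ∈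
      closure {b | ∃ x : lp D ∞, Tendsto (fun n => κ n (x n)) atTop (𝓝 b)})
    (G : Finset P) {ε : ℝ} (hε : 0 < ε) :
    ∀ᶠ n in atTop, ∃ β : P →⋆ₙₐ[ℂ] D n, ∀ g ∈ G, ‖κ n (β g) - φ g‖ < ε := by
  let incl : convAlg κ →⋆ₙₐ[ℂ] B × lp D ∞ := NonUnitalStarSubalgebraClass.subtype _
  let π : convAlg κ →⋆ₙₐ[ℂ] B := (NonUnitalStarAlgHom.fst ℂ B (lp D ∞)).comp incl
  have hπ : ∀ i, φ (y i) ∈ range π := fun i => by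
    rw [← (isClosed_range π).closure_eq]
    refine closure_mono ?_ (hφ i)
    rintro b ⟨x, hx⟩
    exact ⟨⟨(b, x), hx⟩, rfl⟩
  obtain ⟨ψ, hψ⟩ := hP.exists_lift_of_dense hy π φ hπ
  have h : ∀ g ∈ G, ∀ᶠ n in atTop, ‖κ n ((ψ g).1.2 n) - φ g‖ < ε := fun g _ => by
    have h1 : Tendsto (fun n => κ n ((ψ g).1.2 n)) atTop (𝓝 (ψ g).1.1) := (ψ g).2
    have h2 : (ψ g).1.1 = φ g := hψ g
    rw [h2] at h1
    simpa only [dist_eq_norm] using Metric.tendsto_nhds.1 h1 ε hε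
  filter_upwards [(G.eventually_all).2 h] with n hn
  exact ⟨(lpEval D n).comp ((NonUnitalStarAlgHom.snd ℂ B (lp D ∞)).comp (incl.comp ψ)), hn⟩

end Asymptotic

section ConeApprox

variable {B : Type*} [NonUnitalCStarAlgebra B]

/-- Continuous paths of the form `t ↦ ∑ j < N, t ^ (j + 1) • c j`. -/
def powerSum (N : ℕ) (c : ℕ → B) : C(unitInterval, B) :=
  ⟨fun t => ∑ j ∈ Finset.range N, (t : ℝ) ^ (j + 1) • c j, by fun_prop⟩

theorem powerSum_eq_of_le {N M : ℕ} (h : N ≤ M) (c : ℕ → B) :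
    ∃ c', powerSum M c' = powerSum N c := by
  refine ⟨fun j => if j < N then c j else 0, ContinuousMap.ext fun t => ?_⟩
  simp only [powerSum, ContinuousMap.coe_mk]
  rw [← Finset.sum_subset (Finset.range_mono h)]
  · exact Finset.sum_congr rfl fun j hj => by rw [if_pos (Finset.mem_range.1 hj)]
  · intro j _ hj
    rw [if_neg (by simpa using hj), smul_zero]

theorem powerSum_add (N : ℕ) (c c' : ℕ → B) :
    powerSum N c + powerSum N c' = powerSum N (c + c') := by
  ext t
  simp [powerSum, Finset.sum_add_distrib]

theorem exists_powerSum_sum {α : Type*} (s : Finset α) (f : α → C(unitInterval, B))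
    (h : ∀ a ∈ s, ∃ N c, f a = powerSum N c) : ∃ N c, ∑ a ∈ s, f a = powerSum N c := by
  classical
  induction s using Finset.induction_on with
  | empty => exact ⟨0, 0, by ext; simp [powerSum]⟩
  | insert a s ha ih =>
    obtain ⟨N, c, hc⟩ := ih fun b hb => h b (Finset.mem_insert_of_mem hb)
    obtain ⟨M, d, hd⟩ := h a (Finset.mem_insert_self _ _)
    obtain ⟨c', hc'⟩ := powerSum_eq_of_le (le_max_left N M) c
    obtain ⟨d', hd'⟩ := powerSum_eq_of_le (le_max_right N M) d
    exact ⟨max N M, d' + c', by rw [Finset.sum_insert ha, hc, hd, ← hc', ← hd', powerSum_add]⟩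

theorem exists_powerSum_of_polynomial (p : Polynomial ℝ) (hp : p.coeff 0 = 0) (b : B)
    (f : C(unitInterval, B)) (hf : ∀ t : unitInterval, f t = p.eval (t : ℝ) • b) :
    ∃ N c, f = powerSum N c := by
  refine ⟨p.natDegree, fun j => p.coeff (j + 1) • b, ContinuousMap.ext fun t => ?_⟩
  rw [hf, Polynomial.eval_eq_sum_range, Finset.sum_range_succ']
  simp [powerSum, hp, Finset.sum_smul, smul_smul, mul_comm]

theorem exists_powerSum_norm_sub_lt (f : C(unitInterval, B)) (hf : f 0 = 0) {ε : ℝ} (hε : 0 < ε) :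
    ∃ N c, ‖powerSum N c - f‖ < ε := by
  obtain ⟨n, hn⟩ := (Metric.tendsto_nhds.1 (bernsteinApproximation_uniform f) ε hε).exists
  rw [dist_eq_norm] at hn
  suffices ∃ N c, bernsteinApproximation n f = powerSum N c by
    obtain ⟨N, c, h⟩ := this
    exact ⟨N, c, h ▸ hn⟩
  rw [bernsteinApproximation]
  refine exists_powerSum_sum _ _ fun k _ => ?_
  rcases Nat.eq_zero_or_pos (k : ℕ) with hk | hk
  · refine ⟨0, 0, ContinuousMap.ext fun t => ?_⟩
    have hz : bernstein.z k = 0 := Subtype.ext (by simp [bernstein.z, hk])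
    simp [powerSum, hz, hf]
  · refine exists_powerSum_of_polynomial (bernsteinPolynomial ℝ n k) ?_
      (f (bernstein.z k)) _ fun t => ?_
    · rw [Polynomial.coeff_zero_eq_eval_zero, bernsteinPolynomial.eval_at_0, if_neg hk.ne']
    · rfl

end ConeApprox

section Cone

variable {J : Type} {B : Type*} [NonUnitalCStarAlgebra B]

/-- The weight on the index set `J × Fin N` given by the second coordinate. -/
def sndWeight (J : Type) (N : ℕ) (q : J × Fin N) : ℕ := q.2

/-- The C*-algebra generated by the paths `t ↦ t ^ (k + 1) • c j k` for `k < N`. -/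
abbrev coneAlg (N : ℕ) (c : J → ℕ → B) : NonUnitalStarSubalgebra ℂ C(unitInterval, B) :=
  genAlg (sndWeight J N) (conePath (sndWeight J N) fun q => c q.1 q.2)

theorem powerSum_mem_coneAlg (N : ℕ) (c : J → ℕ → B) (j : J) :
    powerSum N (c j) ∈ coneAlg N c := by
  have h : powerSum N (c j) =
      ∑ l : Fin N, conePath (sndWeight J N) (fun q => c q.1 q.2) (j, l) := by
    ext t
    simp [powerSum, conePath, sndWeight, Finset.sum_range]
  rw [h]
  exact sum_mem fun l _ => mem_genAlg _ _ _

theorem exists_powerSum_family [Finite J] (f : J → C(unitInterval, B)) (hf : ∀ j, f j 0 = 0)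
    {ε : ℝ} (hε : 0 < ε) : ∃ (N : ℕ) (c : J → ℕ → B), ∀ j, ‖powerSum N (c j) - f j‖ < ε := by
  choose N c hc using fun j => exists_powerSum_norm_sub_lt (f j) (hf j) hε
  obtain ⟨M, hM⟩ := (finite_range N).bddAbove
  choose c' hc' using fun j => powerSum_eq_of_le (hM ⟨j, rfl⟩) (c j)
  exact ⟨M, c', fun j => by rw [hc']; exact hc j⟩

end Cone

theorem exists_projective_factor_cone {P B : Type u} [NonUnitalCStarAlgebra P]
    [NonUnitalCStarAlgebra B] (hPfg : IsFinitelyGeneratedCStar P) (hP : IsProjective P)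
    (H : P →⋆ₙₐ[ℂ] C(unitInterval, B)) (hH : ∀ p, H p 0 = 0) (G : Finset P)
    (F : Finset C(unitInterval, B)) (hF : ∀ f ∈ F, f 0 = 0) {ε : ℝ} (hε : 0 < ε) :
    ∃ (Q : Type u) (_ : NonUnitalCStarAlgebra Q) (α : P →⋆ₙₐ[ℂ] Q)
      (θ : Q →⋆ₙₐ[ℂ] C(unitInterval, B)), IsFinitelyGeneratedCStar Q ∧ IsProjective Q ∧
        (∀ g ∈ G, ‖θ (α g) - H g‖ < ε) ∧ (∀ g ∈ G, ‖α g‖ ≤ ‖H g‖ + ε) ∧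
        ∀ f ∈ F, ∃ q, ‖θ q - f‖ < ε := by
  obtain ⟨n, y, hy⟩ := exists_generators hPfg
  let f : Fin n ⊕ Fin F.card → C(unitInterval, B) :=
    Sum.elim (fun i => H (y i)) fun i => F.equivFin.symm i
  have hf : ∀ j, f j 0 = 0 := by
    rintro (i | i)
    · exact hH _
    · exact hF _ (F.equivFin.symm i).2
  choose N c hc using fun K : ℕ =>
    exists_powerSum_family f hf (Nat.one_div_pos_of_nat (α := ℝ) (n := K))
  let D : ℕ → Type u := fun K => coneAlg (N K) (c K)
  let κ : ∀ K, D K →⋆ₙₐ[ℂ] C(unitInterval, B) := fun K => genAlgIncl _ _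
  let a : ∀ j K, D K := fun j K => ⟨powerSum (N K) (c K j), powerSum_mem_coneAlg _ _ j⟩
  have happ : ∀ i, ∃ x : lp D ∞, Tendsto (fun K => κ K (x K)) atTop (𝓝 (H (y i))) := by
    intro i
    have hlt : ∀ K, ‖a (.inl i) K‖ ≤ ‖H (y i)‖ + 1 := fun K => by
      have h1 : ‖powerSum (N K) (c K (.inl i)) - H (y i)‖ < _ := hc K (.inl i)
      have h2 : (1 : ℝ) / (K + 1) ≤ 1 := div_le_one_of_le₀ (by linarith [K.cast_nonneg (α := ℝ)])
        (by positivity)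
      change ‖powerSum (N K) (c K (.inl i))‖ ≤ _
      linarith [norm_le_norm_add_norm_sub' (powerSum (N K) (c K (.inl i))) (H (y i))]
    refine ⟨⟨a (.inl i), memℓp_infty ⟨_, by rintro _ ⟨K, rfl⟩; exact hlt K⟩⟩, ?_⟩
    rw [tendsto_iff_norm_sub_tendsto_zero]
    exact squeeze_zero (fun _ => norm_nonneg _) (fun K => (hc K (.inl i)).le)
      tendsto_one_div_add_atTop_nhds_zero_nat
  have hε2 : 0 < ε / 2 := by positivity
  obtain ⟨K, ⟨Φ, hΦ⟩, hK⟩ := ((eventually_exists_approx_hom κ hP hy H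
    (fun i => subset_closure (happ i)) G hε2).and
    ((tendsto_one_div_add_atTop_nhds_zero_nat (𝕜 := ℝ)).eventually_lt_const hε)).exists
  obtain ⟨Q, _, ρ, α, hQfg, hQ, hρ, hρα, hα⟩ := exists_projective_over_cone hP _ _ Φ G hε2
  refine ⟨Q, _, α, (κ K).comp ρ, hQfg, hQ, fun g hg => ?_, fun g hg => ?_, fun b hb => ?_⟩
  · rw [NonUnitalStarAlgHom.comp_apply, hρα]
    linarith [hΦ g hg]
  · have h1 : ‖Φ g‖ = ‖κ K (Φ g)‖ := rfl
    linarith [hα g hg, norm_le_norm_add_norm_sub' (κ K (Φ g)) (H g), hΦ g hg]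
  · obtain ⟨q, hq⟩ := hρ (a (.inr (F.equivFin ⟨b, hb⟩)) K)
    refine ⟨q, ?_⟩
    rw [NonUnitalStarAlgHom.comp_apply, hq]
    have h1 : f (.inr (F.equivFin ⟨b, hb⟩)) = b := by simp [f]
    have h2 := hc K (.inr (F.equivFin ⟨b, hb⟩))
    rw [h1] at h2
    exact h2.trans hK

end

section

open scoped ENNReal

/-- Reversal of paths, as a *-homomorphism. -/
def reverseHom (B : Type*) [NonUnitalCStarAlgebra B] :
    C(unitInterval, B) →⋆ₙₐ[ℂ] C(unitInterval, B) where
  toFun f := f.comp ⟨unitInterval.symm, unitInterval.continuous_symm⟩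
  map_smul' _ _ := rfl
  map_zero' := rfl
  map_add' _ _ := rfl
  map_mul' _ _ := rfl
  map_star' _ := rfl

theorem reverseHom_apply {B : Type*} [NonUnitalCStarAlgebra B] (f : C(unitInterval, B))
    (t : unitInterval) : reverseHom B f t = f (unitInterval.symm t) := rfl

section System

variable {A : Type u} [NonUnitalCStarAlgebra A] {Ak : ℕ → Type u}
  [∀ k, NonUnitalCStarAlgebra (Ak k)] {γ : ∀ k, Ak k →⋆ₙₐ[ℂ] Ak (k + 1)}
  {μ : ∀ k, Ak k →⋆ₙₐ[ℂ] A}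

theorem map_conn (hμ : ∀ k, (μ (k + 1)).comp (γ k) = μ k) (k : ℕ) (a : Ak k) :
    μ (k + 1) (γ k a) = μ k a := DFunLike.congr_fun (hμ k) a

theorem map_iterHom (hμ : ∀ k, (μ (k + 1)).comp (γ k) = μ k) (k n : ℕ) (a : Ak k) :
    μ (k + n) (iterHom γ k n a) = μ k a := by
  induction n with
  | zero => rfl
  | succ n ih => exact (map_conn hμ _ _).trans ih

open Classical in
/-- The sequence which vanishes before `k`, equals `c` at `k`, and is propagated by the
connecting morphisms afterwards. -/
def transport (γ : ∀ k, Ak k →⋆ₙₐ[ℂ] Ak (k + 1)) (k : ℕ) (c : Ak k) : ∀ n, Ak n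
  | 0 => if h : k = 0 then h ▸ c else 0
  | n + 1 => if h : k = n + 1 then h ▸ c else γ n (transport γ k c n)

theorem norm_transport_le (k : ℕ) (c : Ak k) (n : ℕ) : ‖transport γ k c n‖ ≤ ‖c‖ := by
  induction n with
  | zero =>
    rw [transport]
    split_ifs with h
    · subst h; rfl
    · simp
  | succ n ih =>
    rw [transport]
    split_ifs with h
    · subst h; rfl
    · exact (NonUnitalStarAlgHom.norm_apply_le _ _).trans ih

theorem transport_self (k : ℕ) (c : Ak k) : transport γ k c k = c := by
  cases k <;> simp [transport]

theorem map_transport (hμ : ∀ k, (μ (k + 1)).comp (γ k) = μ k) (k : ℕ) (c : Ak k) {n : ℕ}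
    (hn : k ≤ n) : μ n (transport γ k c n) = μ k c := by
  induction n, hn using Nat.le_induction with
  | base => rw [transport_self]
  | succ n hn ih => rw [transport, dif_neg (by omega), map_conn hμ, ih]

theorem mem_closure_limits (hlim : IsInductiveLimit γ A μ) (a : A) :
    a ∈ closure {b | ∃ x : lp Ak ∞, Tendsto (fun n => μ n (x n)) atTop (𝓝 b)} := by
  refine closure_mono ?_ (hlim.dense_union a)
  refine iUnion_subset fun k => ?_
  rintro _ ⟨c, rfl⟩
  refine ⟨⟨transport γ k c, memℓp_infty ⟨‖c‖, ?_⟩⟩, ?_⟩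
  · rintro _ ⟨n, rfl⟩
    exact norm_transport_le k c n
  · refine tendsto_const_nhds.congr' ?_
    filter_upwards [eventually_ge_atTop k] with n hn
    exact (map_transport hlim.compat k c hn).symm

theorem eventually_exists_norm_sub_lt (hlim : IsInductiveLimit γ A μ) (a : A) {ε : ℝ}
    (hε : 0 < ε) : ∀ᶠ n in atTop, ∃ c, ‖μ n c - a‖ < ε := by
  obtain ⟨b, hb, hab⟩ := Metric.mem_closure_iff.1 (hlim.dense_union a) ε hε
  obtain ⟨k, c, rfl⟩ := mem_iUnion.1 hb
  filter_upwards [eventually_ge_atTop k] with n hn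
  refine ⟨transport γ k c n, ?_⟩
  rwa [map_transport hlim.compat k c hn, ← dist_eq_norm, dist_comm]

theorem exists_projective_factor (hlim : IsInductiveLimit γ A μ) (hnull : ∀ k, NullHomotopic (γ k))
    {P : Type u} [NonUnitalCStarAlgebra P] (hPfg : IsFinitelyGeneratedCStar P)
    (hP : IsProjective P) (φ : P →⋆ₙₐ[ℂ] A) (G : Finset P) (F : Finset A) {ε : ℝ} (hε : 0 < ε) :
    ∃ (Q : Type u) (_ : NonUnitalCStarAlgebra Q) (α : P →⋆ₙₐ[ℂ] Q) (ψ : Q →⋆ₙₐ[ℂ] A),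
      IsFinitelyGeneratedCStar Q ∧ IsProjective Q ∧ (∀ g ∈ G, ‖ψ (α g) - φ g‖ < ε) ∧
        (∀ g ∈ G, ‖α g‖ ≤ ‖φ g‖ + ε) ∧ ∀ a ∈ F, ∃ q, ‖ψ q - a‖ < ε := by
  classical
  have hε4 : 0 < ε / 4 := by positivity
  obtain ⟨n₀, y, hy⟩ := exists_generators hPfg
  obtain ⟨n, ⟨β, hβ⟩, hFn⟩ := ((eventually_exists_approx_hom μ hP hy φ
    (fun i => mem_closure_limits hlim _) G hε4).and
    ((F.eventually_all).2 fun a _ => eventually_exists_norm_sub_lt hlim a hε4)).exists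
  obtain ⟨m, hm⟩ := ((G.eventually_all).2 fun g _ =>
    (hlim.norm_tendsto n (β g)).eventually_lt_const
      (lt_add_of_pos_right ‖μ n (β g)‖ hε4)).exists
  choose! c hc using hFn
  obtain ⟨H, hH0, hH1⟩ := hnull (n + m)
  let H' : Ak n →⋆ₙₐ[ℂ] C(unitInterval, Ak (n + m + 1)) :=
    (reverseHom _).comp (H.comp (iterHom γ n m))
  have hH'0 : ∀ a, H' a 0 = 0 := fun a => by
    simp [H', reverseHom_apply, hH1]
  have hH'1 : ∀ a, μ (n + m + 1) (H' a 1) = μ n a := fun a => by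
    simp only [H', NonUnitalStarAlgHom.comp_apply, reverseHom_apply, unitInterval.symm_one, hH0]
    rw [map_conn hlim.compat, map_iterHom hlim.compat]
  obtain ⟨Q, _, α, θ, hQfg, hQ, hθ, hα, hF⟩ := exists_projective_factor_cone hPfg hP
    (H'.comp β) (fun _ => hH'0 _) G (F.image fun a => H' (c a))
    (by
      intro f hf
      obtain ⟨a, -, rfl⟩ := Finset.mem_image.1 hf
      exact hH'0 _) hε4
  let ω : C(unitInterval, Ak (n + m + 1)) →⋆ₙₐ[ℂ] A := (μ (n + m + 1)).comp (evalHom 1)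
  have hω : ∀ a, ω (H' a) = μ n a := hH'1
  have key : ∀ q a b, ‖θ q - H' a‖ < ε / 4 → ‖μ n a - b‖ < ε / 4 → ‖ω (θ q) - b‖ < ε := by
    intro q a b h1 h2
    have h3 : ω (θ q) - b = ω (θ q - H' a) + (μ n a - b) := by
      rw [map_sub, hω]; abel
    rw [h3]
    refine (norm_add_le _ _).trans_lt ?_
    linarith [NonUnitalStarAlgHom.norm_apply_le ω (θ q - H' a)]
  refine ⟨Q, _, α, ω.comp θ, hQfg, hQ, fun g hg => key _ _ _ (hθ g hg) (hβ g hg),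
    fun g hg => ?_, fun a ha => ?_⟩
  · have h1 : ‖H' (β g)‖ ≤ ‖iterHom γ n m (β g)‖ :=
      NonUnitalStarAlgHom.norm_apply_le ((reverseHom _).comp H) _
    have h2 := hα g hg
    rw [NonUnitalStarAlgHom.comp_apply] at h2
    linarith [hm g hg, hβ g hg, norm_le_norm_add_norm_sub' (μ n (β g)) (φ g)]
  · obtain ⟨q, hq⟩ := hF _ (Finset.mem_image_of_mem _ ha)
    exact ⟨q, key _ _ _ hq (hc a ha)⟩

end System

end

section

theorem lipschitzWith_one_starHom {C D : Type*} [NonUnitalCStarAlgebra C] [NonUnitalCStarAlgebra D]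
    (π : C →⋆ₙₐ[ℂ] D) : LipschitzWith 1 π :=
  LipschitzWith.mk_one fun x y => by
    rw [dist_eq_norm, dist_eq_norm, ← map_sub]
    exact NonUnitalStarAlgHom.norm_apply_le π (x - y)

theorem cauchySeq_of_dense {P A : Type*} [NonUnitalCStarAlgebra P] [NonUnitalCStarAlgebra A]
    (f : ℕ → P →⋆ₙₐ[ℂ] A) {S : Set P} (hS : Dense S)
    (h : ∀ p ∈ S, CauchySeq fun n => f n p) (p : P) : CauchySeq fun n => f n p := by
  refine Metric.cauchySeq_iff'.2 fun ε hε => ?_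
  obtain ⟨q, hq, hpq⟩ := hS.exists_dist_lt p (by positivity : 0 < ε / 3)
  obtain ⟨N, hN⟩ := Metric.cauchySeq_iff'.1 (h q hq) (ε / 3) (by positivity)
  refine ⟨N, fun n hn => ?_⟩
  have hd : ∀ n, dist (f n p) (f n q) < ε / 3 := fun n =>
    (((lipschitzWith_one_starHom (f n)).dist_le_mul p q).trans (by simp)).trans_lt hpq
  have h1 := hd N
  rw [dist_comm] at h1
  linarith [dist_triangle4 (f n p) (f n q) (f N q) (f N p), hd n, hN n hn]

/-- The pointwise limit of a sequence of *-homomorphisms. -/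
def limHom {P A : Type*} [NonUnitalCStarAlgebra P] [NonUnitalCStarAlgebra A]
    (f : ℕ → P →⋆ₙₐ[ℂ] A) (g : P → A) (h : ∀ p, Tendsto (fun n => f n p) atTop (𝓝 (g p))) :
    P →⋆ₙₐ[ℂ] A where
  toFun := g
  map_smul' c p := tendsto_nhds_unique (h _) (by simpa using (h p).const_smul c)
  map_zero' := tendsto_nhds_unique (h _) (by simp)
  map_add' p q := tendsto_nhds_unique (h _) (by simpa using (h p).add (h q))
  map_mul' p q := tendsto_nhds_unique (h _) (by simpa using (h p).mul (h q))
  map_star' p := tendsto_nhds_unique (h _) (by simpa [map_star] using (h p).star)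

section Intertwining

variable {A : Type u} [NonUnitalCStarAlgebra A] {X : ℕ → Type u}
  [∀ k, NonUnitalCStarAlgebra (X k)]

theorem apply_iterHom_succ {Z : Type*} (α : ∀ k, X k →⋆ₙₐ[ℂ] X (k + 1)) (k n : ℕ) (p : X k)
    (Ψ : ∀ m, X m → Z) :
    Ψ (k + 1 + n) (iterHom α (k + 1) n (α k p)) = Ψ (k + (n + 1)) (iterHom α k (n + 1) p) := by
  induction n generalizing Ψ with
  | zero => rfl
  | succ n ih => exact ih fun m x => Ψ (m + 1) (α m x)

theorem exists_isInductiveLimit_of_approx (α : ∀ k, X k →⋆ₙₐ[ℂ] X (k + 1))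
    (φ : ∀ k, X k →⋆ₙₐ[ℂ] A) (G : ∀ k, ℕ → Set (X k)) (hmono : ∀ k, Monotone (G k))
    (hdense : ∀ k, Dense (⋃ i, G k i)) (hG : ∀ k i, ∀ g ∈ G k i, α k g ∈ G (k + 1) i)
    (hφ : ∀ k, ∀ g ∈ G k k, ‖φ (k + 1) (α k g) - φ k g‖ ≤ (1 / 2) ^ k)
    (hα : ∀ k, ∀ g ∈ G k k, ‖α k g‖ ≤ ‖φ k g‖ + (1 / 2) ^ k)
    (hF : ∀ a : A, ∀ ε > 0, ∀ K, ∃ k ≥ K, ∃ q ∈ G k 0, ‖φ k q - a‖ < ε) :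
    ∃ ν : ∀ k, X k →⋆ₙₐ[ℂ] A, IsInductiveLimit α A ν := by
  let f : ∀ k, ℕ → X k →⋆ₙₐ[ℂ] A := fun k n => (φ (k + n)).comp (iterHom α k n)
  have hiter : ∀ k i n, ∀ g ∈ G k i, iterHom α k n g ∈ G (k + n) i := by
    intro k i n g hg
    induction n with
    | zero => exact hg
    | succ n ih => exact hG _ _ _ ih
  have hdist : ∀ k i n, i ≤ k + n → ∀ g ∈ G k i, dist (f k n g) (f k (n + 1) g) ≤
      (1 / 2) ^ (k + n) := by
    intro k i n hin g hg
    rw [dist_comm, dist_eq_norm]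
    exact hφ _ _ (hmono _ hin (hiter k i n g hg))
  have hcauchy : ∀ k p, CauchySeq fun n => f k n p := by
    intro k
    refine cauchySeq_of_dense (f k) (hdense k) fun g hg => ?_
    obtain ⟨i, hi⟩ := mem_iUnion.1 hg
    refine (cauchySeq_shift i).1 (cauchySeq_of_le_geometric (1 / 2) 1 (by norm_num) fun n => ?_)
    have h1 := hdist k i (n + i) (by omega) g hi
    rw [add_right_comm n 1 i, one_mul]
    exact h1.trans (pow_le_pow_of_le_one (by norm_num) (by norm_num) (by omega))
  choose g hg using fun k p => cauchySeq_tendsto_of_complete (hcauchy k p)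
  let ν : ∀ k, X k →⋆ₙₐ[ℂ] A := fun k => limHom (f k) (g k) (hg k)
  have hν : ∀ k p, Tendsto (fun n => f k n p) atTop (𝓝 (ν k p)) := hg
  refine ⟨ν, fun k => ?_, fun a => ?_, fun k a => ?_⟩
  · ext p
    have h1 : Tendsto (fun n => f k (n + 1) p) atTop (𝓝 (ν k p)) :=
      (hν k p).comp (tendsto_add_atTop_nat 1)
    refine tendsto_nhds_unique (hν (k + 1) (α k p)) (h1.congr fun n => ?_)
    exact (apply_iterHom_succ α k n p fun m x => φ m x).symm
  · refine Metric.mem_closure_iff.2 fun ε hε => ?_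
    obtain ⟨K, hK⟩ := exists_pow_lt_of_lt_one (by positivity : 0 < ε / 4)
      (by norm_num : (1 / 2 : ℝ) < 1)
    obtain ⟨k, hk, q, hq, hqa⟩ := hF a (ε / 2) (by positivity) K
    refine ⟨ν k q, mem_iUnion.2 ⟨k, q, rfl⟩, ?_⟩
    have h1 := dist_le_of_le_geometric_of_tendsto₀ (1 / 2) ((1 / 2) ^ k) (by norm_num)
      (fun n => (hdist k 0 n (by omega) q hq).trans (pow_add _ _ _).le) (hν k q)
    have h2 : f k 0 q = φ k q := rfl
    have h3 : (1 / 2 : ℝ) ^ k ≤ (1 / 2) ^ K :=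
      pow_le_pow_of_le_one (by norm_num) (by norm_num) hk
    rw [h2] at h1
    rw [← dist_eq_norm, dist_comm] at hqa
    have h4 : (1 / 2 : ℝ) ^ k / (1 - 1 / 2) = 2 * (1 / 2) ^ k := by ring
    linarith [dist_triangle a (φ k q) (ν k q)]
  · have hL : ∀ n, LipschitzWith 1 fun p => ‖iterHom α k n p‖ := fun n => by
      have h := lipschitzWith_one_norm.comp (lipschitzWith_one_starHom (iterHom α k n))
      rwa [one_mul] at h
    have hcl := (LipschitzWith.uniformEquicontinuous _ 1 hL).equicontinuous.isClosed_setOfPred_tendsto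
      (l := atTop) (continuous_starHom (ν k)).norm
    refine hcl.closure_subset_iff.2 ?_ (hdense k a)
    refine iUnion_subset fun i p hp => ?_
    have hpow : Tendsto (fun n => (1 / 2 : ℝ) ^ (k + n)) atTop (𝓝 0) :=
      (tendsto_pow_atTop_nhds_zero_of_lt_one (by norm_num) (by norm_num)).comp
        (tendsto_atTop_mono (fun n => Nat.le_add_left n k) tendsto_id)
    have hup : Tendsto (fun n => ‖f k n p‖ + (1 / 2) ^ (k + n)) atTop (𝓝 ‖ν k p‖) := by
      have h := (hν k p).norm.add hpow
      rwa [add_zero] at h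
    have hlow : Tendsto (fun n => ‖f k (n + 1) p‖) atTop (𝓝 ‖ν k p‖) :=
      ((hν k p).comp (tendsto_add_atTop_nat 1)).norm
    refine (tendsto_add_atTop_iff_nat 1).1
      (tendsto_of_tendsto_of_tendsto_of_le_of_le' hlow hup ?_ ?_)
    · exact Eventually.of_forall fun n =>
        NonUnitalStarAlgHom.norm_apply_le (φ (k + (n + 1))) (iterHom α k (n + 1) p)
    · filter_upwards [eventually_ge_atTop i] with n hn
      exact hα _ _ (hmono _ (by omega) (hiter k i n p hp))

end Intertwining

end

section

/-- A finitely generated projective C*-algebra over `A`, with an exhaustion by finite sets of a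
dense subset. -/
structure Stage (A : Type u) [NonUnitalCStarAlgebra A] : Type (u + 1) where
  X : Type u
  inst : NonUnitalCStarAlgebra X
  φ : X →⋆ₙₐ[ℂ] A
  G : ℕ → Finset X
  mono : Monotone G
  dense : Dense (⋃ i, (G i : Set X))
  fg : IsFinitelyGeneratedCStar X
  projective : IsProjective X

attribute [instance] Stage.inst

open TopologicalSpace in
theorem exists_exhaustion {P : Type*} [NonUnitalCStarAlgebra P] (h : IsFinitelyGeneratedCStar P)
    (G : ℕ → Finset P) (hG : Monotone G) (F : Finset P) :
    ∃ G' : ℕ → Finset P, Monotone G' ∧ Dense (⋃ i, (G' i : Set P)) ∧ (∀ i, G i ⊆ G' i) ∧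
      F ⊆ G' 0 := by
  classical
  have := separableSpace_of_isFinitelyGenerated h
  refine ⟨fun i => G i ∪ F ∪ (Finset.range (i + 1)).image (denseSeq P), ?_, ?_, ?_, ?_⟩
  · intro i j hij
    exact Finset.union_subset_union (Finset.union_subset_union (hG hij) subset_rfl)
      (Finset.image_subset_image (Finset.range_mono (by omega)))
  · refine (denseRange_denseSeq P).mono (range_subset_iff.2 fun i => mem_iUnion.2 ⟨i, ?_⟩)
    exact Finset.mem_union_right _ (Finset.mem_image_of_mem _ (by simp))
  · exact fun i => Finset.subset_union_left.trans Finset.subset_union_left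
  · exact Finset.subset_union_right.trans Finset.subset_union_left

section System

variable {A : Type u} [NonUnitalCStarAlgebra A] {Ak : ℕ → Type u}
  [∀ k, NonUnitalCStarAlgebra (Ak k)] {γ : ∀ k, Ak k →⋆ₙₐ[ℂ] Ak (k + 1)}
  {μ : ∀ k, Ak k →⋆ₙₐ[ℂ] A}

/-- The conditions on a connecting morphism between consecutive stages. -/
structure Stage.IsStep (F : Finset A) (k : ℕ) (s t : Stage A) (α : s.X →⋆ₙₐ[ℂ] t.X) : Prop where
  map_mem : ∀ i, ∀ g ∈ s.G i, α g ∈ t.G i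
  norm_sub_le : ∀ g ∈ s.G k, ‖t.φ (α g) - s.φ g‖ ≤ (1 / 2) ^ k
  norm_le : ∀ g ∈ s.G k, ‖α g‖ ≤ ‖s.φ g‖ + (1 / 2) ^ k
  exists_near : ∀ a ∈ F, ∃ q ∈ t.G 0, ‖t.φ q - a‖ < (1 / 2) ^ k

theorem Stage.exists_isStep (hlim : IsInductiveLimit γ A μ) (hnull : ∀ k, NullHomotopic (γ k))
    (F : Finset A) (k : ℕ) (s : Stage A) : ∃ (t : Stage A) (α : s.X →⋆ₙₐ[ℂ] t.X),
      s.IsStep F k t α := by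
  classical
  obtain ⟨Q, _, α, ψ, hQfg, hQ, hd, hn, hF⟩ := exists_projective_factor hlim hnull s.fg
    s.projective s.φ (s.G k) F (by positivity : (0 : ℝ) < (1 / 2) ^ k)
  choose! q hq using hF
  obtain ⟨G', hmono, hdense, hGG', hFG'⟩ := exists_exhaustion hQfg (fun i => (s.G i).image α)
    (fun i j hij => Finset.image_subset_image (s.mono hij)) (F.image q)
  exact ⟨⟨Q, _, ψ, G', hmono, hdense, hQfg, hQ⟩, α,
    fun i g hg => hGG' i (Finset.mem_image_of_mem _ hg), fun g hg => (hd g hg).le, hn,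
    fun a ha => ⟨q a, hFG' (Finset.mem_image_of_mem _ ha), hq a ha⟩⟩

theorem Stage.nonempty (A : Type u) [NonUnitalCStarAlgebra A] : Nonempty (Stage A) := by
  have hT : BoundsVars (∅ : Set (Term Empty)) := fun i => i.elim
  obtain ⟨Q, _, y, hy⟩ := exists_isUniversalSolution.{u} (0 : Empty → ℕ) ∅ 1 hT one_pos
  have hfg := isFinitelyGenerated_of_dense hy.dense
  obtain ⟨G, hmono, hdense, -⟩ := exists_exhaustion hfg (fun _ => ∅) monotone_const ∅
  exact ⟨⟨Q, _, 0, G, hmono, hdense, hfg, hy.isProjective finite_empty hT one_pos le_rfl⟩⟩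

end System

end

end TrivialShape
end

open TopologicalSpace in
/-- If a separable C*-algebra `A` is an inductive limit of a system with null-homotopic
connecting morphisms, then `A` is an inductive limit of finitely generated projective
C*-algebras. -/
theorem nullHomotopic_system_implies_limit_of_fg_projectives
    (A : Type u) [NonUnitalCStarAlgebra A] [SeparableSpace A]
    (Ak : ℕ → Type u) [∀ k, NonUnitalCStarAlgebra (Ak k)]
    (γ : ∀ k, Ak k →⋆ₙₐ[ℂ] Ak (k + 1)) (μ : ∀ k, Ak k →⋆ₙₐ[ℂ] A)
    (hlim : IsInductiveLimit γ A μ)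
    (hnull : ∀ k, NullHomotopic (γ k)) :
    ∃ (S : CStarInductiveSystem.{u}) (ν : ∀ k, S.X k →⋆ₙₐ[ℂ] A),
      IsInductiveLimit S.conn A ν ∧
      ∀ k, IsFinitelyGeneratedCStar (S.X k) ∧ IsProjective (S.X k) := by
  classical
  obtain ⟨s₀⟩ := TrivialShape.Stage.nonempty A
  let F : ℕ → Finset A := fun k => (Finset.range (k + 1)).image (denseSeq A)
  choose next α hα using fun k (s : TrivialShape.Stage A) => s.exists_isStep hlim hnull (F k) k
  let st : ℕ → TrivialShape.Stage A := fun k => Nat.rec s₀ next k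
  have hst : ∀ k, (st k).IsStep (F k) k (st (k + 1)) (α k (st k)) := fun k => hα k (st k)
  obtain ⟨ν, hν⟩ := @TrivialShape.exists_isInductiveLimit_of_approx A _
    (fun k => (st k).X) (fun k => (st k).inst) (fun k => α k (st k)) (fun k => (st k).φ)
    (fun k i => (st k).G i) (fun k i j hij => (st k).mono hij) (fun k => (st k).dense)
    (fun k => (hst k).map_mem) (fun k => (hst k).norm_sub_le) (fun k => (hst k).norm_le)
    (fun a ε hε K => by
      obtain ⟨m, hm⟩ := (denseRange_denseSeq A).exists_dist_lt a (by positivity : 0 < ε / 2)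
      obtain ⟨n, hn⟩ := exists_pow_lt_of_lt_one (by positivity : 0 < ε / 2)
        (by norm_num : (1 / 2 : ℝ) < 1)
      let k := max K (max m n)
      obtain ⟨q, hq, hqa⟩ := (hst k).exists_near (denseSeq A m)
        (Finset.mem_image_of_mem _ (Finset.mem_range.2 (by omega)))
      refine ⟨k + 1, by omega, q, hq, ?_⟩
      have h1 : (1 / 2 : ℝ) ^ k ≤ (1 / 2) ^ n :=
        pow_le_pow_of_le_one (by norm_num) (by norm_num) (by omega)
      rw [← dist_eq_norm] at hqa ⊢
      rw [dist_comm] at hm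
      linarith [dist_triangle ((st (k + 1)).φ q) (denseSeq A m) a])
  exact ⟨⟨fun k => (st k).X, fun k => (st k).inst, fun k => α k (st k)⟩, ν, hν, fun k => ⟨(st k).fg, (st k).projective⟩⟩
end
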